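/- Let M, N, P ≥ 4 be integers, at least one of which is even, and suppose it is not the case that two of M, N, P equal 4 while the third is odd. Then the Artin group A_{MNP} is residually finite. -/

import Mathlib

/-- The alternating word (a,b)_M = abab⋯ of length M in the free group. -/
def altWord {V : Type} (a b : V) (M : ℕ) : FreeGroup V :=
  ((List.range M).map fun i => if i % 2 = 0 then FreeGroup.of a else FreeGroup.of b).prod

/-- The relators of the Artin group A_{MNP} on three generators a = 0, b = 1, c = 2. -/
def artinRels3 (M N P : ℕ) : Set (FreeGroup (Fin 3)) :=
  {altWord 0 1 M * (altWord 1 0 M)⁻¹,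
   altWord 1 2 N * (altWord 2 1 N)⁻¹,
   altWord 2 0 P * (altWord 0 2 P)⁻¹}

/-- The Artin group A_{MNP}. -/
abbrev Artin3 (M N P : ℕ) : Type := PresentedGroup (artinRels3 M N P)

/-- A group is residually finite if every nontrivial element survives in some finite quotient. -/
def ResiduallyFinite (G : Type*) [Group G] : Prop :=
  ∀ g : G, g ≠ 1 → ∃ (Q : Type) (_ : Group Q) (_ : Finite Q) (φ : G →* Q), φ g ≠ 1


open Equiv

/-- Abstract pairing lemma: extending an action of `C` by a twisted square root of `η`. -/
theorem exists_twisted_root {C X : Type} [Group C] (γ : C →* Perm X) (φ : C →* C) (η : C)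
    (hφη : φ η = η) (hφφ : ∀ c, φ (φ c) = η * c * η⁻¹)
    (hst : ∀ c p q, γ c p = p → γ (φ c) q = q)
    (base τ : X → X) (o : X → Bool)
    (hb1 : ∀ c p, base (γ c p) = base p) (hb2 : ∀ p, ∃ c, p = γ c (base p))
    (hτb : ∀ p, base p = p → base (τ p) = τ p)
    (hττ : ∀ p, base p = p → τ (τ p) = p)
    (ho : ∀ p, base p = p → o (τ p) = !(o p)) :
    ∃ π : Perm X, π * π = γ η ∧ (∀ c, π * γ c = γ (φ c) * π) ∧
      ∀ p, base p = p → o p = true → π p = τ p := by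
  choose κ hκ using hb2
  have hbb : ∀ p, base (base p) = base p := fun p => by
    conv_rhs => rw [hκ p, hb1]
  let δ : X → C := fun p => if o p then 1 else η
  have hδ : ∀ p, base p = p → φ (δ p) * δ (τ p) = η := by
    intro p hp
    simp only [δ, ho p hp]
    cases o p <;> simp [hφη]
  -- the function
  let f : X → X := fun p => γ (φ (κ p) * δ (base p)) (τ (base p))
  have hf : ∀ c p, base p = p → f (γ c p) = γ (φ c * δ p) (τ p) := by
    intro c p hp
    have h1 : base (γ c p) = p := by rw [hb1, hp]
    have h2 : γ c p = γ (κ (γ c p)) p := by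
      have := hκ (γ c p)
      rw [h1] at this
      exact this
    simp only [f, h1]
    generalize κ (γ c p) = k at h2
    have h3 : γ (c⁻¹ * k) p = p := by
      rw [map_mul, Perm.mul_apply, ← h2, ← Perm.mul_apply, ← map_mul]; simp
    have h4 := hst _ _ (γ (δ p) (τ p)) h3
    rw [map_mul, map_mul, Perm.mul_apply, map_inv, map_inv] at h4
    rw [Perm.inv_eq_iff_eq] at h4
    rw [map_mul, map_mul, Perm.mul_apply, Perm.mul_apply, h4]
  have hff : ∀ p, f (f p) = γ η p := by
    intro p
    have e1 : p = γ (κ p) (base p) := hκ p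
    have e2 : f p = γ (φ (κ p) * δ (base p)) (τ (base p)) := rfl
    rw [e2, hf _ _ (hτb _ (hbb p)), hττ _ (hbb p)]
    conv_rhs => rw [e1]
    rw [map_mul φ, hφφ, mul_assoc, hδ _ (hbb p), ← Perm.mul_apply, ← map_mul]
    simp
  have hfc : ∀ c p, f (γ c p) = γ (φ c) (f p) := by
    intro c p
    conv_lhs => rw [hκ p, ← Perm.mul_apply, ← map_mul]
    rw [hf _ _ (hbb p)]
    simp [f]
  have hbij : Function.Bijective f := by
    have : Function.Bijective (f ∘ f) := by
      have : f ∘ f = γ η := funext hff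
      rw [this]; exact (γ η).bijective
    exact ⟨Function.Injective.of_comp this.1, Function.Surjective.of_comp this.2⟩
  refine ⟨Equiv.ofBijective f hbij, ?_, ?_, ?_⟩
  · ext p; exact hff p
  · intro c; ext p; exact hfc c p
  · intro p hp hop
    have := hf 1 p hp
    simpa [δ, hop] using this

section Core

variable {A C G : Type} [Group A] [Group C] [Group G]

/-- the alternating product `j a₀ h j a₁ h ⋯ h j aₖ` -/
def Wd (j : A →* G) (h : G) (a : ℕ → A) : ℕ → G
  | 0 => j (a 0)
  | n + 1 => Wd j h a n * h * j (a (n + 1))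

theorem Wd_congr (j : A →* G) (h : G) (a b : ℕ → A) (n : ℕ) (hab : ∀ i ≤ n, a i = b i) :
    Wd j h a n = Wd j h b n := by
  induction n with
  | zero => simp [Wd, hab 0 le_rfl]
  | succ n ih => simp [Wd, hab (n+1) le_rfl, ih fun i hi => hab i (by omega)]

theorem Wd_update (j : A →* G) (h : G) (a : ℕ → A) (n : ℕ) (x : A) :
    Wd j h (Function.update a n (a n * x)) n = Wd j h a n * j x := by
  cases n with
  | zero => simp [Wd]
  | succ n =>
    simp only [Wd, Function.update_self, map_mul]
    rw [Wd_congr j h _ a n]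
    · simp [mul_assoc]
    · intro i hi
      rw [Function.update_of_ne (by omega)]

/-- normal forms -/
theorem exists_Wd (j : A →* G) (ι : C →* A) (φ : C →* C) (η : C) (h : G)
    (hh : h * h = j (ι η)) (hc : ∀ c, h * j (ι c) = j (ι (φ c)) * h)
    (hgen : Subgroup.closure (Set.range j ∪ {h}) = ⊤) (g : G) :
    ∃ (k : ℕ) (a : ℕ → A), g = Wd j h a k ∧ ∀ i, 1 ≤ i → i < k → a i ∉ ι.range := by
  have hj : ∀ g : G, ∀ x, (∃ (k : ℕ) (a : ℕ → A), g = Wd j h a k ∧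
      ∀ i, 1 ≤ i → i < k → a i ∉ ι.range) → (∃ (k : ℕ) (a : ℕ → A), g * j x = Wd j h a k ∧
      ∀ i, 1 ≤ i → i < k → a i ∉ ι.range) := by
    rintro _ x ⟨k, a, rfl, ha⟩
    refine ⟨k, Function.update a k (a k * x), (Wd_update ..).symm, ?_⟩
    intro i h1 h2
    rw [Function.update_of_ne (by omega)]
    exact ha i h1 h2
  have hhs : ∀ g : G, (∃ (k : ℕ) (a : ℕ → A), g = Wd j h a k ∧
      ∀ i, 1 ≤ i → i < k → a i ∉ ι.range) → (∃ (k : ℕ) (a : ℕ → A), g * h = Wd j h a k ∧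
      ∀ i, 1 ≤ i → i < k → a i ∉ ι.range) := by
    rintro _ ⟨k, a, rfl, ha⟩
    by_cases hk : 1 ≤ k ∧ a k ∈ ι.range
    · obtain ⟨hk1, c, hc'⟩ := hk
      obtain ⟨k, rfl⟩ : ∃ l, k = l + 1 := ⟨k - 1, by omega⟩
      have : Wd j h a (k + 1) * h = Wd j h a k * j (ι (φ c) * ι η) := by
        simp only [Wd, ← hc', map_mul, ← hh]
        rw [mul_assoc (Wd j h a k), hc]
        simp [mul_assoc]
      rw [this]
      exact hj _ _ ⟨k, a, rfl, fun i h1 h2 => ha i h1 (by omega)⟩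
    · refine ⟨k + 1, Function.update a (k+1) 1, ?_, ?_⟩
      · simp only [Wd, Function.update_self, map_one, mul_one]
        rw [Wd_congr j h (Function.update a (k + 1) 1) a k]
        intro i hi
        rw [Function.update_of_ne (by omega)]
      · intro i h1 h2
        rw [Function.update_of_ne (by omega)]
        by_cases hik : i = k
        · subst hik
          tauto
        · exact ha i h1 (by omega)
  have hmem : g ∈ Subgroup.closure (Set.range j ∪ {h}) := by rw [hgen]; trivial
  induction hmem using Subgroup.closure_induction_right with
  | one => exact ⟨0, fun _ => 1, by simp [Wd], by intros; omega⟩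
  | mul_right x _ y hy ih =>
    rcases hy with ⟨a, rfl⟩ | rfl
    · exact hj _ _ ih
    · exact hhs _ ih
  | mul_inv_cancel x _ y hy ih =>
    rcases hy with ⟨a, rfl⟩ | hy
    · rw [← map_inv]; exact hj _ _ ih
    · obtain rfl : y = h := hy
      have : x * y⁻¹ = x * j (ι η)⁻¹ * y := by
        rw [map_inv, ← hh]; group
      rw [this]
      exact hhs _ (hj _ _ ih)

/-- Good finite index normal subgroups separate `W`. -/
theorem exists_rep_of_good (j : A →* G) (ι : C →* A) (φ : C →* C) (η : C) (h : G)
    (hφη : φ η = η) (hφφ : ∀ c, φ (φ c) = η * c * η⁻¹)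
    (UP : ∀ (E : Type) [Finite E] (α : A →* Perm E) (π : Perm E), π * π = α (ι η) →
      (∀ c, π * α (ι c) = α (ι (φ c)) * π) → ∃ F : G →* Perm E, (∀ a, F (j a) = α a) ∧ F h = π)
    (V : Subgroup A) [V.Normal] [V.FiniteIndex] (hV : ∀ c, ι c ∈ V → ι (φ c) ∈ V)
    (k : ℕ) (a : ℕ → A) (ha : ∀ i, 1 ≤ i → i < k → ∀ c, (ι c)⁻¹ * a i ∉ V)
    (h0 : k = 0 → a 0 ∉ V) :
    ∃ (E : Type) (_ : Finite E) (F : G →* Perm E), F (Wd j h a k) ≠ 1 := by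
  classical
  let Q := A ⧸ V
  have : Finite Q := inferInstance
  let X := Q × Fin (k + 1) × Bool
  have : Finite X := inferInstance
  let α : A →* Perm X :=
    { toFun := fun x => (MulAction.toPerm x : Perm Q).prodCongr (Equiv.refl _)
      map_one' := by ext p <;> simp
      map_mul' := by intro x y; ext p <;> simp [mul_smul] }
  have hα : ∀ x q f, α x (q, f) = (x • q, f) := fun x q f => rfl
  have hcoe : ∀ x y : A, x • ((y : A) : Q) = ((x * y : A) : Q) := fun _ _ => rfl
  -- orbits
  let rel : Q → Q → Prop := fun q q' => ∃ c, q = ι c • q'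
  have rel_refl : ∀ q, rel q q := fun q => ⟨1, by simp⟩
  have rel_symm : ∀ q q', rel q q' → rel q' q := by
    rintro q q' ⟨c, rfl⟩; exact ⟨c⁻¹, by simp⟩
  have rel_trans : ∀ q r s, rel q r → rel r s → rel q s := by
    rintro _ _ q ⟨c, rfl⟩ ⟨d, rfl⟩; exact ⟨c * d, by simp [mul_smul]⟩
  let S : Setoid Q := ⟨rel, rel_refl, fun {_ _} => rel_symm _ _, fun {_ _ _} => rel_trans _ _ _⟩
  let out : Q → Q := fun q => (Quotient.mk S q).out
  have out_rel : ∀ q, rel q (out q) := fun q => rel_symm _ _ (Quotient.mk_out (s := S) q)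
  have out_eq : ∀ q q', rel q q' → out q = out q' := by
    intro q q' hqq
    have : Quotient.mk S q = Quotient.mk S q' := Quotient.sound hqq
    simp only [out, this]
  let ab : ℕ → Q := fun i => ((a i : A) : Q)
  let one : Q := ((1 : A) : Q)
  have hne : ∀ i, 1 ≤ i → i < k → ¬ rel one (ab i) := by
    intro i h1 h2 hr
    obtain ⟨c, hc⟩ := rel_symm _ _ hr
    have : ((ι c : A) : Q) = (a i : A) := by rw [← mul_one (ι c), ← hcoe]; exact hc.symm
    exact ha i h1 h2 c (QuotientGroup.eq.1 this)
  let bs : ℕ → Q → Q := fun f q =>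
    if 1 ≤ f ∧ rel q (ab f) then ab f else if rel q one then one else out q
  have bs_rel : ∀ f q, rel q (bs f q) := by
    intro f q
    simp only [bs]
    split_ifs with h1 h2
    · exact h1.2
    · exact h2
    · exact out_rel q
  have bs_eq : ∀ f q q', rel q q' → bs f q = bs f q' := by
    intro f q q' hqq
    have e1 : ∀ t, rel q t ↔ rel q' t := fun t =>
      ⟨rel_trans _ _ _ (rel_symm _ _ hqq), rel_trans _ _ _ hqq⟩
    simp only [bs, e1, out_eq _ _ hqq]
  have bs_ab : ∀ f, 1 ≤ f → bs f (ab f) = ab f := by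
    intro f hf; simp only [bs, hf, rel_refl, and_self, if_true]
  have bs_one : ∀ f, (f = 0 ∨ f < k) → bs f one = one := by
    intro f hf
    simp only [bs]
    split_ifs with h1 h2
    · exfalso; exact hne f h1.1 (by omega) h1.2
    · rfl
    · exact absurd (rel_refl one) h2
  have ab_ne : ∀ f, 1 ≤ f → f < k → one ≠ ab f := by
    intro f h1 h2 he; exact hne f h1 h2 (he ▸ rel_refl _)
  let base : X → X := fun p => (bs p.2.1 p.1, p.2)
  let τ : X → X := fun p =>
    if 1 ≤ p.2.1.1 ∧ p.1 = ab p.2.1 then (one, ⟨p.2.1.1 - 1, by have := p.2.1.2; omega⟩, p.2.2)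
    else if hk : p.2.1.1 < k ∧ p.1 = one then (ab (p.2.1.1 + 1), ⟨p.2.1.1 + 1, by omega⟩, p.2.2)
    else (p.1, p.2.1, !p.2.2)
  let o : X → Bool := fun p =>
    if 1 ≤ p.2.1.1 ∧ p.1 = ab p.2.1 then true
    else if p.2.1.1 < k ∧ p.1 = one then false else p.2.2
  have hroot : ∃ π : Perm X, π * π = α (ι η) ∧ (∀ c, π * α (ι c) = α (ι (φ c)) * π) ∧
      ∀ p, base p = p → o p = true → π p = τ p := by
    refine exists_twisted_root (α.comp ι) φ η hφη hφφ ?_ base τ o ?_ ?_ ?_ ?_ ?_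
    · rintro c ⟨q, f⟩ ⟨q', f'⟩ hc
      have hc : ι c • q = q := congrArg Prod.fst hc
      suffices hs : ι (φ c) • q' = q' by
        change (ι (φ c) • q', f') = (q', f'); rw [hs]
      induction q using QuotientGroup.induction_on with
      | H x =>
      induction q' using QuotientGroup.induction_on with
      | H y =>
      have h1 : ι c ∈ V := by
        have h2 := QuotientGroup.eq.1 ((hcoe _ _).symm.trans hc).symm
        have h3 := (inferInstance : V.Normal).conj_mem _ h2 x
        simpa [mul_assoc] using h3
      have h2 := (inferInstance : V.Normal).conj_mem _ (hV _ h1) y⁻¹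
      rw [hcoe]
      apply Eq.symm
      rw [QuotientGroup.eq]
      simpa [mul_assoc] using h2
    · rintro c ⟨q, f⟩
      simp only [MonoidHom.comp_apply, hα, base]
      rw [bs_eq f.1 (ι c • q) q ⟨c, rfl⟩]
    · rintro ⟨q, f⟩
      obtain ⟨c, hc⟩ := bs_rel f.1 q
      exact ⟨c, by simp only [MonoidHom.comp_apply, hα, base]; rw [← hc]⟩
    · rintro ⟨q, ⟨f, hf⟩, e⟩ hp
      replace hp : bs f q = q := congrArg Prod.fst hp
      simp only [τ]
      split_ifs with h1 h2
      · simp only [base]; rw [bs_one _ (by omega)]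
      · simp only [base]; rw [bs_ab _ (by omega)]
      · simp only [base]; rw [hp]
    · rintro ⟨q, ⟨f, hf⟩, e⟩ hp
      replace hp : bs f q = q := congrArg Prod.fst hp
      by_cases h1 : 1 ≤ f ∧ q = ab f
      · have e1 : τ (q, ⟨f, hf⟩, e) = (one, ⟨f - 1, by omega⟩, e) := by simp only [τ]; rw [if_pos h1]
        rw [e1]
        simp only [τ]
        rw [if_neg, dif_pos (⟨by omega, trivial⟩)]
        · obtain ⟨f, rfl⟩ : ∃ l, f = l + 1 := ⟨f - 1, by omega⟩
          simp [h1.2]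
        · rintro ⟨h2, h3⟩
          exact ab_ne _ h2 (by omega) h3
      · by_cases h2 : f < k ∧ q = one
        · have e1 : τ (q, ⟨f, hf⟩, e) = (ab (f+1), ⟨f + 1, by omega⟩, e) := by
            simp only [τ]; rw [if_neg h1, dif_pos h2]
          rw [e1]
          simp only [τ]
          rw [if_pos (⟨by omega, trivial⟩)]
          simp [h2.2]
        · have e1 : ∀ e, τ (q, ⟨f, hf⟩, e) = (q, ⟨f, hf⟩, !e) := by
            intro e
            simp only [τ]; rw [if_neg h1, dif_neg h2]
          rw [e1, e1]; simp
    · rintro ⟨q, ⟨f, hf⟩, e⟩ hp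
      replace hp : bs f q = q := congrArg Prod.fst hp
      by_cases h1 : 1 ≤ f ∧ q = ab f
      · have e1 : τ (q, ⟨f, hf⟩, e) = (one, ⟨f - 1, by omega⟩, e) := by simp only [τ]; rw [if_pos h1]
        rw [e1]
        simp only [o]
        rw [if_neg, if_pos (⟨by omega, trivial⟩), if_pos h1]
        · rfl
        · rintro ⟨h2, h3⟩
          exact ab_ne _ h2 (by omega) h3
      · by_cases h2 : f < k ∧ q = one
        · have e1 : τ (q, ⟨f, hf⟩, e) = (ab (f+1), ⟨f + 1, by omega⟩, e) := by
            simp only [τ]; rw [if_neg h1, dif_pos h2]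
          rw [e1]
          simp only [o]
          rw [if_pos (⟨by omega, trivial⟩), if_neg h1, if_pos h2]
          rfl
        · have e1 : ∀ e, τ (q, ⟨f, hf⟩, e) = (q, ⟨f, hf⟩, !e) := by
            intro e
            simp only [τ]; rw [if_neg h1, dif_neg h2]
          rw [e1]
          simp only [o]; rw [if_neg h1, if_neg h2, if_neg h1, if_neg h2]
  obtain ⟨π, hπ1, hπ2, hπ3⟩ := hroot
  obtain ⟨F, hF1, hF2⟩ := UP X α π hπ1 hπ2
  refine ⟨X, inferInstance, F, ?_⟩
  have key : ∀ n (hn : n ≤ k), F (Wd j h a n) (one, ⟨n, by omega⟩, true)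
      = (ab 0, ⟨0, by omega⟩, true) := by
    intro n
    induction n with
    | zero =>
      intro hn
      simp only [Wd, hF1, hα, one, hcoe, ab, mul_one]
    | succ n ih =>
      intro hn
      simp only [Wd, map_mul, Perm.mul_apply, hF1, hF2, hα]
      have e1 : a (n+1) • one = ab (n+1) := by simp only [one, hcoe, ab, mul_one]
      rw [e1, hπ3]
      · simp only [τ]
        rw [if_pos (by simp)]
        exact ih (by omega)
      · simp only [base]
        rw [bs_ab _ (by omega)]
      · simp only [o]
        rw [if_pos (by simp)]
  intro hF
  have := key k le_rfl
  rw [hF] at this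
  have t1 : one = ab 0 := congrArg Prod.fst this
  have t2 : k = 0 := congrArg (fun p : X => p.2.1.1) this
  apply h0 t2
  have := QuotientGroup.eq.1 t1
  simpa using this

end Core


open Equiv
set_option linter.all false

section Core2

variable {A C G : Type} [Group A] [Group C] [Group G]

theorem finite_hom_of_fg (K S : Type) [Group K] [Group S] [Finite S] [hK : Group.FG K] :
    Finite (K →* S) := by
  obtain ⟨s, hs⟩ := (Group.fg_def.1 hK : (⊤ : Subgroup K).FG)
  apply Finite.of_injective (fun (f : K →* S) (x : s) => f x)
  intro f g hfg
  apply MonoidHom.eq_of_eqOn_dense hs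
  intro x hx
  exact congrFun hfg ⟨x, hx⟩

/-- `V` is a finite index normal subgroup compatible with `φ`. -/
def GoodV (ι : C →* A) (φ : C →* C) (V : Subgroup A) : Prop :=
  V.Normal ∧ V.FiniteIndex ∧ ∀ c, ι c ∈ V → ι (φ c) ∈ V

theorem GoodV.inf {ι : C →* A} {φ : C →* C} {V V' : Subgroup A} (h : GoodV ι φ V)
    (h' : GoodV ι φ V') : GoodV ι φ (V ⊓ V') := by
  obtain ⟨h1, h2, h3⟩ := h
  obtain ⟨h1', h2', h3'⟩ := h'
  exact ⟨inferInstance, inferInstance, fun c hc => ⟨h3 c hc.1, h3' c hc.2⟩⟩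

/-- The verbal-type subgroup killed by all homs `K → S`. -/
def VS (K : Subgroup A) (S : Type) [Group S] : Subgroup A :=
  (⨅ ψ : K →* S, ψ.ker).map K.subtype

theorem mem_VS (K : Subgroup A) (S : Type) [Group S] (a : A) :
    a ∈ VS K S ↔ ∃ h : a ∈ K, ∀ ψ : K →* S, ψ ⟨a, h⟩ = 1 := by
  simp only [VS, Subgroup.mem_map, Subgroup.mem_iInf, MonoidHom.mem_ker, Subgroup.coe_subtype]
  constructor
  · rintro ⟨⟨x, hx⟩, h1, rfl⟩
    exact ⟨hx, h1⟩
  · rintro ⟨hx, h1⟩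
    exact ⟨⟨a, hx⟩, h1, rfl⟩

theorem VS_good [Group.FG A] (ι : C →* A) (φ : C →* C) (K : Subgroup A) [hKn : K.Normal]
    [K.FiniteIndex] (hK : ∀ c, ι c ∈ K → ι (φ c) ∈ K) (r : K →* C) (hr1 : ∀ k, ι (r k) ∈ K)
    (hr2 : ∀ c (h : ι c ∈ K), r ⟨ι c, h⟩ = c) (S : Type) [Group S] [Finite S] :
    GoodV ι φ (VS K S) := by
  refine ⟨⟨?_⟩, ?_, ?_⟩
  · intro n hn g
    rw [mem_VS] at hn ⊢
    obtain ⟨h1, h2⟩ := hn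
    refine ⟨hKn.conj_mem _ h1 g, fun ψ => ?_⟩
    exact h2 (ψ.comp (MulAut.conjNormal g).toMonoidHom)
  · have : Finite (K →* S) := finite_hom_of_fg K S
    have h1 : (⨅ ψ : K →* S, ψ.ker).FiniteIndex := by
      apply Subgroup.finiteIndex_iInf
      intro ψ
      exact Subgroup.finiteIndex_ker ψ
    constructor
    rw [VS, Subgroup.index_map_subtype]
    exact mul_ne_zero h1.1 (Subgroup.FiniteIndex.index_ne_zero)
  · intro c hc
    rw [mem_VS] at hc ⊢
    obtain ⟨h1, h2⟩ := hc
    refine ⟨hK _ h1, fun ψ => ?_⟩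
    let θ : K →* K := ((ι.comp (φ.comp r)).codRestrict K (fun k => hK _ (hr1 k)))
    have := h2 (ψ.comp θ)
    have e : θ ⟨ι c, h1⟩ = ⟨ι (φ c), hK _ h1⟩ := by
      ext
      simp [θ, hr2]
    rwa [MonoidHom.comp_apply, e] at this

theorem exists_good_notin_range [Group.FG A] (hA : ResiduallyFinite A)
    (ι : C →* A) (φ : C →* C) (K : Subgroup A) [hKn : K.Normal]
    [K.FiniteIndex] (hK : ∀ c, ι c ∈ K → ι (φ c) ∈ K) (r : K →* C) (hr1 : ∀ k, ι (r k) ∈ K)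
    (hr2 : ∀ c (h : ι c ∈ K), r ⟨ι c, h⟩ = c) (a : A) (ha : a ∉ ι.range) :
    ∃ V, GoodV ι φ V ∧ ∀ c, (ι c)⁻¹ * a ∉ V := by
  by_cases hc : ∃ c, (ι c)⁻¹ * a ∈ K
  · obtain ⟨c, hc⟩ := hc
    have hne : (ι c)⁻¹ * a * (ι (r ⟨_, hc⟩))⁻¹ ≠ 1 := by
      intro h
      apply ha
      refine ⟨c * r ⟨_, hc⟩, ?_⟩
      rw [mul_inv_eq_one] at h
      rw [map_mul, ← h]; group
    obtain ⟨S, _, _, χ, hχ⟩ := hA _ hne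
    refine ⟨VS K S, VS_good ι φ K hK r hr1 hr2 S, ?_⟩
    intro d hd
    rw [mem_VS] at hd
    obtain ⟨h1, h2⟩ := hd
    have hk : ι (d⁻¹ * c) ∈ K := by
      have := K.mul_mem h1 (K.inv_mem hc)
      have e : ι (d⁻¹ * c) = (ι d)⁻¹ * a * ((ι c)⁻¹ * a)⁻¹ := by simp
      rwa [e]
    have h3 := h2 (χ.comp K.subtype)
    have h4 := h2 (χ.comp (ι.comp r))
    have e : (⟨(ι d)⁻¹ * a, h1⟩ : K) = ⟨ι (d⁻¹ * c), hk⟩ * ⟨(ι c)⁻¹ * a, hc⟩ := by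
      ext; simp
    rw [e, map_mul] at h3 h4
    simp only [MonoidHom.comp_apply, hr2, Subgroup.coe_subtype] at h3 h4
    apply hχ
    rw [map_mul, map_inv, mul_inv_eq_one]
    exact mul_left_cancel (h3.trans h4.symm)
  · push Not at hc
    refine ⟨VS K Unit, VS_good ι φ K hK r hr1 hr2 Unit, ?_⟩
    intro c h
    rw [mem_VS] at h
    exact hc c h.1

theorem exists_good_ne_one [Group.FG A] (hA : ResiduallyFinite A)
    (ι : C →* A) (φ : C →* C) (K : Subgroup A) [hKn : K.Normal]
    [K.FiniteIndex] (hK : ∀ c, ι c ∈ K → ι (φ c) ∈ K) (r : K →* C) (hr1 : ∀ k, ι (r k) ∈ K)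
    (hr2 : ∀ c (h : ι c ∈ K), r ⟨ι c, h⟩ = c) (a : A) (ha : a ≠ 1) :
    ∃ V, GoodV ι φ V ∧ a ∉ V := by
  obtain ⟨S, _, _, χ, hχ⟩ := hA _ ha
  refine ⟨VS K S, VS_good ι φ K hK r hr1 hr2 S, ?_⟩
  intro h
  rw [mem_VS] at h
  exact hχ (h.2 (χ.comp K.subtype))

theorem core_rf [Group.FG A] (hA : ResiduallyFinite A)
    (j : A →* G) (ι : C →* A) (φ : C →* C) (η : C) (h : G)
    (hφη : φ η = η) (hφφ : ∀ c, φ (φ c) = η * c * η⁻¹)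
    (hh : h * h = j (ι η)) (hc : ∀ c, h * j (ι c) = j (ι (φ c)) * h)
    (hgen : Subgroup.closure (Set.range j ∪ {h}) = ⊤)
    (UP : ∀ (E : Type) [Finite E] (α : A →* Perm E) (π : Perm E), π * π = α (ι η) →
      (∀ c, π * α (ι c) = α (ι (φ c)) * π) → ∃ F : G →* Perm E, (∀ a, F (j a) = α a) ∧ F h = π)
    (K : Subgroup A) [hKn : K.Normal]
    [K.FiniteIndex] (hK : ∀ c, ι c ∈ K → ι (φ c) ∈ K) (r : K →* C) (hr1 : ∀ k, ι (r k) ∈ K)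
    (hr2 : ∀ c (h : ι c ∈ K), r ⟨ι c, h⟩ = c) :
    ResiduallyFinite G := by
  intro g hg
  obtain ⟨k, a, rfl, ha⟩ := exists_Wd j ι φ η h hh hc hgen g
  have key : ∀ m, m ≤ k → ∃ V, GoodV ι φ V ∧ (∀ i, 1 ≤ i → i < m → ∀ c, (ι c)⁻¹ * a i ∉ V) ∧
      (k = 0 → a 0 ∉ V) := by
    intro m
    induction m with
    | zero =>
      intro _
      by_cases hk : k = 0
      · have : a 0 ≠ 1 := by
          intro h; apply hg; subst hk; simp [Wd, h]
        obtain ⟨V, hV, h1⟩ := exists_good_ne_one hA ι φ K hK r hr1 hr2 _ this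
        exact ⟨V, hV, by intros; omega, fun _ => h1⟩
      · exact ⟨VS K Unit, VS_good ι φ K hK r hr1 hr2 Unit, by intros; omega, fun h => absurd h hk⟩
    | succ m ih =>
      intro hm
      obtain ⟨V, hV, h1, h2⟩ := ih (by omega)
      by_cases hm1 : 1 ≤ m
      · obtain ⟨V', hV', h1'⟩ := exists_good_notin_range hA ι φ K hK r hr1 hr2 (a m)
          (ha m hm1 (by omega))
        refine ⟨V ⊓ V', hV.inf hV', ?_, fun h => fun h' => h2 h h'.1⟩
        intro i hi1 hi2 c hc
        by_cases him : i = m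
        · subst him; exact h1' c hc.2
        · exact h1 i hi1 (by omega) c hc.1
      · exact ⟨V, hV, by intros; omega, h2⟩
  obtain ⟨V, ⟨hV1, hV2, hV3⟩, h1, h2⟩ := key k le_rfl
  obtain ⟨E, _, F, hF⟩ := exists_rep_of_good j ι φ η h hφη hφφ UP V hV3 k a h1 h2
  exact ⟨Perm E, inferInstance, inferInstance, F, hF⟩

end Core2


open Equiv
set_option linter.all false

theorem exists_perm_extend {X : Type} [Finite X] (s : Set X) (f : X → X) (hf : Set.InjOn f s) :
    ∃ g : Perm X, ∀ x ∈ s, g x = f x := by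
  classical
  have := Fintype.ofFinite X
  obtain ⟨g, hg⟩ := Set.MapsTo.exists_equiv_extend_of_card_eq (α := X) (t := (Finset.univ : Finset X))
    (by simp) (s := s) (f := f) (by intro x _; simp) hf
  exact ⟨g.trans (Equiv.subtypeUnivEquiv (by simp)), fun x hx => by simpa using hg x hx⟩

theorem freeGroup_rf {α : Type} : ResiduallyFinite (FreeGroup α) := by
  classical
  intro w hw
  obtain ⟨L, rfl⟩ : ∃ L, w = FreeGroup.mk L := ⟨w.toWord, FreeGroup.mk_toWord.symm⟩
  let X : Finset (FreeGroup α) := (L.tails.map FreeGroup.mk).toFinset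
  have hX : ∀ L', L' <:+ L → FreeGroup.mk L' ∈ X := by
    intro L' h
    simp only [X, List.mem_toFinset, List.mem_map, List.mem_tails]
    exact ⟨L', h, rfl⟩
  have hσ : ∀ i : α, ∃ σ : Perm X, ∀ (q : X) (h : FreeGroup.of i * q.1 ∈ X),
      σ q = ⟨FreeGroup.of i * q.1, h⟩ := by
    intro i
    obtain ⟨σ, hσ⟩ := exists_perm_extend (X := X) {q | FreeGroup.of i * q.1 ∈ X}
      (fun q => if h : FreeGroup.of i * q.1 ∈ X then ⟨_, h⟩ else q) (by
        intro q hq q' hq' h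
        simp only [Set.mem_setOf_eq] at hq hq'
        simp only [hq, hq', dif_pos, Subtype.mk.injEq, mul_right_inj] at h
        exact Subtype.ext h)
    refine ⟨σ, fun q h => ?_⟩
    rw [hσ q h, dif_pos h]
  choose σ hσ using hσ
  let F : FreeGroup α →* Perm X := FreeGroup.lift σ
  have hσ' : ∀ (i : α) (q : X) (h : FreeGroup.of i * q.1 ∈ X), (σ i q).1 = FreeGroup.of i * q.1 := by
    intro i q h; rw [hσ i q h]
  let p0 : X := ⟨1, hX [] (List.nil_suffix)⟩
  have key : ∀ L' (h : L' <:+ L), (F (FreeGroup.mk L') p0).1 = FreeGroup.mk L' := by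
    intro L'
    induction L' with
    | nil => intro h; rw [show (FreeGroup.mk ([] : List (α × Bool))) = 1 from rfl, map_one]; rfl
    | cons x L' ih =>
      intro h
      have h' : L' <:+ L := (List.suffix_cons x L').trans h
      obtain ⟨i, b⟩ := x
      have e : FreeGroup.mk ((i, b) :: L') = FreeGroup.mk [(i, b)] * FreeGroup.mk L' := by
        rw [FreeGroup.mul_mk]; rfl
      have hmem := hX _ h
      have ih := ih h'
      rw [e, map_mul, Perm.mul_apply]
      generalize hq : F (FreeGroup.mk L') p0 = q at ih
      cases b with
      | true =>
        have e1 : FreeGroup.mk [(i, true)] = FreeGroup.of i := rfl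
        rw [e1, show F (FreeGroup.of i) = σ i from FreeGroup.lift_apply_of]
        rw [hσ', ih]
        rw [ih, ← e1, ← e]; exact hmem
      | false =>
        have e1 : FreeGroup.mk [(i, false)] = (FreeGroup.of i)⁻¹ := by
          simp [FreeGroup.of, FreeGroup.inv_mk, FreeGroup.invRev]
        rw [e1, map_inv, show F (FreeGroup.of i) = σ i from FreeGroup.lift_apply_of]
        rw [e, e1] at hmem
        have h2 : (σ i)⁻¹ q = ⟨_, hmem⟩ := by
          rw [Perm.inv_eq_iff_eq, Subtype.ext_iff, hσ', ih]
          · simp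
          · simpa using hX L' h'
        rw [h2]
  refine ⟨Perm X, inferInstance, inferInstance, F, fun h => hw ?_⟩
  have := key L List.suffix_rfl
  rw [h] at this
  exact this.symm


open Equiv
set_option linter.all false

section Artin

/-- the images of the seven free generators -/
def iotaFun (oM oN : Bool) (m n p : ℕ) : Fin 7 → FreeGroup (Fin 3) :=
  let x : FreeGroup (Fin 3) := FreeGroup.of 0
  let y : FreeGroup (Fin 3) := FreeGroup.of 1
  let z : FreeGroup (Fin 3) := FreeGroup.of 2
  ![y * x * z,
    if oM then x ^ m * y⁻¹ else x ^ m,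
    if oM then y * x ^ (m + 1) else y * x ^ m * y⁻¹,
    if oN then z⁻¹ * y ^ n else z⁻¹ * y ^ n * z,
    if oN then y ^ (n + 1) * z else y ^ n,
    z ^ p,
    y * z ^ p * y⁻¹]

def iotaH (oM oN : Bool) (m n p : ℕ) : FreeGroup (Fin 7) →* FreeGroup (Fin 3) :=
  FreeGroup.lift (iotaFun oM oN m n p)

def phiFun (oM oN : Bool) : Fin 7 → FreeGroup (Fin 7) :=
  let f : Fin 7 → FreeGroup (Fin 7) := FreeGroup.of
  ![f 0,
    if oM then f 2 * (f 0)⁻¹ else f 2,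
    if oM then f 0 * f 1 else f 0 * f 1 * (f 0)⁻¹,
    if oN then f 4 * (f 0)⁻¹ else f 4,
    if oN then f 0 * f 3 else f 0 * f 3 * (f 0)⁻¹,
    f 6,
    f 0 * f 5 * (f 0)⁻¹]

def phiH (oM oN : Bool) : FreeGroup (Fin 7) →* FreeGroup (Fin 7) :=
  FreeGroup.lift (phiFun oM oN)

theorem phiH_eta (oM oN : Bool) : phiH oM oN (FreeGroup.of 0) = FreeGroup.of 0 := by
  simp [phiH, phiFun]

theorem phiH_phiH (oM oN : Bool) (c : FreeGroup (Fin 7)) :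
    phiH oM oN (phiH oM oN c) = FreeGroup.of 0 * c * (FreeGroup.of 0)⁻¹ := by
  have : (phiH oM oN).comp (phiH oM oN) = (MulAut.conj (FreeGroup.of (0 : Fin 7))).toMonoidHom := by
    ext i
    fin_cases i <;> cases oM <;> cases oN <;> simp [phiH, phiFun, mul_assoc]
  exact DFunLike.congr_fun this c

/-- the Artin relation of length `2 m` or `2 m + 1` -/
def ArtRel {E : Type} [Group E] (o : Bool) (m : ℕ) (a b : E) : Prop :=
  if o then (a * b) ^ m * a = b * (a * b) ^ m else (a * b) ^ m * a = a * (a * b) ^ m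

variable {E : Type} [Group E]

def len (o : Bool) (m : ℕ) : ℕ := if o then 2 * m + 1 else 2 * m

theorem altWord_add_two {V : Type} (a b : V) (k : ℕ) :
    altWord a b (k + 2) = FreeGroup.of a * FreeGroup.of b * altWord a b k := by
  simp only [altWord, List.range_succ_eq_map, List.map_cons, List.map_map, List.prod_cons]
  simp only [Nat.zero_mod, if_true, Function.comp_def]
  rw [← mul_assoc]
  congr 1
  congr 1
  apply List.map_congr_left
  intro i _
  have : (i + 1 + 1) % 2 = i % 2 := by omega
  simp only [Nat.succ_eq_add_one, this]

theorem altWord_even {V : Type} (a b : V) (m : ℕ) :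
    altWord a b (2 * m) = (FreeGroup.of a * FreeGroup.of b) ^ m := by
  induction m with
  | zero => simp [altWord]
  | succ m ih => rw [mul_add, mul_one, altWord_add_two, ih, pow_succ']

theorem altWord_odd {V : Type} (a b : V) (m : ℕ) :
    altWord a b (2 * m + 1) = (FreeGroup.of a * FreeGroup.of b) ^ m * FreeGroup.of a := by
  induction m with
  | zero => simp [altWord]
  | succ m ih =>
    rw [show 2 * (m + 1) + 1 = (2 * m + 1) + 2 by ring, altWord_add_two, ih, pow_succ']
    simp [mul_assoc]

theorem mul_pow_swap (a b : E) (m : ℕ) : (b * a) ^ m * b = b * (a * b) ^ m := by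
  induction m with
  | zero => simp
  | succ m ih => rw [pow_succ', mul_assoc, ih, pow_succ']; simp [mul_assoc]

theorem artRel_iff {V : Type} (f : FreeGroup V →* E) (o : Bool) (m : ℕ) (a b : V) :
    f (altWord a b (len o m) * (altWord b a (len o m))⁻¹) = 1 ↔
      ArtRel o m (f (FreeGroup.of a)) (f (FreeGroup.of b)) := by
  rw [map_mul, map_inv, mul_inv_eq_one]
  cases o
  · simp only [len, altWord_even, ArtRel, map_pow, map_mul, Bool.false_eq_true, if_false]
    constructor
    · intro h
      nth_rewrite 2 [h]
      rw [mul_pow_swap]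
    · intro h
      have : f (FreeGroup.of a) * (f (FreeGroup.of b) * f (FreeGroup.of a)) ^ m =
        f (FreeGroup.of a) * (f (FreeGroup.of a) * f (FreeGroup.of b)) ^ m := by
        rw [← h, mul_pow_swap]
      exact (mul_left_cancel this).symm
  · simp only [len, altWord_odd, ArtRel, map_pow, map_mul, if_true]
    rw [mul_pow_swap (f (FreeGroup.of a)) (f (FreeGroup.of b))]

/-- evaluation of words in `x, y, z` -/
def evA (x y z : E) : FreeGroup (Fin 3) →* E := FreeGroup.lift ![x, y, z]

@[simp] theorem evA_x (x y z : E) : evA x y z (FreeGroup.of 0) = x := by simp [evA]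
@[simp] theorem evA_y (x y z : E) : evA x y z (FreeGroup.of 1) = y := by simp [evA]
@[simp] theorem evA_z (x y z : E) : evA x y z (FreeGroup.of 2) = z := by simp [evA]

theorem conj_rel_of_artRel (oM oN : Bool) (m n p : ℕ) (a b c : E)
    (h1 : ArtRel oM m a b) (h2 : ArtRel oN n b c) (h3 : ArtRel false p c a)
    (w : FreeGroup (Fin 7)) :
    (b * c * a) * evA (a * b) (b * c) (c * a) (iotaH oM oN m n p w) =
      evA (a * b) (b * c) (c * a) (iotaH oM oN m n p (phiH oM oN w)) * (b * c * a) := by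
  set ev := evA (a * b) (b * c) (c * a) with hev
  suffices hs : (MulAut.conj (b * c * a)).toMonoidHom.comp (ev.comp (iotaH oM oN m n p)) =
      (ev.comp (iotaH oM oN m n p)).comp (phiH oM oN) by
    have := DFunLike.congr_fun hs w
    simp only [MonoidHom.comp_apply, MulEquiv.coe_toMonoidHom, MulAut.conj_apply] at this
    rw [← this]; group
  ext i
  have hx : ev (FreeGroup.of 0) = a * b := evA_x ..
  have hy : ev (FreeGroup.of 1) = b * c := evA_y ..
  have hz : ev (FreeGroup.of 2) = c * a := evA_z ..
  clear_value ev
  have hZ : (c * a) ^ p * (c * a) = (c * a) * (c * a) ^ p := by rw [← pow_succ, pow_succ']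
  have hX : (a * b) ^ (m + 1) = (a * b) * (a * b) ^ m := pow_succ' _ _
  have hY : (b * c) ^ (n + 1) = (b * c) * (b * c) ^ n := pow_succ' _ _
  simp only [ArtRel, Bool.false_eq_true, if_false] at h1 h2 h3
  generalize hXd : (a * b) ^ m = X at *
  generalize hYd : (b * c) ^ n = Y at *
  generalize hZd : (c * a) ^ p = Z at *
  have hZ' : Z * a = a * Z := by
    rw [← mul_assoc, h3, mul_assoc, mul_assoc] at hZ
    exact mul_left_cancel hZ
  have hc : c * Z * c⁻¹ = Z := by rw [← h3]; group
  have ha : a * Z * a⁻¹ = Z := by rw [← hZ']; group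
  fin_cases i <;> simp only [MonoidHom.comp_apply, MulEquiv.coe_toMonoidHom, MulAut.conj_apply,
    iotaH, phiH, FreeGroup.lift_apply_of, phiFun, Fin.zero_eta, Fin.mk_one, Fin.reduceFinMk,
    Matrix.cons_val, Matrix.cons_val_zero, Matrix.cons_val_one]
  · simp only [iotaFun, Matrix.cons_val, Matrix.cons_val_zero, map_mul, hx, hy, hz]
    group
  · cases oM
    · simp only [FreeGroup.lift_apply_of, iotaFun, Matrix.cons_val, Bool.false_eq_true, if_false,
        map_mul, map_inv, map_pow, hx, hy, hz, hXd, hYd, hZd] at h1 ⊢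
      have e : a * X * a⁻¹ = X := by rw [← h1]; group
      conv_rhs => rw [← e]
      group
    · simp only [FreeGroup.lift_apply_of, iotaFun, Matrix.cons_val, if_true,
        map_mul, map_inv, map_pow, hx, hy, hz, hXd, hYd, hZd, hX] at h1 ⊢
      obtain rfl : b = X * a * X⁻¹ := by rw [h1]; group
      group
  · cases oM
    · simp only [FreeGroup.lift_apply_of, iotaFun, Matrix.cons_val, Bool.false_eq_true, if_false,
        map_mul, map_inv, map_pow, hx, hy, hz, hXd, hYd, hZd] at h1 ⊢
      have e : a * X * a⁻¹ = X := by rw [← h1]; group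
      conv_lhs => rw [← e]
      group
    · simp only [FreeGroup.lift_apply_of, iotaFun, Matrix.cons_val, if_true,
        map_mul, map_inv, map_pow, hx, hy, hz, hXd, hYd, hZd, hX] at h1 ⊢
      obtain rfl : b = X * a * X⁻¹ := by rw [h1]; group
      group
  · cases oN
    · simp only [FreeGroup.lift_apply_of, iotaFun, Matrix.cons_val, Bool.false_eq_true, if_false,
        map_mul, map_inv, map_pow, hx, hy, hz, hXd, hYd, hZd] at h2 ⊢
      have e : b * Y * b⁻¹ = Y := by rw [← h2]; group
      conv_rhs => rw [← e]
      group
    · simp only [FreeGroup.lift_apply_of, iotaFun, Matrix.cons_val, if_true,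
        map_mul, map_inv, map_pow, hx, hy, hz, hXd, hYd, hZd, hY] at h2 ⊢
      obtain rfl : c = Y * b * Y⁻¹ := by rw [h2]; group
      group
  · cases oN
    · simp only [FreeGroup.lift_apply_of, iotaFun, Matrix.cons_val, Bool.false_eq_true, if_false,
        map_mul, map_inv, map_pow, hx, hy, hz, hXd, hYd, hZd] at h2 ⊢
      have e : b * Y * b⁻¹ = Y := by rw [← h2]; group
      conv_lhs => rw [← e]
      group
    · simp only [FreeGroup.lift_apply_of, iotaFun, Matrix.cons_val, if_true,
        map_mul, map_inv, map_pow, hx, hy, hz, hXd, hYd, hZd, hY] at h2 ⊢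
      obtain rfl : c = Y * b * Y⁻¹ := by rw [h2]; group
      group
  · simp only [FreeGroup.lift_apply_of, iotaFun, Matrix.cons_val, map_mul, map_inv, map_pow, hx, hy, hz, hXd, hYd, hZd]
    trans b * (c * (a * Z * a⁻¹) * c⁻¹) * b⁻¹
    · group
    · rw [ha]; group
  · simp only [FreeGroup.lift_apply_of, iotaFun, Matrix.cons_val, map_mul, map_inv, map_pow, hx, hy, hz, hXd, hYd, hZd]
    conv_lhs => rw [← ha]
    group

/-- conversely the twisted relations give back the Artin relations -/
theorem artRel_of_conj_rel (oM oN : Bool) (m n p : ℕ) (ev : FreeGroup (Fin 3) →* E) (h : E)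
    (hh : h * h = ev (iotaH oM oN m n p (FreeGroup.of 0)))
    (hc : ∀ w, h * ev (iotaH oM oN m n p w) = ev (iotaH oM oN m n p (phiH oM oN w)) * h) :
    ∃ a b c : E, ArtRel oM m a b ∧ ArtRel oN n b c ∧ ArtRel false p c a ∧
      a * b = ev (FreeGroup.of 0) ∧ b * c = ev (FreeGroup.of 1) ∧ c * a = ev (FreeGroup.of 2) ∧
      b * c * a = h := by
  have h1 := hc (FreeGroup.of 1)
  have h3 := hc (FreeGroup.of 3)
  have h5 := hc (FreeGroup.of 5)
  simp only [iotaH, phiH, phiFun, iotaFun, FreeGroup.lift_apply_of, Matrix.cons_val] at hh h1 h3 h5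
  simp only [map_mul, map_inv, map_pow] at hh h5
  generalize hx : ev (FreeGroup.of 0) = x at *
  generalize hy : ev (FreeGroup.of 1) = y at *
  generalize hz : ev (FreeGroup.of 2) = z at *
  have hxe : x = y⁻¹ * h * h * z⁻¹ := by rw [mul_assoc y⁻¹, hh]; group
  have eab : y⁻¹ * h * (h * z⁻¹) = x := by rw [hxe]; group
  have ebc : h * z⁻¹ * (z * h⁻¹ * y) = y := by group
  have eca : z * h⁻¹ * y * (y⁻¹ * h) = z := by group
  have hhi : (y * x * z)⁻¹ * h = h⁻¹ := by rw [← hh]; group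
  refine ⟨y⁻¹ * h, h * z⁻¹, z * h⁻¹ * y, ?_, ?_, ?_, eab, ebc, eca, by group⟩
  · rw [ArtRel, eab]
    cases oM
    · simp only [Bool.false_eq_true, if_false, FreeGroup.lift_apply_of, Matrix.cons_val, map_mul, map_inv,
        map_pow, hx, hy, hz] at h1 ⊢
      generalize x ^ m = X at *
      rw [mul_assoc, h1]; group
    · simp only [if_true, map_mul, map_inv, FreeGroup.lift_apply_of, Matrix.cons_val, map_pow,
        hx, hy, hz, pow_succ'] at h1 ⊢
      generalize x ^ m = X at *
      rw [mul_assoc (y * (x * X)), hhi] at h1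
      calc X * (y⁻¹ * h) = h⁻¹ * (h * (X * y⁻¹)) * h := by group
        _ = h⁻¹ * y * x * X := by rw [h1]; group
        _ = h * z⁻¹ * X := by rw [hxe]; group
  · rw [ArtRel, ebc]
    cases oN
    · simp only [Bool.false_eq_true, if_false, FreeGroup.lift_apply_of, Matrix.cons_val, map_mul, map_inv,
        map_pow, hx, hy, hz] at h3 ⊢
      generalize y ^ n = Y at *
      rw [← mul_assoc Y, ← h3]; group
    · simp only [if_true, map_mul, map_inv, FreeGroup.lift_apply_of, Matrix.cons_val, map_pow,
        hx, hy, hz, pow_succ'] at h3 ⊢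
      generalize y ^ n = Y at *
      rw [mul_assoc (y * Y * z), hhi] at h3
      calc Y * (h * z⁻¹) = z * h⁻¹ * (h * (z⁻¹ * Y)) * h * z⁻¹ := by group
        _ = z * h⁻¹ * y * Y := by rw [h3]; group
  · rw [ArtRel, eca]
    have hZ : z ^ p * z = z * z ^ p := by rw [← pow_succ, pow_succ']
    simp only [Bool.false_eq_true, if_false]
    generalize z ^ p = Z at *
    calc Z * (z * h⁻¹ * y) = (Z * z) * h⁻¹ * y := by group
      _ = z * h⁻¹ * (h * Z) * h⁻¹ * y := by rw [hZ]; group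
      _ = z * h⁻¹ * y * Z := by rw [h5]; group

end Artin


open Equiv
set_option linter.all false

/-- The privacy conditions; `Q a` means that `a` fixes the base vertex. -/
structure Privacy (oM oN : Bool) (m n p : ℕ) {E : Type} [Group E] (x y z : E) (Q : E → Prop) :
    Prop where
  hy : ¬ Q y
  hz : ¬ Q z
  hyz : ¬ Q (y * z)
  xu : ∀ k, 0 < k → k < m → ¬ Q (x ^ k) ∧ ¬ Q (x ^ k * y⁻¹) ∧ ¬ Q (x ^ k * z)
  xv : ∀ k, 0 < k → (k + if oM then 0 else 1) < m →
    ¬ Q (z⁻¹ * x ^ k) ∧ ¬ Q (z⁻¹ * x ^ k * y⁻¹) ∧ ¬ Q (z⁻¹ * x ^ k * z)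
  yv : ∀ k, 0 < k → k < n → ¬ Q (z⁻¹ * y ^ k * z) ∧ ¬ Q (z⁻¹ * y ^ k * y⁻¹)
  yw : ∀ k, 0 < k → (k + if oN then 0 else 1) < n → ¬ Q (y * y ^ k * z) ∧ ¬ Q (y * y ^ k * y⁻¹)
  zu : ∀ k, 0 < k → k < p → ¬ Q (z ^ k) ∧ ¬ Q (z ^ k * y⁻¹)
  zw : ∀ k, 0 < k → k < p → ¬ Q (y * z ^ k) ∧ ¬ Q (y * z ^ k * y⁻¹)

theorem exists_retraction (oM oN : Bool) (m n p : ℕ) (hm : 2 ≤ m) (hn : 2 ≤ n) (hp : 2 ≤ p)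
    {H : Type} [Group H] (f : FreeGroup (Fin 3) →* H)
    (hpr : Privacy oM oN m n p (f (FreeGroup.of 0)) (f (FreeGroup.of 1)) (f (FreeGroup.of 2))
      (fun q => q ∈ (f.comp (iotaH oM oN m n p)).range)) :
    ∃ r : f.ker →* FreeGroup (Fin 7), (∀ k, iotaH oM oN m n p (r k) ∈ f.ker) ∧
      ∀ c (h : iotaH oM oN m n p c ∈ f.ker), r ⟨_, h⟩ = c := by
  classical
  set ι := iotaH oM oN m n p with hι
  set D : Subgroup H := (f.comp ι).range with hD
  set x := f (FreeGroup.of 0) with hx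
  set y := f (FreeGroup.of 1) with hy
  set z := f (FreeGroup.of 2) with hz
  have hsec : ∀ d : H, ∃ c : FreeGroup (Fin 7), (d ∈ D → f (ι c) = d) ∧ (d = 1 → c = 1) := by
    intro d
    by_cases h1 : d = 1
    · exact ⟨1, by simp [h1], fun _ => rfl⟩
    · by_cases h2 : d ∈ D
      · obtain ⟨c, hc⟩ := h2
        exact ⟨c, fun _ => hc, fun h => absurd h h1⟩
      · exact ⟨1, fun h => absurd h h2, fun _ => rfl⟩
  choose σ hσ hσ1 using hsec
  have hσ1 : σ 1 = 1 := hσ1 1 rfl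
  let bar : FreeGroup (Fin 7) → H := fun c => f (ι c)
  have bar_mem : ∀ c, bar c ∈ D := fun c => ⟨c, rfl⟩
  have bar_mul : ∀ c c', bar (c * c') = bar c * bar c' := fun c c' => by simp [bar]
  let L : H → FreeGroup (Fin 7) → FreeGroup (Fin 7) := fun d κ => σ d * κ * (σ (d * bar κ))⁻¹
  have hL : ∀ d κ, d ∈ D → f (ι (L d κ)) = 1 := by
    intro d κ hd
    simp only [L, map_mul, map_inv]
    rw [hσ d hd, hσ (d * bar κ) (D.mul_mem hd (bar_mem κ))]
    simp [bar]
  have L_mul : ∀ d κ κ', L d κ * L (d * bar κ) κ' = L d (κ * κ') := by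
    intro d κ κ'
    simp only [L, bar_mul]
    group
  let g : Fin 7 → FreeGroup (Fin 7) := FreeGroup.of
  let lab : Fin 3 → H → FreeGroup (Fin 7) := ![
    fun q => if q ∈ D then L q (g 1) else if q * y⁻¹ ∈ D then L (q * y⁻¹) (g 0) else
      if q * z ∈ D then L (q * z) ((g 0)⁻¹ * g 2) else 1,
    fun q => if q * z ∈ D then L (q * z) (g 3) else if q * y⁻¹ ∈ D then L (q * y⁻¹) (g 4) else 1,
    fun q => if q ∈ D then L q (g 5) else if q * y⁻¹ ∈ D then L (q * y⁻¹) (g 6) else 1]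
  have hlab : ∀ i q, f (ι (lab i q)) = 1 := by
    intro i q
    fin_cases i <;> simp only [lab, Fin.zero_eta, Fin.mk_one, Fin.reduceFinMk,
      Matrix.cons_val, Matrix.cons_val_zero, Matrix.cons_val_one]
    all_goals split_ifs with h1 h2 h3
    all_goals first | exact hL _ _ ‹_› | simp
  -- the action
  let pm : Fin 3 → Perm (H × FreeGroup (Fin 7)) := fun i =>
    { toFun := fun q => (q.1 * f (FreeGroup.of i), q.2 * lab i q.1)
      invFun := fun q => (q.1 * (f (FreeGroup.of i))⁻¹, q.2 * (lab i (q.1 * (f (FreeGroup.of i))⁻¹))⁻¹)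
      left_inv := by intro q; simp
      right_inv := by intro q; simp }
  let F : FreeGroup (Fin 3) →* (Perm (H × FreeGroup (Fin 7)))ᵐᵒᵖ := FreeGroup.lift fun i => MulOpposite.op (pm i)
  let act : FreeGroup (Fin 3) → Perm (H × FreeGroup (Fin 7)) := fun a => (F a).unop
  have act_one : ∀ q, act 1 q = q := by intro q; simp [act]
  have act_mul : ∀ a b q, act (a * b) q = act b (act a q) := by intro a b q; simp [act]
  have act_inv : ∀ a q, act a⁻¹ (act a q) = q := by
    intro a q; rw [← act_mul]; simp [act_one]
  have act_of : ∀ i q l, act (FreeGroup.of i) (q, l) = (q * f (FreeGroup.of i), l * lab i q) := by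
    intro i q l; simp [act, F, pm]
  have act_inv' : ∀ a q q', act a q' = q → act a⁻¹ q = q' := by
    rintro a q q' rfl; exact act_inv a q'
  have hP : ∀ a q, ∃ P : FreeGroup (Fin 7), f (ι P) = 1 ∧ ∀ l, act a (q, l) = (q * f a, l * P) := by
    intro a
    induction a using FreeGroup.induction_on with
    | C1 => intro q; exact ⟨1, by simp, fun l => by rw [act_one]; simp⟩
    | of i => intro q; exact ⟨lab i q, hlab i q, act_of i q⟩
    | inv_of i ih =>
      intro q
      obtain ⟨P, h1, h2⟩ := ih (q * (f (FreeGroup.of i))⁻¹)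
      refine ⟨P⁻¹, by simp [h1], fun l => ?_⟩
      apply act_inv'
      rw [map_inv, h2]; simp
    | mul a b iha ihb =>
      intro q
      obtain ⟨P, h1, h2⟩ := iha q
      obtain ⟨P', h1', h2'⟩ := ihb (q * f a)
      refine ⟨P * P', by simp [h1, h1'], fun l => ?_⟩
      rw [act_mul, h2, h2']
      simp [mul_assoc]
  choose P hP1 hP2 using hP
  -- power lemma
  have hpow : ∀ i k q l, (∀ t, 0 < t → t < k → lab i (q * f (FreeGroup.of i) ^ t) = 1) → 0 < k →
      act (FreeGroup.of i ^ k) (q, l) = (q * f (FreeGroup.of i) ^ k, l * lab i q) := by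
    intro i k q l
    induction k with
    | zero => intro _ h; omega
    | succ k ih =>
      intro h1 _
      rcases Nat.eq_zero_or_pos k with rfl | hk
      · simp [act_of]
      · rw [pow_succ, act_mul, ih (fun t h2 h3 => h1 t h2 (by omega)) hk, act_of, h1 k hk (by omega)]
        simp [pow_succ, mul_assoc]
  have D1 : ∀ d q, d ∈ D → (d * q ∈ D ↔ q ∈ D) := fun d q hd => Subgroup.mul_mem_cancel_left D hd
  have E1 : ∀ d ∈ D, lab 1 d = 1 := by
    intro d hd
    have h1 : d * z ∉ D := by rw [D1 _ _ hd]; exact hpr.hz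
    have h2 : d * y⁻¹ ∉ D := by rw [D1 _ _ hd, inv_mem_iff]; exact hpr.hy
    simp only [lab, Matrix.cons_val, if_neg h1, if_neg h2]
  have key : ∀ i d l, d ∈ D → act (ι (g i)) (d, l) = (d * bar (g i), l * L d (g i)) := by
    intro i d l hd
    have hn0 : ∀ d ∈ D, d * y ∉ D := fun d hd => by rw [D1 _ _ hd]; exact hpr.hy
    have hzi : ∀ d ∈ D, d * z⁻¹ ∉ D := fun d hd => by rw [D1 _ _ hd, inv_mem_iff]; exact hpr.hz
    have hzyi : ∀ d ∈ D, d * z⁻¹ * y⁻¹ ∉ D := fun d hd => by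
      rw [mul_assoc, D1 _ _ hd, ← mul_inv_rev, inv_mem_iff]; exact hpr.hyz
    have hyz : ∀ d ∈ D, d * y * z ∉ D := fun d hd => by
      rw [mul_assoc, D1 _ _ hd]; exact hpr.hyz
    have X1 : ∀ d ∈ D, lab 0 d = L d (g 1) := fun d hd => by
      simp only [lab, Matrix.cons_val, if_pos hd]
    have X2 : ∀ d ∈ D, lab 0 (d * y) = L d (g 0) := fun d hd => by
      simp only [lab, Matrix.cons_val, if_neg (hn0 d hd), mul_inv_cancel_right, if_pos hd]
    have X3 : ∀ d ∈ D, lab 0 (d * z⁻¹) = L d ((g 0)⁻¹ * g 2) := fun d hd => by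
      simp only [lab, Matrix.cons_val, if_neg (hzi d hd), if_neg (hzyi d hd), inv_mul_cancel_right, if_pos hd]
    have X4 : ∀ d ∈ D, ∀ q, q ∉ D → q * y⁻¹ ∉ D → q * z ∉ D → lab 0 (d * q) = 1 := fun d hd q h1 h2 h3 => by
      rw [← D1 d _ hd] at h1 h2 h3
      rw [← mul_assoc] at h2 h3
      simp only [lab, Matrix.cons_val, if_neg h1, if_neg h2, if_neg h3]
    have Y1 : ∀ d ∈ D, lab 1 (d * z⁻¹) = L d (g 3) := fun d hd => by
      simp only [lab, Matrix.cons_val, inv_mul_cancel_right, if_pos hd]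
    have Y2 : ∀ d ∈ D, lab 1 (d * y) = L d (g 4) := fun d hd => by
      simp only [lab, Matrix.cons_val, if_neg (hyz d hd), mul_inv_cancel_right, if_pos hd]
    have Y3 : ∀ d ∈ D, ∀ q, q * z ∉ D → q * y⁻¹ ∉ D → lab 1 (d * q) = 1 := fun d hd q h2 h3 => by
      rw [← D1 d _ hd, ← mul_assoc] at h2 h3
      simp only [lab, Matrix.cons_val, if_neg h2, if_neg h3]
    have Z1 : ∀ d ∈ D, lab 2 d = L d (g 5) := fun d hd => by
      simp only [lab, Matrix.cons_val, if_pos hd]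
    have Z2 : ∀ d ∈ D, lab 2 (d * y) = L d (g 6) := fun d hd => by
      simp only [lab, Matrix.cons_val, if_neg (hn0 d hd), mul_inv_cancel_right, if_pos hd]
    have Z3 : ∀ d ∈ D, lab 2 (d * z⁻¹) = 1 := fun d hd => by
      simp only [lab, Matrix.cons_val, if_neg (hzi d hd), if_neg (hzyi d hd)]
    have Z4 : ∀ d ∈ D, ∀ q, q ∉ D → q * y⁻¹ ∉ D → lab 2 (d * q) = 1 := fun d hd q h2 h3 => by
      rw [← D1 d _ hd] at h2 h3
      rw [← mul_assoc] at h3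
      simp only [lab, Matrix.cons_val, if_neg h2, if_neg h3]
    have sx : ∀ q l, act (FreeGroup.of 0) (q, l) = (q * x, l * lab 0 q) := act_of 0
    have sy : ∀ d ∈ D, ∀ l, act (FreeGroup.of 1) (d, l) = (d * y, l) := fun d hd l => by
      rw [act_of, E1 d hd, mul_one]
    have syi : ∀ q l, q * y⁻¹ ∈ D → act (FreeGroup.of 1)⁻¹ (q, l) = (q * y⁻¹, l) := fun q l h => by
      apply act_inv'
      rw [sy _ h, inv_mul_cancel_right]
    have sz : ∀ q l, q * z ∈ D → act (FreeGroup.of 2) (q, l) = (q * z, l) := fun q l h => by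
      have := Z3 _ h
      rw [mul_inv_cancel_right] at this
      rw [act_of, this, mul_one]
    have szi : ∀ d ∈ D, ∀ l, act (FreeGroup.of 2)⁻¹ (d, l) = (d * z⁻¹, l) := fun d hd l => by
      apply act_inv'
      rw [sz _ _ (by rwa [inv_mul_cancel_right]), inv_mul_cancel_right]
    have dbar : ∀ i, d * bar (g i) ∈ D := fun i => D.mul_mem hd (bar_mem _)
    have hb0 : bar (g 0) = y * x * z := by
      simp [bar, g, hι, iotaH, iotaFun, hx, hy, hz]
    have hyx : d * y * x = d * bar (g 0) * z⁻¹ := by rw [hb0]; group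
    have px : ∀ l, act (FreeGroup.of 0 ^ m) (d, l) = (d * x ^ m, l * L d (g 1)) := by
      intro l
      rw [hpow 0 m d l _ (by omega), X1 d hd]
      intro t h1 h2
      obtain ⟨h3, h4, h5⟩ := hpr.xu t h1 h2
      exact X4 d hd _ h3 h4 h5
    have pyx : ∀ l, act (FreeGroup.of 0) (act (FreeGroup.of 1) (d, l)) = (d * bar (g 0) * z⁻¹, l * L d (g 0)) := by
      intro l
      rw [sy _ hd, sx, X2 _ hd, hyx]
    have pz : ∀ l, act (FreeGroup.of 2 ^ p) (d, l) = (d * z ^ p, l * L d (g 5)) := by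
      intro l
      rw [hpow 2 p d l _ (by omega), Z1 d hd]
      intro t h1 h2
      obtain ⟨h3, h4⟩ := hpr.zu t h1 h2
      exact Z4 d hd _ h3 h4
    have pz' : ∀ l, act (FreeGroup.of 2 ^ p) (d * y, l) = (d * y * z ^ p, l * L d (g 6)) := by
      intro l
      rw [hpow 2 p (d * y) l _ (by omega), Z2 d hd]
      intro t h1 h2
      obtain ⟨h3, h4⟩ := hpr.zw t h1 h2
      rw [mul_assoc]
      exact Z4 d hd _ h3 h4
    have pv : ∀ l, act (FreeGroup.of 1 ^ n) (d * z⁻¹, l) = (d * z⁻¹ * y ^ n, l * L d (g 3)) := by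
      intro l
      rw [hpow 1 n _ l _ (by omega), Y1 d hd]
      intro t h1 h2
      obtain ⟨h3, h4⟩ := hpr.yv t h1 h2
      rw [mul_assoc]
      exact Y3 d hd _ h3 h4
    have hb1 := dbar 1
    have hb2 := dbar 2
    have hb3 := dbar 3
    have hb4 := dbar 4
    have hb6 := dbar 6
    fin_cases i
    · have e : ι (g 0) = FreeGroup.of 1 * FreeGroup.of 0 * FreeGroup.of 2 := by
        simp [g, hι, iotaH, iotaFun]
      show act (ι (g 0)) (d, l) = _
      rw [e, act_mul, act_mul, pyx, sz _ _ (by rw [inv_mul_cancel_right]; exact dbar 0)]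
      simp
    · show act (ι (g 1)) (d, l) = (d * bar (g 1), l * L d (g 1))
      cases oM
      · have e : ι (g 1) = FreeGroup.of 0 ^ m := by
          simp [g, hι, iotaH, iotaFun]
        rw [e, px]; simp only [bar, e, map_pow, hx]
      · have e : ι (g 1) = FreeGroup.of 0 ^ m * (FreeGroup.of 1)⁻¹ := by
          simp [g, hι, iotaH, iotaFun]
        have e' : bar (g 1) = x ^ m * y⁻¹ := by simp only [bar, e, map_mul, map_pow, map_inv, hx, hy]
        rw [e', ← mul_assoc] at hb1
        rw [e, act_mul, px, syi _ _ hb1, e', mul_assoc]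
    · show act (ι (g 2)) (d, l) = (d * bar (g 2), l * L d (g 2))
      cases oM
      · have e : ι (g 2) = FreeGroup.of 1 * FreeGroup.of 0 * FreeGroup.of 0 ^ (m-1) * (FreeGroup.of 1)⁻¹ := by
          obtain ⟨m, rfl⟩ : ∃ k, m = k + 1 := ⟨m - 1, by omega⟩
          simp [g, hι, iotaH, iotaFun, pow_succ', mul_assoc]
        have e' : bar (g 2) = y * x * x ^ (m-1) * y⁻¹ := by
          simp only [bar, e, map_mul, map_pow, map_inv, hx, hy]
        have e2 : d * bar (g 0) * z⁻¹ * x ^ (m-1) * y⁻¹ = d * bar (g 2) := by rw [← hyx, e']; group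
        rw [e, act_mul, act_mul, act_mul, pyx, hpow 0 (m-1) _ _ _ (by omega), X3 _ (dbar 0), syi, mul_assoc l, L_mul]
        · rw [e2, mul_inv_cancel_left]
        · rw [e2]; exact hb2
        · intro t h1 h2
          obtain ⟨h3, h4, h5⟩ := hpr.xv t h1 (by simp; omega)
          rw [mul_assoc]
          exact X4 _ (dbar 0) _ h3 h4 h5
      · have e : ι (g 2) = FreeGroup.of 1 * FreeGroup.of 0 * FreeGroup.of 0 ^ m := by
          simp [g, hι, iotaH, iotaFun, pow_succ', mul_assoc]
        have e' : bar (g 2) = y * x * x ^ m := by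
          simp only [bar, e, map_mul, map_pow, map_inv, hx, hy]
        have e2 : d * bar (g 0) * z⁻¹ * x ^ m = d * bar (g 2) := by rw [← hyx, e']; group
        rw [e, act_mul, act_mul, pyx, hpow 0 m _ _ _ (by omega), X3 _ (dbar 0), mul_assoc l, L_mul]
        · simp only [← hx]
          rw [e2, mul_inv_cancel_left]
        · intro t h1 h2
          obtain ⟨h3, h4, h5⟩ := hpr.xv t h1 (by simp; omega)
          rw [mul_assoc]
          exact X4 _ (dbar 0) _ h3 h4 h5
    · show act (ι (g 3)) (d, l) = (d * bar (g 3), l * L d (g 3))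
      cases oN
      · have e : ι (g 3) = (FreeGroup.of 2)⁻¹ * FreeGroup.of 1 ^ n * FreeGroup.of 2 := by
          simp [g, hι, iotaH, iotaFun]
        have e' : d * bar (g 3) = d * z⁻¹ * y ^ n * z := by
          simp only [bar, e, map_mul, map_pow, map_inv, hx, hy, hz, mul_assoc]
        rw [e'] at hb3
        rw [e, act_mul, act_mul, szi _ hd, pv, sz _ _ hb3, e']
      · have e : ι (g 3) = (FreeGroup.of 2)⁻¹ * FreeGroup.of 1 ^ n := by
          simp [g, hι, iotaH, iotaFun]
        have e' : d * bar (g 3) = d * z⁻¹ * y ^ n := by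
          simp only [bar, e, map_mul, map_pow, map_inv, hx, hy, hz, mul_assoc]
        rw [e, act_mul, szi _ hd, pv, e']
    · show act (ι (g 4)) (d, l) = (d * bar (g 4), l * L d (g 4))
      cases oN
      · have e : ι (g 4) = FreeGroup.of 1 * FreeGroup.of 1 ^ (n-1) := by
          obtain ⟨n, rfl⟩ : ∃ k, n = k + 1 := ⟨n - 1, by omega⟩
          simp [g, hι, iotaH, iotaFun, pow_succ']
        have e' : d * bar (g 4) = d * y * y ^ (n-1) := by
          simp only [bar, e, map_mul, map_pow, map_inv, hx, hy, hz, mul_assoc]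
        rw [e, act_mul, sy _ hd, hpow 1 (n-1) _ _ _ (by omega), Y2 _ hd, e']
        intro t h1 h2
        obtain ⟨h3, h4⟩ := hpr.yw t h1 (by simp; omega)
        rw [mul_assoc]
        exact Y3 _ hd _ h3 h4
      · have e : ι (g 4) = FreeGroup.of 1 * FreeGroup.of 1 ^ n * FreeGroup.of 2 := by
          simp [g, hι, iotaH, iotaFun, pow_succ']
        have e' : d * bar (g 4) = d * y * y ^ n * z := by
          simp only [bar, e, map_mul, map_pow, map_inv, hx, hy, hz, mul_assoc]
        rw [e'] at hb4
        rw [e, act_mul, act_mul, sy _ hd, hpow 1 n _ _ _ (by omega), Y2 _ hd, e', sz _ _ hb4]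
        intro t h1 h2
        obtain ⟨h3, h4⟩ := hpr.yw t h1 (by simp; omega)
        rw [mul_assoc]
        exact Y3 _ hd _ h3 h4
    · have e : ι (g 5) = FreeGroup.of 2 ^ p := by
        simp [g, hι, iotaH, iotaFun]
      show act (ι (g 5)) (d, l) = (d * bar (g 5), l * L d (g 5))
      rw [e, pz]; simp only [bar, e, map_pow, hz]
    · have e : ι (g 6) = FreeGroup.of 1 * FreeGroup.of 2 ^ p * (FreeGroup.of 1)⁻¹ := by
        simp [g, hι, iotaH, iotaFun]
      have e' : d * bar (g 6) = d * y * z ^ p * y⁻¹ := by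
        simp only [bar, e, map_mul, map_pow, map_inv, hx, hy, hz, mul_assoc]
      show act (ι (g 6)) (d, l) = (d * bar (g 6), l * L d (g 6))
      rw [e'] at hb6
      rw [e, act_mul, act_mul, sy _ hd, pz', syi _ _ hb6, e']
  have key2 : ∀ c d l, d ∈ D → act (ι c) (d, l) = (d * bar c, l * L d c) := by
    intro c
    induction c using FreeGroup.induction_on with
    | C1 => intro d l hd; rw [map_one, act_one]; simp [bar, L]
    | of i => exact key i
    | inv_of i ih =>
      intro d l hd
      rw [map_inv]
      apply act_inv'
      rw [ih _ _ (D.mul_mem hd (bar_mem _))]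
      simp only [bar, L, map_inv, inv_mul_cancel_right, Prod.mk.injEq, true_and]; group
    | mul a b iha ihb =>
      intro d l hd
      rw [map_mul, act_mul, iha _ _ hd, ihb _ _ (D.mul_mem hd (bar_mem _)), bar_mul, ← L_mul]
      simp [mul_assoc]
  refine ⟨⟨⟨fun k => P k.1 1, ?_⟩, ?_⟩, fun k => hP1 _ _, ?_⟩
  · have := hP2 1 1 1
    rw [act_one] at this
    simpa using (congrArg Prod.snd this).symm
  · intro a b
    have h1 := hP2 (a * b : f.ker).1 1 1
    have e : ((a * b : f.ker) : FreeGroup (Fin 3)) = a.1 * b.1 := rfl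
    rw [e, act_mul, hP2, hP2] at h1
    have h2 := congrArg Prod.snd h1
    simp only [one_mul] at h2
    have h3 : f a.1 = 1 := a.2
    rw [h3] at h2
    exact h2.symm
  · intro c hc
    have h1 := hP2 (ι c) 1 1
    rw [key2 _ _ _ D.one_mem] at h1
    have h2 := congrArg Prod.snd h1
    have h3 : bar c = 1 := hc
    simp only [one_mul, L, h3, mul_one, hσ1, inv_one] at h2
    exact h2.symm


open Equiv
set_option linter.all false

theorem rf_of_quotient (oM oN : Bool) (m n p : ℕ) (hm : 2 ≤ m) (hn : 2 ≤ n) (hp : 2 ≤ p)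
    {Q : Type} [Group Q] [Finite Q] (a b c : Q)
    (h1 : ArtRel oM m a b) (h2 : ArtRel oN n b c) (h3 : ArtRel false p c a)
    (hpr : Privacy oM oN m n p (a * b) (b * c) (c * a)
      (fun q => q ∈ ((evA (a * b) (b * c) (c * a)).comp (iotaH oM oN m n p)).range)) :
    ResiduallyFinite (Artin3 (len oM m) (len oN n) (len false p)) := by
  set rels := artinRels3 (len oM m) (len oN n) (len false p) with hrels
  let Pm := PresentedGroup.mk rels
  let a' : PresentedGroup rels := PresentedGroup.of 0
  let b' : PresentedGroup rels := PresentedGroup.of 1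
  let c' : PresentedGroup rels := PresentedGroup.of 2
  have hone : ∀ r ∈ rels, Pm r = 1 := fun r hr => PresentedGroup.one_of_mem hr
  have r1 : ArtRel oM m a' b' := by
    exact (artRel_iff Pm oM m 0 1).mp (hone _ (by simp [hrels, artinRels3]))
  have r2 : ArtRel oN n b' c' := by
    exact (artRel_iff Pm oN n 1 2).mp (hone _ (by simp [hrels, artinRels3]))
  have r3 : ArtRel false p c' a' := by
    exact (artRel_iff Pm false p 2 0).mp (hone _ (by simp [hrels, artinRels3]))
  let f : FreeGroup (Fin 3) →* Q := evA (a * b) (b * c) (c * a)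
  have hfx : f (FreeGroup.of 0) = a * b := evA_x ..
  have hfy : f (FreeGroup.of 1) = b * c := evA_y ..
  have hfz : f (FreeGroup.of 2) = c * a := evA_z ..
  obtain ⟨r, hr1, hr2⟩ := exists_retraction oM oN m n p hm hn hp f (by
    rw [hfx, hfy, hfz]; exact hpr)
  have hfi : (f.ker).FiniteIndex := inferInstance
  refine core_rf (A := FreeGroup (Fin 3)) (C := FreeGroup (Fin 7)) freeGroup_rf
    (evA (a' * b') (b' * c') (c' * a')) (iotaH oM oN m n p) (phiH oM oN) (FreeGroup.of 0)
    (b' * c' * a') (phiH_eta _ _) (phiH_phiH _ _) ?_ (conj_rel_of_artRel oM oN m n p a' b' c' r1 r2 r3)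
    ?_ ?_ f.ker ?_ r hr1 hr2
  · simp [iotaH, iotaFun, mul_assoc]
  · rw [eq_top_iff, ← PresentedGroup.closure_range_of, Subgroup.closure_le]
    set S := Subgroup.closure (Set.range (evA (a' * b') (b' * c') (c' * a')) ∪ {b' * c' * a'}) with hS
    have hy : b' * c' ∈ S := Subgroup.subset_closure (Or.inl ⟨FreeGroup.of 1, by simp⟩)
    have hz : c' * a' ∈ S := Subgroup.subset_closure (Or.inl ⟨FreeGroup.of 2, by simp⟩)
    have hh : b' * c' * a' ∈ S := Subgroup.subset_closure (Or.inr rfl)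
    have ha : a' ∈ S := by
      have := S.mul_mem (S.inv_mem hy) hh
      rwa [inv_mul_cancel_left] at this
    have hb : b' ∈ S := by
      have := S.mul_mem hh (S.inv_mem hz)
      rwa [mul_assoc b' c' a', mul_inv_cancel_right] at this
    have hc : c' ∈ S := by
      have := S.mul_mem (S.inv_mem hb) hy
      rwa [inv_mul_cancel_left] at this
    rintro _ ⟨i, rfl⟩
    fin_cases i
    · exact ha
    · exact hb
    · exact hc
  · intro E _ α π h4 h5
    obtain ⟨A, B, C, s1, s2, s3, e1, e2, e3, e4⟩ := artRel_of_conj_rel oM oN m n p α π h4 h5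
    have hF : ∀ r ∈ rels, FreeGroup.lift ![A, B, C] r = 1 := by
      intro r hr
      simp only [hrels, artinRels3, Set.mem_insert_iff, Set.mem_singleton_iff] at hr
      rcases hr with rfl | rfl | rfl
      · rw [artRel_iff]; simpa using s1
      · rw [artRel_iff]; simpa using s2
      · rw [artRel_iff]; simpa using s3
    let F : PresentedGroup rels →* Perm E := PresentedGroup.toGroup hF
    have hA : F a' = A := by simp [F, a']
    have hB : F b' = B := by simp [F, b']
    have hC : F c' = C := by simp [F, c']
    refine ⟨F, ?_, ?_⟩
    · intro w
      have : F.comp (evA (a' * b') (b' * c') (c' * a')) = α := by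
        ext i : 1
        fin_cases i
        · simp [hA, hB, e1]
        · simp [hB, hC, e2]
        · simp [hC, hA, e3]
      exact DFunLike.congr_fun this w
    · rw [map_mul, map_mul, hA, hB, hC, e4]
  · intro w hw
    have := conj_rel_of_artRel oM oN m n p a b c h1 h2 h3 w
    rw [MonoidHom.mem_ker] at hw ⊢
    change b * c * a * f _ = f _ * (b * c * a) at this
    rw [hw, mul_one] at this
    exact mul_eq_right.mp this.symm

/-- Seeds: a right action of a group with the required orbit structure. -/
structure Seed (oM oN : Bool) (m n p : ℕ) {Q Ω : Type} [Monoid Q] (act : Q → Ω → Ω) (a b c : Q)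
    (u v w : Ω) : Prop where
  hb : act b u = v
  hc : act c v = w
  ha : act a w = u
  z1 : (c * a) ^ p = 1
  zu : ∀ k, 0 < k → k < p → act ((c * a) ^ k) u ≠ u
  zw : ∀ k, 0 < k → k < p → act ((c * a) ^ k) w ≠ w
  zuw : ∀ k, k < p → act ((c * a) ^ k) u ≠ w
  xo : oM = true → (a * b) ^ m * a = b * (a * b) ^ m ∧ (a * b) ^ (2 * m + 1) = 1 ∧
    act ((a * b) ^ m) u = w ∧ ∀ k, 0 < k → k < 2 * m + 1 → act ((a * b) ^ k) u ≠ u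
  xe : oM = false → (a * b) ^ m = 1 ∧ (∀ k, 0 < k → k < m → act ((a * b) ^ k) u ≠ u) ∧
    (∀ k, 0 < k → k < m → act ((a * b) ^ k) w ≠ w) ∧ ∀ k, k < m → act ((a * b) ^ k) u ≠ w
  yo : oN = true → (b * c) ^ n * b = c * (b * c) ^ n ∧ (b * c) ^ (2 * n + 1) = 1 ∧
    act ((b * c) ^ n) v = u ∧ ∀ k, 0 < k → k < 2 * n + 1 → act ((b * c) ^ k) u ≠ u
  ye : oN = false → (b * c) ^ n = 1 ∧ (∀ k, 0 < k → k < n → act ((b * c) ^ k) u ≠ u) ∧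
    (∀ k, 0 < k → k < n → act ((b * c) ^ k) v ≠ v) ∧ ∀ k, k < n → act ((b * c) ^ k) u ≠ v

theorem rf_of_seed (oM oN : Bool) (m n p : ℕ) (hm : 2 ≤ m) (hn : 2 ≤ n) (hp : 2 ≤ p)
    {Q Ω : Type} [Group Q] [Finite Q] (act : Q → Ω → Ω) (act1 : ∀ q, act 1 q = q)
    (actm : ∀ g h q, act (g * h) q = act h (act g q)) (a b c : Q) (u v w : Ω)
    (S : Seed oM oN m n p act a b c u v w) :
    ResiduallyFinite (Artin3 (len oM m) (len oN n) (len false p)) := by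
  have inj : ∀ g q q', act g q = act g q' → q = q' := by
    intro g q q' h
    have := congrArg (act g⁻¹) h
    rwa [← actm, ← actm, mul_inv_cancel, act1, act1] at this
  have acti : ∀ g q q', act g q = q' → act g⁻¹ q' = q := by
    rintro g q _ rfl
    rw [← actm, mul_inv_cancel, act1]
  have acti' : ∀ g q q', act g⁻¹ q = q' → q = act g q' := by
    rintro g q _ rfl
    rw [← actm, inv_mul_cancel, act1]
  have hyu : act (b * c) u = w := by rw [actm, S.hb, S.hc]
  have hxw : act (a * b) w = v := by rw [actm, S.ha, S.hb]
  have hzv : act (c * a) v = u := by rw [actm, S.hc, S.ha]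
  obtain ⟨hb, hc, ha, z1, zu, zw, zuw, xo, xe, yo, ye⟩ := S
  have h1 : ArtRel oM m a b := by
    cases oM
    · simp [ArtRel, (xe rfl).1]
    · simp [ArtRel, (xo rfl).1]
  have h2 : ArtRel oN n b c := by
    cases oN
    · simp [ArtRel, (ye rfl).1]
    · simp [ArtRel, (yo rfl).1]
  have h3 : ArtRel false p c a := by simp [ArtRel, z1]
  refine rf_of_quotient oM oN m n p hm hn hp a b c h1 h2 h3 ?_
  replace xo : oM = true → (a * b) ^ (2 * m + 1) = 1 ∧
    act ((a * b) ^ m) u = w ∧ ∀ k, 0 < k → k < 2 * m + 1 → act ((a * b) ^ k) u ≠ u :=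
    fun h => (xo h).2
  replace yo : oN = true → (b * c) ^ (2 * n + 1) = 1 ∧
    act ((b * c) ^ n) v = u ∧ ∀ k, 0 < k → k < 2 * n + 1 → act ((b * c) ^ k) u ≠ u :=
    fun h => (yo h).2
  clear hb hc ha h1 h2 h3
  generalize a * b = x at *
  generalize b * c = y at *
  generalize c * a = z at *
  have pw1 : ∀ (g : Q) k q, act (g ^ k) (act g q) = act (g ^ (k+1)) q := by
    intro g k q; rw [pow_succ', actm]
  have pw2 : ∀ (g : Q) k q, act g (act (g ^ k) q) = act (g ^ (k+1)) q := by
    intro g k q; rw [pow_succ, actm]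
  have pwa : ∀ (g : Q) k l q, act (g ^ k) (act (g ^ l) q) = act (g ^ (k+l)) q := by
    intro g k l q; rw [← actm, ← pow_add, add_comm]
  have cyc : ∀ (g : Q) M q, (∀ k, 0 < k → k < M → act (g ^ k) q ≠ q) → ∀ i j, i < M → j < M →
      act (g ^ i) q = act (g ^ j) q → i = j := by
    have aux : ∀ (g : Q) M q, (∀ k, 0 < k → k < M → act (g ^ k) q ≠ q) → ∀ i j, i < j → j < M →
      act (g ^ i) q ≠ act (g ^ j) q := by
      intro g M q h i j hij hj he
      apply h (j - i) (by omega) (by omega)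
      apply inj (g ^ i)
      rw [pwa, he, show i + (j - i) = j by omega]
    intro g M q h i j hi hj he
    rcases lt_trichotomy i j with h' | h' | h'
    · exact absurd he (aux g M q h i j h' hj)
    · exact h'
    · exact absurd he.symm (aux g M q h j i h' hi)
  have hfix : ∀ q, q ∈ ((evA x y z).comp (iotaH oM oN m n p)).range → act q u = u := by
    rintro _ ⟨t, rfl⟩
    induction t using FreeGroup.induction_on with
    | C1 => simp [act1]
    | inv_of i ih => rw [map_inv]; exact acti _ _ _ ih
    | mul s t ihs iht => rw [map_mul, actm, ihs, iht]
    | of i =>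
      have hzi := acti _ _ _ hzv
      have hyi := acti _ _ _ hyu
      fin_cases i <;> simp only [MonoidHom.comp_apply, iotaH, iotaFun, FreeGroup.lift_apply_of,
        Fin.zero_eta, Fin.mk_one, Fin.reduceFinMk, Matrix.cons_val, Matrix.cons_val_zero, Matrix.cons_val_one]
      · simp only [map_mul, evA_x, evA_y, evA_z, actm, hyu, hxw, hzv]
      · cases oM
        · simp [(xe rfl).1, act1]
        · simp [actm, (xo rfl).2.1, hyi]
      · cases oM
        · simp [(xe rfl).1, act1]
        · simp only [if_true, map_mul, map_pow, evA_x, evA_y, actm, hyu]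
          rw [← (xo rfl).2.1, pwa, show m + 1 + m = 2 * m + 1 by ring, (xo rfl).1, act1]
      · cases oN
        · simp [(ye rfl).1, act1]
        · simp [actm, hzi, (yo rfl).2.1]
      · cases oN
        · simp [(ye rfl).1, act1]
        · simp only [if_true, map_mul, map_pow, evA_x, evA_y, evA_z, actm]
          rw [← (yo rfl).2.1, pwa, show n + 1 + n = 2 * n + 1 by ring, (yo rfl).1, act1, hzv, (yo rfl).2.1]
      · simp [z1, act1]
      · simp [z1, act1]
  have toP : ∀ q t t', act q t ≠ t' → True := fun _ _ _ _ => trivial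
  constructor
  · intro h; have := hfix _ h
    rw [hyu] at this; exact zuw 0 (by omega) (by rw [pow_zero, act1, this])
  · intro h; have := hfix _ h
    exact zu 1 (by omega) (by omega) (by rwa [pow_one])
  · intro h; have := hfix _ h
    rw [actm, hyu] at this
    apply zuw (p - 1) (by omega)
    apply inj z
    rw [pw2, show p - 1 + 1 = p by omega, z1, act1, this]
  · intro k hk1 hk2
    refine ⟨fun h => ?_, fun h => ?_, fun h => ?_⟩ <;> replace h := hfix _ h <;> (try rw [actm] at h)
    · cases oM
      · exact (xe rfl).2.1 k hk1 hk2 h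
      · exact (xo rfl).2.2 k hk1 (by omega) h
    · replace h := acti' _ _ _ h
      rw [hyu] at h
      cases oM
      · exact (xe rfl).2.2.2 k hk2 h
      · rw [← (xo rfl).2.1] at h
        have := cyc _ _ _ (xo rfl).2.2 _ _ (by omega) (by omega) h
        omega
    · rw [← hzv] at h
      replace h := inj _ _ _ h
      rw [hzv, ← hxw] at h
      cases oM
      · refine (xe rfl).2.2.2 (k - 1) (by omega) (inj x _ _ ?_)
        rw [pw2, show k - 1 + 1 = k by omega, h]
      · rw [← (xo rfl).2.1, pw2] at h
        have := cyc _ _ _ (xo rfl).2.2 _ _ (by omega) (by omega) h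
        omega
  · intro k hk1 hk2
    have hzi := acti _ _ _ hzv
    refine ⟨fun h => ?_, fun h => ?_, fun h => ?_⟩ <;> replace h := hfix _ h <;> simp only [actm, hzi] at h
    · cases oM
      · simp at hk2
        rw [← hxw, pw1] at h
        apply (xe rfl).2.2.2 (m - (k + 1)) (by omega)
        rw [← h, pwa, show m - (k + 1) + (k + 1) = m by omega, (xe rfl).1, act1]
      · simp at hk2
        rw [← hxw, pw1, ← (xo rfl).2.1, pwa] at h
        exact (xo rfl).2.2 _ (by omega) (by omega) h
    · replace h := acti' _ _ _ h
      rw [hyu, ← hxw, pw1] at h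
      cases oM
      · simp at hk2
        exact (xe rfl).2.2.1 _ (by omega) (by omega) h
      · simp at hk2
        rw [← (xo rfl).2.1, pwa] at h
        have := cyc _ _ _ (xo rfl).2.2 _ _ (by omega) (by omega) h
        omega
    · rw [← hzv] at h
      replace h := inj _ _ _ h
      rw [← hxw, pw1] at h
      cases oM
      · simp at hk2
        refine (xe rfl).2.2.1 k (by omega) (by omega) (inj x _ _ ?_)
        rw [pw2, h]
      · simp at hk2
        rw [← (xo rfl).2.1, pw2, pwa] at h
        have := cyc _ _ _ (xo rfl).2.2 _ _ (by omega) (by omega) h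
        omega
  · intro k hk1 hk2
    have hzi := acti _ _ _ hzv
    refine ⟨fun h => ?_, fun h => ?_⟩ <;> replace h := hfix _ h <;> simp only [actm, hzi] at h
    · rw [← hzv] at h
      replace h := inj _ _ _ h
      cases oN
      · exact (ye rfl).2.2.1 k hk1 hk2 h
      · obtain ⟨y1, y2, y3⟩ := yo rfl
        refine y3 k hk1 (by omega) ?_
        rw [← y2, pwa, add_comm, ← pwa, h]
    · replace h := acti' _ _ _ h
      cases oN
      · obtain ⟨y1, y2, y3, y4⟩ := ye rfl
        have h' : act (y ^ (k - 1)) v = u := by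
          apply inj y; rw [pw2, show k - 1 + 1 = k by omega, h]
        rcases Nat.eq_or_lt_of_le (show 1 ≤ k from hk1) with rfl | hk3
        · rw [show 1 - 1 = 0 from rfl, pow_zero, act1] at h'
          exact y4 0 (by omega) (by rw [pow_zero, act1, h'])
        · apply y4 (n - (k - 1)) (by omega)
          rw [← h', pwa, show n - (k-1) + (k-1) = n by omega, y1, act1]
      · obtain ⟨y1, y2, y3⟩ := yo rfl
        have hv : v = act (y ^ (n + 1)) u := by
          rw [← y2, pwa, show n + 1 + n = 2 * n + 1 by ring, y1, act1]
        rw [hv, pwa, ← pow_one y, ← pow_mul] at h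
        have := cyc _ _ _ y3 _ _ (by omega) (by omega) h
        omega
  · intro k hk1 hk2
    refine ⟨fun h => ?_, fun h => ?_⟩ <;> replace h := hfix _ h <;> simp only [actm] at h
    · rw [← hzv] at h
      replace h := inj _ _ _ h
      rw [hzv, pw1] at h
      cases oN
      · simp at hk2
        exact (ye rfl).2.2.2 _ (by omega) h
      · simp at hk2
        obtain ⟨y1, y2, y3⟩ := yo rfl
        have hv : v = act (y ^ (n + 1)) u := by
          rw [← y2, pwa, show n + 1 + n = 2 * n + 1 by ring, y1, act1]
        rw [hv] at h
        have := cyc _ _ _ y3 _ _ (by omega) (by omega) h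
        omega
    · replace h := acti' _ _ _ h
      rw [pw1, ← pw2] at h
      replace h := inj _ _ _ h
      cases oN
      · simp at hk2
        exact (ye rfl).2.1 _ (by omega) (by omega) h
      · simp at hk2
        obtain ⟨y1, y2, y3⟩ := yo rfl
        exact y3 _ (by omega) (by omega) h
  · intro k hk1 hk2
    refine ⟨fun h => ?_, fun h => ?_⟩ <;> replace h := hfix _ h <;> (try rw [actm] at h)
    · exact zu k hk1 hk2 h
    · replace h := acti' _ _ _ h
      rw [hyu] at h
      exact zuw k hk2 h
  · intro k hk1 hk2
    refine ⟨fun h => ?_, fun h => ?_⟩ <;> replace h := hfix _ h <;> simp only [actm, hyu] at h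
    · apply zuw (p - k) (by omega)
      rw [← h, pwa, show p - k + k = p by omega, z1, act1]
    · replace h := acti' _ _ _ h
      rw [hyu] at h
      exact zw k hk1 hk2 h


open Equiv
set_option linter.all false

theorem int_jacobson : IsJacobsonRing ℤ := by
  rw [isJacobsonRing_iff_prime_eq]
  intro P hP
  by_cases h : P = ⊥
  · subst h
    rw [eq_bot_iff]
    intro x hx
    by_contra hx0
    rw [Ideal.mem_bot] at hx0
    obtain ⟨p, hp1, hp2⟩ := Nat.exists_infinite_primes (x.natAbs + 1)
    have hpi : Prime (p : ℤ) := Nat.prime_iff_prime_int.mp hp2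
    have hmax : (Ideal.span {(p : ℤ)}).IsMaximal :=
      PrincipalIdealRing.isMaximal_of_irreducible hpi.irreducible
    rw [Ideal.jacobson, Ideal.mem_sInf] at hx
    have := hx (I := Ideal.span {(p : ℤ)}) ⟨bot_le, hmax⟩
    rw [Ideal.mem_span_singleton] at this
    have := Int.natAbs_dvd_natAbs.mpr this
    have := Nat.le_of_dvd (by omega) this
    simp at this
    omega
  · have := hP.isMaximal h
    exact Ideal.jacobson_eq_self_of_isMaximal

theorem finite_of_field_finiteType (k : Type) [Field k] [Algebra.FiniteType ℤ k] : Finite k := by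
  have := int_jacobson
  have hf := finite_of_finite_type_of_isJacobsonRing ℤ k
  obtain ⟨p, hp⟩ := CharP.exists k
  have hp0 : p ≠ 0 := by
    rintro rfl
    have : CharZero k := CharP.charP_to_charZero k
    have hInteg : Algebra.IsIntegral ℤ k := inferInstance
    exact Int.not_isField (isField_of_isIntegral_of_isField (R := ℤ) (S := k)
      (RingHom.injective_int _) (Field.toIsField k))
  apply Module.finite_of_fg_torsion k
  intro x
  refine ⟨⟨(p : ℤ), ?_⟩, ?_⟩
  · simpa using hp0
  · change (p : ℤ) • x = 0
    simp

theorem finite_of_field_finiteType' (k : Type) [Field k] [inst : Algebra ℤ k] [h : Algebra.FiniteType ℤ k] :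
    Finite k := by
  have : inst = Ring.toIntAlgebra k := Subsingleton.elim _ _
  subst this
  exact finite_of_field_finiteType k

theorem exists_finite_reduction (T : Finset ℂ) (δ : Algebra.adjoin ℤ (T : Set ℂ)) (hδ : δ ≠ 0) :
    ∃ (k : Type) (_ : Field k) (_ : Finite k) (φ : Algebra.adjoin ℤ (T : Set ℂ) →+* k), φ δ ≠ 0 := by
  have := int_jacobson
  have hft : Algebra.FiniteType ℤ (Algebra.adjoin ℤ (T : Set ℂ)) :=
    (Subalgebra.fg_iff_finiteType _).mp (Subalgebra.fg_adjoin_finset T)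
  have hj : IsJacobsonRing (Algebra.adjoin ℤ (T : Set ℂ)) := isJacobsonRing_of_finiteType (A := ℤ)
  have hb := (isJacobsonRing_iff.mp hj) ⊥ (by
    intro x hx
    obtain ⟨n, hn⟩ := hx
    rw [Ideal.mem_bot] at hn ⊢
    exact eq_zero_of_pow_eq_zero hn)
  have : δ ∉ (⊥ : Ideal (Algebra.adjoin ℤ (T : Set ℂ))).jacobson := by
    rw [hb, Ideal.mem_bot]; exact hδ
  rw [Ideal.jacobson, Ideal.mem_sInf] at this
  push Not at this
  obtain ⟨I, ⟨_, hI⟩, hδI⟩ := this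
  letI := Ideal.Quotient.field I
  refine ⟨Algebra.adjoin ℤ (T : Set ℂ) ⧸ I, inferInstance, ?_, Ideal.Quotient.mk I, ?_⟩
  · have : Algebra.FiniteType ℤ (Algebra.adjoin ℤ (T : Set ℂ) ⧸ I) := inferInstance
    exact @finite_of_field_finiteType' _ _ (Ideal.Quotient.algebra ℤ) this
  · rwa [Ne, Ideal.Quotient.eq_zero_iff_mem]

theorem exists_finite_reduction' (T : Finset ℂ) {ι : Type} [Fintype ι]
    (F : Finset (ι → Algebra.adjoin ℤ (T : Set ℂ))) :
    ∃ (k : Type) (_ : Field k) (_ : Finite k) (φ : Algebra.adjoin ℤ (T : Set ℂ) →+* k),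
      ∀ δ ∈ F, (∀ i, φ (δ i) = 0) → δ = 0 := by
  classical
  have hch : ∀ δ : ι → Algebra.adjoin ℤ (T : Set ℂ), ∃ e : Algebra.adjoin ℤ (T : Set ℂ), e ≠ 0 ∧
      (δ ≠ 0 → ∃ i, e = δ i) := by
    intro δ
    by_cases h : δ = 0
    · exact ⟨1, one_ne_zero, fun h' => absurd h h'⟩
    · obtain ⟨i, hi⟩ := Function.ne_iff.mp h
      exact ⟨δ i, hi, fun _ => ⟨i, rfl⟩⟩
  choose e he1 he2 using hch
  obtain ⟨k, hk1, hk2, φ, hφ⟩ := exists_finite_reduction T (∏ δ ∈ F, e δ)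
    (Finset.prod_ne_zero_iff.mpr fun δ _ => he1 δ)
  refine ⟨k, hk1, hk2, φ, fun δ hδ h => ?_⟩
  by_contra h0
  obtain ⟨i, hi⟩ := he2 δ h0
  rw [map_prod] at hφ
  have := (Finset.prod_ne_zero_iff.mp hφ) δ hδ
  rw [hi, h i] at this
  exact this rfl

theorem rf_of_complex_seed (oM oN : Bool) (m n p : ℕ) (hm : 2 ≤ m) (hn : 2 ≤ n) (hp : 2 ≤ p)
    {ι : Type} [Fintype ι] [DecidableEq ι] (a b c : (Matrix ι ι ℂ)ˣ) (u v w : ι → ℂ)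
    (S : Seed oM oN m n p (fun (g : (Matrix ι ι ℂ)ˣ) q => Matrix.vecMul q g.val) a b c u v w) :
    ResiduallyFinite (Artin3 (len oM m) (len oN n) (len false p)) := by
  classical
  let ent : Matrix ι ι ℂ → Finset ℂ := fun A => Finset.univ.image (fun q : ι × ι => A q.1 q.2)
  let T : Finset ℂ := ent a.val ∪ ent a.inv ∪ ent b.val ∪ ent b.inv ∪ ent c.val ∪ ent c.inv ∪
    Finset.univ.image u ∪ Finset.univ.image v ∪ Finset.univ.image w
  set R := Algebra.adjoin ℤ (T : Set ℂ) with hR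
  have hT : ∀ t ∈ T, t ∈ R := fun t ht => Algebra.subset_adjoin ht
  let j : R →+* ℂ := R.val.toRingHom
  have hj : Function.Injective j := Subtype.val_injective
  have lm : ∀ A : Matrix ι ι ℂ, (∀ i k, A i k ∈ T) → ∃ B : Matrix ι ι R, j.mapMatrix B = A := by
    intro A hA
    refine ⟨fun i k => ⟨A i k, hT _ (hA i k)⟩, ?_⟩
    ext i k; rfl
  have jinj : Function.Injective (j.mapMatrix : Matrix ι ι R → Matrix ι ι ℂ) := by
    intro A B h
    ext i k
    exact congrFun (congrFun h i) k
  have hent : ∀ (A : Matrix ι ι ℂ) i k, A i k ∈ ent A := by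
    intro A i k
    exact Finset.mem_image.mpr ⟨(i, k), Finset.mem_univ _, rfl⟩
  have lu : ∀ g : (Matrix ι ι ℂ)ˣ, (∀ i k, g.val i k ∈ T) → (∀ i k, g.inv i k ∈ T) →
      ∃ g' : (Matrix ι ι R)ˣ, Units.map j.mapMatrix.toMonoidHom g' = g := by
    intro g h1 h2
    obtain ⟨A, hA⟩ := lm _ h1
    obtain ⟨B, hB⟩ := lm _ h2
    refine ⟨⟨A, B, jinj ?_, jinj ?_⟩, ?_⟩
    · rw [map_mul, hA, hB, map_one]; exact g.val_inv
    · rw [map_mul, hA, hB, map_one]; exact g.inv_val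
    · ext1; exact hA
  have lv : ∀ q : ι → ℂ, (∀ i, q i ∈ T) → ∃ q' : ι → R, j ∘ q' = q := by
    intro q h
    exact ⟨fun i => ⟨q i, hT _ (h i)⟩, rfl⟩
  obtain ⟨a', ha'⟩ := lu a (fun i k => by simp [T, hent]) (fun i k => by
    have := hent a.inv i k
    simp only [T, Finset.mem_union]; tauto)
  obtain ⟨b', hb'⟩ := lu b (fun i k => by simp [T, hent]) (fun i k => by
    have := hent b.inv i k
    simp only [T, Finset.mem_union]; tauto)
  obtain ⟨c', hc'⟩ := lu c (fun i k => by simp [T, hent]) (fun i k => by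
    have := hent c.inv i k
    simp only [T, Finset.mem_union]; tauto)
  obtain ⟨u', hu'⟩ := lv u (fun i => by simp [T])
  obtain ⟨v', hv'⟩ := lv v (fun i => by simp [T])
  obtain ⟨w', hw'⟩ := lv w (fun i => by simp [T])
  let K := 2 * m + 2 * n + p + 2
  let F : Finset (ι → R) := (((({a', b', c'} : Finset ((Matrix ι ι R)ˣ)) ×ˢ ({a', b', c'} : Finset ((Matrix ι ι R)ˣ))) ×ˢ
    Finset.range K) ×ˢ (({u', v', w'} : Finset (ι → R)) ×ˢ ({u', v', w'} : Finset (ι → R)))).image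
      (fun t => Matrix.vecMul t.2.1 ((t.1.1.1 * t.1.1.2) ^ t.1.2).val - t.2.2)
  obtain ⟨k, hk1, hk2, φ, hφ⟩ := exists_finite_reduction' T F
  let Φ : (Matrix ι ι R)ˣ →* (Matrix ι ι k)ˣ := Units.map φ.mapMatrix.toMonoidHom
  let J : (Matrix ι ι R)ˣ →* (Matrix ι ι ℂ)ˣ := Units.map j.mapMatrix.toMonoidHom
  have hJ : Function.Injective J := Units.map_injective jinj
  have vΦ : ∀ (g : (Matrix ι ι R)ˣ) q, Matrix.vecMul (φ ∘ q) (Φ g).val = φ ∘ (Matrix.vecMul q g.val) := by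
    intro g q; ext i
    simp [Φ, Matrix.vecMul, dotProduct]
  have vJ : ∀ (g : (Matrix ι ι R)ˣ) q, Matrix.vecMul (j ∘ q) (J g).val = j ∘ (Matrix.vecMul q g.val) := by
    intro g q; ext i
    simp [J, Matrix.vecMul, dotProduct]
  have jv : ∀ q q' : ι → R, j ∘ q = j ∘ q' → q = q' := fun q q' h => hj.comp_left h
  have ne : ∀ g ∈ ({a', b', c'} : Finset ((Matrix ι ι R)ˣ)), ∀ g' ∈ ({a', b', c'} : Finset ((Matrix ι ι R)ˣ)),
      ∀ q ∈ ({u', v', w'} : Finset (ι → R)), ∀ q' ∈ ({u', v', w'} : Finset (ι → R)), ∀ i, i < K →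
      Matrix.vecMul (j ∘ q) ((J g * J g') ^ i).val ≠ j ∘ q' →
      Matrix.vecMul (φ ∘ q) ((Φ g * Φ g') ^ i).val ≠ φ ∘ q' := by
    intro g hg g' hg' q hq q' hq' i hi h1 h2
    apply h1
    rw [← map_mul, ← map_pow, vΦ] at h2
    rw [← map_mul, ← map_pow, vJ]
    congr 1
    rw [← sub_eq_zero]
    apply hφ
    · refine Finset.mem_image.mpr ⟨(((g, g'), i), (q, q')), ?_, rfl⟩
      simp only [Finset.mem_product, Finset.mem_range]
      exact ⟨⟨⟨hg, hg'⟩, hi⟩, hq, hq'⟩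
    · intro t
      rw [Pi.sub_apply, map_sub, sub_eq_zero]
      exact congrFun h2 t
  have eqv : ∀ (g : (Matrix ι ι R)ˣ) q q', Matrix.vecMul (j ∘ q) (J g).val = j ∘ q' →
      Matrix.vecMul (φ ∘ q) (Φ g).val = φ ∘ q' := by
    intro g q q' h
    rw [vJ] at h
    rw [vΦ, jv _ _ h]
  have ma : a' ∈ ({a', b', c'} : Finset ((Matrix ι ι R)ˣ)) := by simp
  have mb : b' ∈ ({a', b', c'} : Finset ((Matrix ι ι R)ˣ)) := by simp
  have mc : c' ∈ ({a', b', c'} : Finset ((Matrix ι ι R)ˣ)) := by simp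
  have mu : u' ∈ ({u', v', w'} : Finset (ι → R)) := by simp
  have mv : v' ∈ ({u', v', w'} : Finset (ι → R)) := by simp
  have mw : w' ∈ ({u', v', w'} : Finset (ι → R)) := by simp
  have eJ : ∀ g g', J g = J g' → Φ g = Φ g' := fun g g' h => by rw [hJ h]
  change J a' = a at ha'
  change J b' = b at hb'
  change J c' = c at hc'
  rw [← hu', ← hv', ← hw', ← ha', ← hb', ← hc'] at S
  obtain ⟨hb, hc, ha, z1, zu, zw, zuw, xo, xe, yo, ye⟩ := S
  refine rf_of_seed oM oN m n p hm hn hp (fun (g : (Matrix ι ι k)ˣ) q => Matrix.vecMul q g.val)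
    (by intro q; simp) (by intro g h q; simp) (Φ a') (Φ b') (Φ c') (φ ∘ u') (φ ∘ v') (φ ∘ w') ?_
  constructor
  · exact eqv _ _ _ hb
  · exact eqv _ _ _ hc
  · exact eqv _ _ _ ha
  · have := eJ ((c' * a') ^ p) 1 (by simpa using z1)
    simpa using this
  · intro i h1 h2; exact ne _ mc _ ma _ mu _ mu i (by omega) (zu i h1 h2)
  · intro i h1 h2; exact ne _ mc _ ma _ mw _ mw i (by omega) (zw i h1 h2)
  · intro i h1; exact ne _ mc _ ma _ mu _ mw i (by omega) (zuw i h1)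
  · intro h
    obtain ⟨e1, e2, e3, e4⟩ := xo h
    refine ⟨?_, ?_, ?_, ?_⟩
    · have := eJ ((a' * b') ^ m * a') (b' * (a' * b') ^ m) (by simpa using e1)
      simpa using this
    · have := eJ ((a' * b') ^ (2 * m + 1)) 1 (by simpa using e2)
      simpa using this
    · have := eqv ((a' * b') ^ m) u' w' (by simpa using e3)
      simpa using this
    · intro i h1 h2; exact ne _ ma _ mb _ mu _ mu i (by omega) (e4 i h1 h2)
  · intro h
    obtain ⟨e1, e2, e3, e4⟩ := xe h
    refine ⟨?_, ?_, ?_, ?_⟩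
    · have := eJ ((a' * b') ^ m) 1 (by simpa using e1)
      simpa using this
    · intro i h1 h2; exact ne _ ma _ mb _ mu _ mu i (by omega) (e2 i h1 h2)
    · intro i h1 h2; exact ne _ ma _ mb _ mw _ mw i (by omega) (e3 i h1 h2)
    · intro i h1; exact ne _ ma _ mb _ mu _ mw i (by omega) (e4 i h1)
  · intro h
    obtain ⟨e1, e2, e3, e4⟩ := yo h
    refine ⟨?_, ?_, ?_, ?_⟩
    · have := eJ ((b' * c') ^ n * b') (c' * (b' * c') ^ n) (by simpa using e1)
      simpa using this
    · have := eJ ((b' * c') ^ (2 * n + 1)) 1 (by simpa using e2)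
      simpa using this
    · have := eqv ((b' * c') ^ n) v' u' (by simpa using e3)
      simpa using this
    · intro i h1 h2; exact ne _ mb _ mc _ mu _ mu i (by omega) (e4 i h1 h2)
  · intro h
    obtain ⟨e1, e2, e3, e4⟩ := ye h
    refine ⟨?_, ?_, ?_, ?_⟩
    · have := eJ ((b' * c') ^ n) 1 (by simpa using e1)
      simpa using this
    · intro i h1 h2; exact ne _ mb _ mc _ mu _ mu i (by omega) (e2 i h1 h2)
    · intro i h1 h2; exact ne _ mb _ mc _ mv _ mv i (by omega) (e3 i h1 h2)
    · intro i h1; exact ne _ mb _ mc _ mu _ mv i (by omega) (e4 i h1)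

theorem rf_of_matrix_seed (oM oN : Bool) (m n p : ℕ) (hm : 2 ≤ m) (hn : 2 ≤ n) (hp : 2 ≤ p)
    {ι : Type} [Fintype ι] [DecidableEq ι] (a b c : Matrix ι ι ℂ) (u v w : ι → ℂ)
    (S : Seed oM oN m n p (fun (g : Matrix ι ι ℂ) q => Matrix.vecMul q g) a b c u v w) :
    ResiduallyFinite (Artin3 (len oM m) (len oN n) (len false p)) := by
  have key : ∀ (g h : Matrix ι ι ℂ) k, 0 < k → (g * h) ^ k = 1 → IsUnit g ∧ IsUnit h := by
    intro g h k hk e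
    obtain ⟨k, rfl⟩ : ∃ t, k = t + 1 := ⟨k - 1, by omega⟩
    constructor
    · rw [pow_succ', mul_assoc] at e
      exact IsUnit.of_mul_eq_one _ e
    · rw [pow_succ, ← mul_assoc] at e
      exact IsUnit.of_mul_eq_one_right _ e
  obtain ⟨uc, ua⟩ := key c a p (by omega) S.z1
  have ub : IsUnit b := by
    cases oM
    · exact (key a b m (by omega) (S.xe rfl).1).2
    · exact (key a b (2 * m + 1) (by omega) (S.xo rfl).2.1).2
  obtain ⟨a, rfl⟩ := ua
  obtain ⟨b, rfl⟩ := ub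
  obtain ⟨c, rfl⟩ := uc
  refine rf_of_complex_seed oM oN m n p hm hn hp a b c u v w ?_
  obtain ⟨hb, hc, ha, z1, zu, zw, zuw, xo, xe, yo, ye⟩ := S
  constructor
  · exact hb
  · exact hc
  · exact ha
  · ext1; simpa using z1
  · intro k h1 h2; have := zu k h1 h2; exact_mod_cast this
  · intro k h1 h2; have := zw k h1 h2; exact_mod_cast this
  · intro k h1; have := zuw k h1; exact_mod_cast this
  · intro h
    obtain ⟨e1, e2, e3, e4⟩ := xo h
    refine ⟨by ext1; exact_mod_cast e1, by ext1; simpa using e2, by exact_mod_cast e3, ?_⟩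
    intro k h1 h2; have := e4 k h1 h2; exact_mod_cast this
  · intro h
    obtain ⟨e1, e2, e3, e4⟩ := xe h
    refine ⟨by ext1; simpa using e1, ?_, ?_, ?_⟩
    · intro k h1 h2; have := e2 k h1 h2; exact_mod_cast this
    · intro k h1 h2; have := e3 k h1 h2; exact_mod_cast this
    · intro k h1; have := e4 k h1; exact_mod_cast this
  · intro h
    obtain ⟨e1, e2, e3, e4⟩ := yo h
    refine ⟨by ext1; exact_mod_cast e1, by ext1; simpa using e2, by exact_mod_cast e3, ?_⟩
    intro k h1 h2; have := e4 k h1 h2; exact_mod_cast this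
  · intro h
    obtain ⟨e1, e2, e3, e4⟩ := ye h
    refine ⟨by ext1; simpa using e1, ?_, ?_, ?_⟩
    · intro k h1 h2; have := e2 k h1 h2; exact_mod_cast this
    · intro k h1 h2; have := e3 k h1 h2; exact_mod_cast this
    · intro k h1; have := e4 k h1; exact_mod_cast this


open Equiv
set_option linter.all false

section Orders
open Polynomial
variable {ι : Type} [Fintype ι] [DecidableEq ι]

theorem ord_of_ann (M : Matrix ι ι ℂ) (N : ℕ) (hN : 2 ≤ N) (s : Finset ℂ)
    (hs : ∀ r ∈ s, IsPrimitiveRoot r N)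
    (h : (M - 1) * aeval M (∏ r ∈ s, (X - C r)) = 0) :
    M ^ N = 1 ∧ ∀ P, Matrix.vecMul P M ≠ P → ∀ k, 0 < k → k < N → Matrix.vecMul P (M ^ k) ≠ P := by
  have h1s : (1 : ℂ) ∉ s := by
    intro h1
    have := (hs 1 h1).pow_ne_one_of_pos_of_lt one_ne_zero (by omega)
    simp at this
  constructor
  · have hd : (X - C 1) * (∏ r ∈ s, (X - C r)) ∣ (X ^ N - 1 : ℂ[X]) := by
      rw [← Finset.prod_insert (f := fun r => X - C r) h1s]
      apply Finset.prod_dvd_of_coprime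
      · intro r _ t _ hrt
        exact pairwise_coprime_X_sub_C Function.injective_id hrt
      · intro r hr
        rw [dvd_iff_isRoot, IsRoot.def]
        rcases Finset.mem_insert.mp hr with rfl | hr
        · simp
        · simp [(hs r hr).pow_eq_one]
    obtain ⟨q, hq⟩ := hd
    have := congrArg (aeval M) hq
    rw [map_mul, map_mul] at this
    simp only [map_sub, aeval_X, map_one, map_pow] at this
    rw [h, zero_mul] at this
    exact sub_eq_zero.mp this
  · intro P hP k hk1 hk2 hk
    have hco : IsCoprime (∏ r ∈ s, (X - C r)) (X ^ k - 1 : ℂ[X]) := by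
      apply IsCoprime.prod_left
      intro r hr
      rw [(irreducible_X_sub_C r).coprime_iff_not_dvd, dvd_iff_isRoot, IsRoot.def]
      have := (hs r hr).pow_ne_one_of_pos_of_lt (by omega) hk2
      simpa [sub_eq_zero] using this
    obtain ⟨f, g, hfg⟩ := hco
    set Δ := Matrix.vecMul P (M - 1) with hΔ
    have hΔ0 : Δ ≠ 0 := by
      rw [hΔ, Matrix.vecMul_sub, Matrix.vecMul_one]
      exact sub_ne_zero.mpr hP
    have e1 : Matrix.vecMul Δ (aeval M (∏ r ∈ s, (X - C r))) = 0 := by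
      rw [hΔ, Matrix.vecMul_vecMul, h, Matrix.vecMul_zero]
    have e2 : Matrix.vecMul Δ (M ^ k - 1) = 0 := by
      have hc : (M - 1) * (M ^ k - 1) = (M ^ k - 1) * (M - 1) := by
        have : Commute M (M ^ k) := Commute.self_pow M k
        simp only [sub_mul, mul_sub, this.eq, one_mul, mul_one]; abel
      have h9 : Matrix.vecMul P (M ^ k - 1) = 0 := by
        rw [Matrix.vecMul_sub, hk, Matrix.vecMul_one, sub_self]
      rw [hΔ, Matrix.vecMul_vecMul, hc, ← Matrix.vecMul_vecMul, h9, Matrix.zero_vecMul]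
    apply hΔ0
    have := congrArg (fun q => Matrix.vecMul Δ (aeval M q)) hfg
    simp only [map_add, map_mul, map_one, Matrix.vecMul_one] at this
    rw [← this, Matrix.vecMul_add]
    have c1 : aeval M f * aeval M (∏ r ∈ s, (X - C r)) = aeval M (∏ r ∈ s, (X - C r)) * aeval M f := by
      rw [← map_mul, mul_comm, map_mul]
    have c2 : aeval M g * aeval M (X ^ k - 1 : ℂ[X]) = aeval M (X ^ k - 1 : ℂ[X]) * aeval M g := by
      rw [← map_mul, mul_comm, map_mul]
    have e3 : aeval M (X ^ k - 1 : ℂ[X]) = M ^ k - 1 := by simp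
    rw [e3] at c2 ⊢
    rw [c1, c2, ← Matrix.vecMul_vecMul, ← Matrix.vecMul_vecMul, e1, e2]
    simp

theorem ord1 (M : Matrix ι ι ℂ) (N : ℕ) (hN : 2 ≤ N) (ω : ℂ) (hω : IsPrimitiveRoot ω N)
    (h : (M - 1) * (M - ω • 1) = 0) :
    M ^ N = 1 ∧ ∀ P, Matrix.vecMul P M ≠ P → ∀ k, 0 < k → k < N → Matrix.vecMul P (M ^ k) ≠ P := by
  apply ord_of_ann M N hN {ω} (by simpa using hω)
  rw [← h]
  simp [Algebra.algebraMap_eq_smul_one]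

theorem prim_ne_inv {ω : ℂ} {N : ℕ} (hN : 3 ≤ N) (hω : IsPrimitiveRoot ω N) : ω ≠ ω⁻¹ := by
  intro h
  have h0 := hω.ne_zero (by omega)
  have : ω ^ 2 = 1 := by
    rw [pow_two]; nth_rewrite 2 [h]; exact mul_inv_cancel₀ h0
  exact hω.pow_ne_one_of_pos_of_lt (by omega) (by omega) this

theorem ord2 (M : Matrix ι ι ℂ) (N : ℕ) (hN : 3 ≤ N) (ω : ℂ) (hω : IsPrimitiveRoot ω N)
    (h : (M - 1) * (M * M - (ω + ω⁻¹) • M + 1) = 0) :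
    M ^ N = 1 ∧ ∀ P, Matrix.vecMul P M ≠ P → ∀ k, 0 < k → k < N → Matrix.vecMul P (M ^ k) ≠ P := by
  have h0 := hω.ne_zero (by omega)
  apply ord_of_ann M N (by omega) {ω, ω⁻¹}
  · intro r hr
    simp only [Finset.mem_insert, Finset.mem_singleton] at hr
    rcases hr with rfl | rfl
    · exact hω
    · exact hω.inv
  · rw [← h, Finset.prod_pair (prim_ne_inv hN hω)]
    congr 1
    simp only [map_mul, map_sub, aeval_X, aeval_C, Algebra.algebraMap_eq_smul_one, sub_mul, mul_sub,
      Algebra.smul_mul_assoc, Algebra.mul_smul_comm, one_mul, mul_one, smul_smul, add_smul, inv_mul_cancel₀ h0, mul_inv_cancel₀ h0, one_smul]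
    abel

/-- powers on the moving part, quadratic case: coefficients depend only on `ζ` -/
theorem pow_quad (ζ : ℂ) (k : ℕ) : ∃ c d : ℂ, c * c + ζ * c * d + d * d = 1 ∧
    ∀ M : Matrix ι ι ℂ, (M - 1) * (M * M - ζ • M + 1) = 0 →
      (M - 1) * M ^ k = (M - 1) * (c • 1 + d • M) := by
  induction k with
  | zero => exact ⟨1, 0, by ring, fun M _ => by simp⟩
  | succ k ih =>
    obtain ⟨c, d, h1, h2⟩ := ih
    refine ⟨-d, c + d * ζ, by linear_combination h1, fun M hM => ?_⟩
    have e : (M - 1) * (M * M) = (M - 1) * (ζ • M - 1) := by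
      rw [← sub_eq_zero, ← mul_sub, ← hM]; congr 1; abel
    rw [pow_succ, ← mul_assoc, h2 M hM]
    have : (M - 1) * (c • 1 + d • M) * M = c • ((M - 1) * M) + d • ((M - 1) * (M * M)) := by
      simp only [mul_assoc, add_mul, mul_add, Algebra.smul_mul_assoc, Algebra.mul_smul_comm, one_mul]
    rw [this, e]
    generalize M - 1 = Y
    simp only [mul_add, mul_sub, Algebra.smul_mul_assoc, Algebra.mul_smul_comm, mul_one]
    module

end Orders


open Equiv
set_option linter.all false

section SeedEEE

theorem aff1 (ω t : ℂ) (N : ℕ) (hN : 2 ≤ N) (hω : IsPrimitiveRoot ω N) (M : Matrix (Fin 2) (Fin 2) ℂ)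
    (hM : M = !![ω, 0; t, 1]) :
    M ^ N = 1 ∧
    (∀ p, (ω - 1) * p + t ≠ 0 → ∀ k, 0 < k → k < N → Matrix.vecMul ![p, 1] (M ^ k) ≠ ![p, 1]) ∧
    (∀ p q, ‖(ω - 1) * p + t‖ ≠ ‖(ω - 1) * q + t‖ → ∀ k, Matrix.vecMul ![p, 1] (M ^ k) ≠ ![q, 1]) := by
  have hv : ∀ p, Matrix.vecMul ![p, 1] M = ![ω * p + t, 1] := by
    intro p; subst hM
    ext i; fin_cases i <;> simp [Matrix.vecMul, dotProduct, Fin.sum_univ_two] <;> ring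
  have h := ord1 M N hN ω hω (by
    subst hM
    ext i j; fin_cases i <;> fin_cases j <;>
      simp [Matrix.mul_apply, Fin.sum_univ_two, Matrix.one_apply])
  refine ⟨h.1, ?_, ?_⟩
  · intro p hp
    apply h.2
    rw [hv]
    intro h1
    have := congrFun h1 0
    simp at this
    apply hp; linear_combination this
  · intro p q hpq k
    have : ∃ r, Matrix.vecMul ![p, 1] (M ^ k) = ![r, 1] ∧ (ω - 1) * r + t = ω ^ k * ((ω - 1) * p + t) := by
      induction k with
      | zero => exact ⟨p, by simp, by ring⟩
      | succ k ih =>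
        obtain ⟨r, h1, h2⟩ := ih
        refine ⟨ω * r + t, ?_, ?_⟩
        · rw [pow_succ, ← Matrix.vecMul_vecMul, h1, hv]
        · rw [pow_succ]; linear_combination ω * h2
    obtain ⟨r, h1, h2⟩ := this
    rw [h1]
    intro h3
    have h4 := congrFun h3 0
    simp at h4
    subst h4
    apply hpq
    rw [h2, norm_mul, norm_pow, hω.norm'_eq_one (by omega), one_pow, one_mul]

theorem exists_prim (N : ℕ) (hN : 2 ≤ N) : ∃ ω : ℂ, IsPrimitiveRoot ω N :=
  ⟨_, Complex.isPrimitiveRoot_exp N (by omega)⟩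

theorem normsq_prim {ω : ℂ} {N : ℕ} (hN : 2 ≤ N) (hω : IsPrimitiveRoot ω N) :
    ω.re ^ 2 + ω.im ^ 2 = 1 ∧ ω.re ≠ 1 := by
  have h1 := hω.norm'_eq_one (by omega)
  have h2 : ω.re ^ 2 + ω.im ^ 2 = 1 := by
    have := Complex.sq_norm ω
    rw [h1, Complex.normSq_apply] at this
    nlinarith
  refine ⟨h2, fun h => ?_⟩
  have : ω = 1 := by
    apply Complex.ext
    · simpa using h
    · rw [h] at h2; simp; nlinarith
  have h3 := hω.pow_ne_one_of_pos_of_lt one_ne_zero (by omega)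
  simp at h3; exact h3 this

theorem norm_ne_of {x y : ℂ} (h : x.re ^ 2 + x.im ^ 2 ≠ y.re ^ 2 + y.im ^ 2) : ‖x‖ ≠ ‖y‖ := by
  intro h1
  apply h
  have h2 := Complex.sq_norm x
  have h3 := Complex.sq_norm y
  rw [Complex.normSq_apply] at h2 h3
  rw [h1] at h2
  nlinarith

theorem rf_EEE (m n p : ℕ) (hm : 2 ≤ m) (hn : 2 ≤ n) (hp : 2 ≤ p) :
    ResiduallyFinite (Artin3 (len false m) (len false n) (len false p)) := by
  obtain ⟨ω1, h1⟩ := exists_prim m hm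
  obtain ⟨ω2, h2⟩ := exists_prim n hn
  obtain ⟨ω3, h3⟩ := exists_prim p hp
  have n1 := h1.ne_zero (by omega)
  have n2 := h2.ne_zero (by omega)
  have n3 := h3.ne_zero (by omega)
  obtain ⟨β, hβ⟩ := IsAlgClosed.exists_pow_nat_eq (ω1 * ω2 / ω3) (n := 2) (by norm_num)
  have nβ : β ≠ 0 := by
    rintro rfl
    have : ω1 * ω2 / ω3 ≠ 0 := div_ne_zero (mul_ne_zero n1 n2) n3
    apply this; rw [← hβ]; norm_num
  obtain ⟨α, hα⟩ : ∃ α, α * β = ω1 := ⟨ω1 / β, div_mul_cancel₀ _ nβ⟩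
  obtain ⟨γ, hγ⟩ : ∃ γ, β * γ = ω2 := ⟨ω2 / β, mul_div_cancel₀ _ nβ⟩
  have hγα : γ * α = ω3 := by
    have : β ^ 2 * ω3 = ω1 * ω2 := by rw [hβ]; field_simp
    have h4 : β ^ 2 * (γ * α - ω3) = 0 := by rw [← hα, ← hγ] at this; linear_combination -this
    rcases mul_eq_zero.mp h4 with h5 | h5
    · exact absurd h5 (pow_ne_zero _ nβ)
    · exact sub_eq_zero.mp h5
  have q1 := normsq_prim hm h1
  have q2 := normsq_prim hn h2
  have q3 := normsq_prim hp h3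
  have X := aff1 ω1 (1 - 3 * ω1) m hm h1 (!![α, 0; -3*α, 1] * !![β, 0; 1, 1]) (by
    rw [← hα]; ext i j; fin_cases i <;> fin_cases j <;> simp [Matrix.mul_apply, Fin.sum_univ_two] <;> ring)
  have Y := aff1 ω2 3 n hn h2 (!![β, 0; 1, 1] * !![γ, 0; 3 - γ, 1]) (by
    rw [← hγ]; ext i j; fin_cases i <;> fin_cases j <;> simp [Matrix.mul_apply, Fin.sum_univ_two] <;> ring)
  have Z := aff1 ω3 (-ω3) p hp h3 (!![γ, 0; 3 - γ, 1] * !![α, 0; -3*α, 1]) (by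
    rw [← hγα]; ext i j; fin_cases i <;> fin_cases j <;> simp [Matrix.mul_apply, Fin.sum_univ_two] <;> ring)
  have nn : ∀ {x : ℂ}, x.re ^ 2 + x.im ^ 2 ≠ 0 → x ≠ 0 := by
    rintro x h rfl; simp at h
  refine rf_of_matrix_seed false false m n p hm hn hp (ι := Fin 2)
    !![α, 0; -3*α, 1] !![β, 0; 1, 1] !![γ, 0; 3 - γ, 1] ![0, 1] ![1, 1] ![3, 1]
    { hb := ?_, hc := ?_, ha := ?_, z1 := Z.1, zu := Z.2.1 0 ?_, zw := Z.2.1 3 ?_, 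
      zuw := fun k _ => Z.2.2 0 3 ?_ k
      xo := fun h => by simp at h
      xe := fun _ => ⟨X.1, X.2.1 0 ?_, X.2.1 3 ?_, fun k _ => X.2.2 0 3 ?_ k⟩
      yo := fun h => by simp at h
      ye := fun _ => ⟨Y.1, Y.2.1 0 ?_, Y.2.1 1 ?_, fun k _ => Y.2.2 0 1 ?_ k⟩ }
  · ext i; fin_cases i <;> simp [Matrix.vecMul, dotProduct, Fin.sum_univ_two]
  · ext i; fin_cases i <;> simp [Matrix.vecMul, dotProduct, Fin.sum_univ_two]
  · ext i; fin_cases i <;> simp [Matrix.vecMul, dotProduct, Fin.sum_univ_two] <;> ring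
  · simpa using n3
  · apply nn; simp; intro h; apply q3.2; nlinarith
  · apply norm_ne_of; simp; intro h; apply q3.2; nlinarith
  · apply nn; simp; intro h; nlinarith
  · apply nn; simp; intro h; nlinarith
  · apply norm_ne_of; simp; intro h; apply q1.2; nlinarith
  · simp
  · apply nn; simp; intro h; nlinarith
  · apply norm_ne_of; simp; intro h; apply q2.2; nlinarith

end SeedEEE


open Equiv
set_option linter.all false

section Aff2

/-- translation part / displacement of an affine map of the plane -/
theorem aff2_vec (A B C D e f p q : ℂ) :
    Matrix.vecMul ![p, q, 1] !![A, B, 0; C, D, 0; e, f, 1] = ![p*A+q*C+e, p*B+q*D+f, 1] := by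
  ext i; fin_cases i <;> simp [Matrix.vecMul, dotProduct, Fin.sum_univ_three]

theorem aff2_vec0 (A B C D e f p q : ℂ) :
    Matrix.vecMul ![p, q, 0] !![A, B, 0; C, D, 0; e, f, 1] = ![p*A+q*C, p*B+q*D, 0] := by
  ext i; fin_cases i <;> simp [Matrix.vecMul, dotProduct, Fin.sum_univ_three]

theorem aff2_mul (A B C D e f A' B' C' D' e' f' : ℂ) :
    !![A, B, 0; C, D, 0; e, f, 1] * !![A', B', 0; C', D', 0; e', f', 1] =
    !![A*A'+B*C', A*B'+B*D', 0; C*A'+D*C', C*B'+D*D', 0; e*A'+f*C'+e', e*B'+f*D'+f', 1] := by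
  ext i j; fin_cases i <;> fin_cases j <;> simp [Matrix.mul_apply, Fin.sum_univ_three]

theorem aff2_ann (A B C D e f ζ : ℂ) (h1 : A + D = ζ) (h2 : A * D - B * C = 1) 
    (M : Matrix (Fin 3) (Fin 3) ℂ) (hM : M = !![A, B, 0; C, D, 0; e, f, 1]) :
    (M - 1) * (M * M - ζ • M + 1) = 0 := by
  have hq : M * M - ζ • M + 1 = !![0,0,0;0,0,0;e*A+f*C+e-ζ*e, e*B+f*D+f-ζ*f,2-ζ] := by
    rw [hM, aff2_mul]
    ext i j; fin_cases i <;> fin_cases j <;> simp [Matrix.one_apply]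
    · linear_combination A * h1 - h2
    · linear_combination B * h1
    · linear_combination C * h1
    · linear_combination D * h1 - h2
    · ring
  rw [hq, hM]
  ext i j; fin_cases i <;> fin_cases j <;> simp [Matrix.mul_apply, Fin.sum_univ_three, Matrix.one_apply]

theorem aff2_ord (A B C D e f : ℂ) (N : ℕ) (hN : 3 ≤ N) (ω : ℂ) (hω : IsPrimitiveRoot ω N)
    (h1 : A + D = ω + ω⁻¹) (h2 : A * D - B * C = 1)
    (M : Matrix (Fin 3) (Fin 3) ℂ) (hM : M = !![A, B, 0; C, D, 0; e, f, 1]) :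
    M ^ N = 1 ∧ ∀ p q, ¬ (p*A+q*C+e-p = 0 ∧ p*B+q*D+f-q = 0) →
      ∀ k, 0 < k → k < N → Matrix.vecMul ![p, q, 1] (M ^ k) ≠ ![p, q, 1] := by
  have h := ord2 M N hN ω hω (aff2_ann A B C D e f _ h1 h2 M hM)
  refine ⟨h.1, fun p q hpq => h.2 _ ?_⟩
  rw [hM, aff2_vec]
  intro h3
  have e1 := congrFun h3 0
  have e2 := congrFun h3 1
  simp at e1 e2
  exact hpq ⟨by linear_combination e1, by linear_combination e2⟩

theorem aff2_disj (ζ : ℂ) (k : ℕ) : ∃ c d : ℂ, c * c + ζ * c * d + d * d = 1 ∧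
    ∀ (A B C D e f : ℂ) (h1 : A + D = ζ) (h2 : A * D - B * C = 1)
    (M : Matrix (Fin 3) (Fin 3) ℂ) (hM : M = !![A, B, 0; C, D, 0; e, f, 1]) (p q p' q' : ℂ),
    Matrix.vecMul ![p, q, 1] (M ^ k) = ![p', q', 1] →
    p'*A+q'*C+e-p' = c * (p*A+q*C+e-p) + d * ((p*A+q*C+e-p)*A + (p*B+q*D+f-q)*C) ∧
    p'*B+q'*D+f-q' = c * (p*B+q*D+f-q) + d * ((p*A+q*C+e-p)*B + (p*B+q*D+f-q)*D) := by
  obtain ⟨c, d, hcd, h⟩ := pow_quad (ι := Fin 3) ζ k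
  refine ⟨c, d, hcd, fun A B C D e f h1 h2 M hM p q p' q' hk => ?_⟩
  have := h M (aff2_ann A B C D e f _ h1 h2 M hM)
  have hc : (M - 1) * M ^ k = M ^ k * (M - 1) := by
    have : Commute M (M ^ k) := Commute.self_pow M k
    simp only [sub_mul, mul_sub, this.eq, one_mul, mul_one]
  rw [hc] at this
  replace this := congrArg (Matrix.vecMul ![p, q, 1]) this
  rw [← Matrix.vecMul_vecMul, ← Matrix.vecMul_vecMul, hk] at this
  have hd : ∀ p q, Matrix.vecMul ![p, q, 1] (M - 1) = ![p*A+q*C+e-p, p*B+q*D+f-q, 0] := by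
    intro p q
    rw [Matrix.vecMul_sub, hM, aff2_vec, Matrix.vecMul_one]
    ext i; fin_cases i <;> simp
  rw [hd, hd, Matrix.vecMul_add, Matrix.vecMul_smul, Matrix.vecMul_smul, Matrix.vecMul_one, hM, aff2_vec0] at this
  have e1 := congrFun this 0
  have e2 := congrFun this 1
  simp at e1 e2
  exact ⟨e1, e2⟩

end Aff2

section OddSide
variable {ι : Type} [Fintype ι] [DecidableEq ι]

theorem odd_exact (ξ : Matrix ι ι ℂ) (m : ℕ) (h : ξ ^ (2*m+1) = 1) (u : ι → ℂ)
    (hu : ∀ k, 0 < k → k < 2*m+1 → Matrix.vecMul u (ξ ^ k) ≠ u) :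
    ∀ k, 0 < k → k < 2*m+1 → Matrix.vecMul u ((ξ * ξ) ^ k) ≠ u := by
  intro k h1 h2
  rw [← pow_two, ← pow_mul]
  by_cases hk : 2 * k < 2 * m + 1
  · exact hu _ (by omega) hk
  · have : 2 * k = (2 * m + 1) + (2 * k - (2 * m + 1)) := by omega
    rw [this, pow_add, h, one_mul]
    exact hu _ (by omega) (by omega)

theorem odd_x (s b : Matrix ι ι ℂ) (m : ℕ) (hs : s * s = 1) (h : (s * b) ^ (2*m+1) = 1) (u w : ι → ℂ)
    (hw : Matrix.vecMul w (s * b) = u)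
    (hu : ∀ k, 0 < k → k < 2*m+1 → Matrix.vecMul u ((s * b) ^ k) ≠ u) :
    ((s*b*s)*b)^m*(s*b*s) = b*((s*b*s)*b)^m ∧ ((s*b*s)*b)^(2*m+1)=1 ∧ 
    Matrix.vecMul u (((s*b*s)*b)^m) = w ∧ 
    ∀ k, 0 < k → k < 2*m+1 → Matrix.vecMul u (((s*b*s)*b)^k) ≠ u := by
  have hx : s*b*s*b = (s*b)*(s*b) := by simp only [mul_assoc]
  have hb : b = s * (s * b) := by rw [← mul_assoc, hs, one_mul]
  rw [hx]
  refine ⟨?_, ?_, ?_, odd_exact _ m h u hu⟩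
  · rw [← pow_two, ← pow_mul, ← mul_assoc, ← pow_succ, h, one_mul]
    calc s = s * (s * b) ^ (2 * m + 1) := by rw [h, mul_one]
      _ = s * ((s * b) * (s * b) ^ (2 * m)) := by rw [pow_succ']
      _ = (s * (s * b)) * (s * b) ^ (2 * m) := by rw [mul_assoc s (s * b)]
      _ = b * (s * b) ^ (2 * m) := by rw [← hb]
  · rw [← pow_two, ← pow_mul, mul_comm, pow_mul, h, one_pow]
  · rw [← pow_two, ← pow_mul, ← hw, Matrix.vecMul_vecMul, ← pow_succ', h, Matrix.vecMul_one]

theorem odd_y (b r : Matrix ι ι ℂ) (n : ℕ) (hr : r * r = 1) (h : (b * r) ^ (2*n+1) = 1) (u v : ι → ℂ)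
    (hw : Matrix.vecMul u (b * r) = v)
    (hu : ∀ k, 0 < k → k < 2*n+1 → Matrix.vecMul u ((b * r) ^ k) ≠ u) :
    (b*(r*b*r))^n*b = (r*b*r)*(b*(r*b*r))^n ∧ (b*(r*b*r))^(2*n+1)=1 ∧ 
    Matrix.vecMul v ((b*(r*b*r))^n) = u ∧ 
    ∀ k, 0 < k → k < 2*n+1 → Matrix.vecMul u ((b*(r*b*r))^k) ≠ u := by
  have hx : b*(r*b*r) = (b*r)*(b*r) := by simp only [mul_assoc]
  have hb : b = (b * r) * r := by rw [mul_assoc, hr, mul_one]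
  rw [hx]
  refine ⟨?_, ?_, ?_, odd_exact _ n h u hu⟩
  · rw [← pow_two, ← pow_mul, mul_assoc r b r, mul_assoc r, ← pow_succ', h, mul_one]
    calc (b * r) ^ (2 * n) * b = (b * r) ^ (2 * n) * ((b * r) * r) := by rw [← hb]
      _ = r := by rw [← mul_assoc, ← pow_succ, h, one_mul]
  · rw [← pow_two, ← pow_mul, mul_comm, pow_mul, h, one_pow]
  · rw [← pow_two, ← pow_mul, ← hw, Matrix.vecMul_vecMul, ← pow_succ', h, Matrix.vecMul_one]

end OddSide


open Equiv
set_option linter.all false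

section SeedOEE

theorem prim_odd_facts {l κ : ℂ} {N : ℕ} (hN : 5 ≤ N) (ho : Odd N) (hl : IsPrimitiveRoot l N) (hk : l * κ = 1) :
    κ ≠ l ∧ l ^ 2 ≠ 1 ∧ κ ≠ -1 ∧ l ^ 4 ≠ 1 := by
  have h2 : l ^ 2 ≠ 1 := hl.pow_ne_one_of_pos_of_lt (by omega) (by omega)
  have h4 : l ^ 4 ≠ 1 := hl.pow_ne_one_of_pos_of_lt (by omega) (by omega)
  refine ⟨?_, h2, ?_, h4⟩
  · rintro rfl; apply h2; linear_combination hk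
  · rintro rfl; apply h2; linear_combination (1 - l) * hk

theorem zeta_ne_two {ω : ℂ} {N : ℕ} (hN : 2 ≤ N) (h : IsPrimitiveRoot ω N) : ω + ω⁻¹ ≠ 2 := by
  intro h1
  have h0 := h.ne_zero (by omega)
  have h2 : (ω - 1) ^ 2 = 0 := by
    have : ω * (ω + ω⁻¹) = ω * 2 := by rw [h1]
    rw [mul_add, mul_inv_cancel₀ h0] at this
    linear_combination this
  have h3 : ω = 1 := by
    have := pow_eq_zero_iff (two_ne_zero) |>.mp h2
    exact sub_eq_zero.mp this
  have h4 := h.pow_ne_one_of_pos_of_lt one_ne_zero (by omega)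
  simp at h4; exact h4 h3

theorem bad_y {l κ y1 y4 K : ℂ} (hk : κ ≠ l) (hK : K = y1 * y4 - 1) (h2 : y1 + y4 ≠ 2) (c d : ℂ) :
    ∃ μ0, ∀ μ ν : ℂ, μ * ν = K → l*y1+κ*ν-1-l+c+d*(y1+ν) = 0 → l*μ+κ*y4-1-κ+c+d*(μ+y4) = 0 → μ = μ0 := by
  by_cases hd : l + d = 0
  · have hd' : d = -l := by linear_combination hd
    subst hd'
    have hkl : κ - l ≠ 0 := sub_ne_zero.mpr hk
    refine ⟨K / ((1 + l - c)/(κ - l)), fun μ ν h e1 e2 => ?_⟩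
    have hν : ν = (1 + l - c)/(κ - l) := by rw [eq_div_iff hkl]; linear_combination e1
    rw [← hν]
    by_cases h0 : ν = 0
    · exfalso
      rw [h0] at h e1
      have hc : c = 1 + l := by linear_combination e1
      have : (κ - l) * (y4 - 1) = 0 := by rw [hc] at e2; linear_combination e2
      rcases mul_eq_zero.mp this with h5 | h5
      · exact hkl h5
      · apply h2
        have : y4 = 1 := by linear_combination h5
        rw [this] at hK ⊢; linear_combination -h - hK
    · rw [eq_div_iff h0, h]
  · refine ⟨-(κ*y4-1-κ+c+d*y4)/(l+d), fun μ ν h e1 e2 => ?_⟩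
    rw [eq_div_iff hd]; linear_combination e2

theorem bad_z {l κ y1 y4 K : ℂ} (hlk : l * κ = 1) (hl : l ^ 2 ≠ 1) (hK : K = y1 * y4 - 1) 
    (h2 : y4*κ^2 + y1*l^2 ≠ 2) (t d : ℂ) :
    ∃ μ0, ∀ μ ν : ℂ, μ * ν = K → -y4*κ^2-μ+1+t*(κ*y4+κ*μ)-d*l = 0 → 
      -ν-y1*l^2+1+t*(l*ν+l*y1)-d*κ=0 → μ = μ0 := by
  have hl0 : l ≠ 0 := by rintro rfl; simp at hlk
  by_cases hd : t * κ - 1 = 0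
  · have hd' : t = l := by linear_combination l * hd - t * hlk
    subst hd'
    have hkl : t^2 - 1 ≠ 0 := sub_ne_zero.mpr hl
    refine ⟨K / ((d*κ-1)/(t^2-1)), fun μ ν h e1 e2 => ?_⟩
    have hν : ν = (d*κ-1)/(t^2-1) := by rw [eq_div_iff hkl]; linear_combination e2
    rw [← hν]
    by_cases h0 : ν = 0
    · exfalso
      rw [h0] at h e2
      have hc : d = t := by linear_combination -t * e2 - d * hlk
      have : (t^2 - 1) * (y4 - t^2) = 0 := by
        rw [hc] at e1
        linear_combination t^2 * e1 + (y4*t*κ + y4 + t^2 * μ- t^2*y4-t^2*μ) * hlk - μ * t^2 * hlk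
      rcases mul_eq_zero.mp this with h5 | h5
      · exact hkl h5
      · apply h2
        have h6 : y4 = t^2 := by linear_combination h5
        rw [h6] at hK ⊢
        linear_combination -h - hK + (t*κ+1)*hlk
    · rw [eq_div_iff h0, h]
  · refine ⟨-(-y4*κ^2+1+t*κ*y4-d*l)/(t*κ-1), fun μ ν h e1 e2 => ?_⟩
    rw [eq_div_iff hd]; linear_combination e1

theorem rf_OEE3 (m n p : ℕ) (hm : 2 ≤ m) (hn : 3 ≤ n) (hp : 3 ≤ p) :
    ResiduallyFinite (Artin3 (len true m) (len false n) (len false p)) := by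
  obtain ⟨l, hl⟩ := exists_prim (2*m+1) (by omega)
  obtain ⟨ω, hω⟩ := exists_prim n (by omega)
  obtain ⟨σ, hσ⟩ := exists_prim p (by omega)
  have hl0 := hl.ne_zero (by omega)
  obtain ⟨κ, hlk⟩ : ∃ κ, l * κ = 1 := ⟨l⁻¹, mul_inv_cancel₀ hl0⟩
  have hκ : l⁻¹ = κ := inv_eq_of_mul_eq_one_right hlk
  obtain ⟨f1, f2, f3, f4⟩ := prim_odd_facts (by omega) ⟨m, rfl⟩ hl hlk
  obtain ⟨y1, y4, hy, hz⟩ : ∃ y1 y4 : ℂ, y1 + y4 = ω + ω⁻¹ ∧ y4*κ^2 + y1*l^2 = σ + σ⁻¹ := by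
    have hd : l^2 - κ^2 ≠ 0 := by
      intro h; apply f4
      linear_combination l^2 * h + (l*κ+1) * hlk
    refine ⟨(σ+σ⁻¹-κ^2*(ω+ω⁻¹))/(l^2-κ^2), ω+ω⁻¹ - (σ+σ⁻¹-κ^2*(ω+ω⁻¹))/(l^2-κ^2), by ring, ?_⟩
    have := div_mul_cancel₀ (σ+σ⁻¹-κ^2*(ω+ω⁻¹)) hd
    linear_combination this
  have ty := zeta_ne_two (by omega) hω
  have tz := zeta_ne_two (by omega) hσ
  obtain ⟨K, hK⟩ : ∃ K, K = y1 * y4 - 1 := ⟨_, rfl⟩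
  choose cy dy _ hdy using fun k => aff2_disj (ω + ω⁻¹) k
  choose cz dz _ hdz using fun k => aff2_disj (σ + σ⁻¹) k
  choose μy hμy using fun k => bad_y f1 hK (hy ▸ ty) (cy k) (dy k)
  choose μz hμz using fun k => bad_z hlk f2 hK (hz ▸ tz) (cz k + dz k * (σ + σ⁻¹) - 1) (dz k)
  obtain ⟨μ, hμ⟩ := Infinite.exists_notMem_finset ((Finset.range n).image μy ∪ (Finset.range p).image μz ∪
    {0, κ*(1+κ-κ*y4), (1-κ*y4-y4*κ^2)/(1+κ)})
  simp only [Finset.mem_union, not_or, Finset.mem_insert, Finset.mem_singleton, Finset.mem_image, Finset.mem_range,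
    not_exists, not_and] at hμ
  obtain ⟨⟨m1, m2⟩, m3, m4, m5⟩ := hμ
  obtain ⟨ν, hν⟩ : ∃ ν, μ * ν = K := ⟨K / μ, mul_div_cancel₀ _ m3⟩
  obtain ⟨s, hs⟩ : ∃ s : Matrix (Fin 3) (Fin 3) ℂ, s = !![0,1,0;1,0,0;0,0,1] := ⟨_, rfl⟩
  obtain ⟨b, hb⟩ : ∃ b : Matrix (Fin 3) (Fin 3) ℂ, b = !![0,κ,0;l,0,0;l,κ,1] := ⟨_, rfl⟩
  obtain ⟨bi, hbi⟩ : ∃ b : Matrix (Fin 3) (Fin 3) ℂ, b = !![0,κ,0;l,0,0;-1,-1,1] := ⟨_, rfl⟩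
  obtain ⟨y, hy'⟩ : ∃ y : Matrix (Fin 3) (Fin 3) ℂ, y = !![y1,μ,0;ν,y4,0;-1,-1,1] := ⟨_, rfl⟩
  have hbb : b * bi = 1 := by
    rw [hb, hbi, aff2_mul]
    ext i j; fin_cases i <;> fin_cases j <;> simp [hlk, mul_comm κ l]
  have hbc : b * (bi * y) = y := by rw [← mul_assoc, hbb, one_mul]
  have hss : s * s = 1 := by
    rw [hs, aff2_mul]
    ext i j; fin_cases i <;> fin_cases j <;> simp
  have hξ : s * b = !![l,0,0;0,κ,0;l,κ,1] := by
    rw [hb, hs, aff2_mul]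
    ext i j; fin_cases i <;> fin_cases j <;> simp
  have hz' : (bi * y) * (s*b*s) = !![y4*κ^2, ν, 0; μ, y1*l^2, 0; -(l*y4*κ^2+κ*μ), -(l*ν+κ*y1*l^2),1] := by
    rw [hξ, hs, hbi, hy', aff2_mul, aff2_mul, aff2_mul]
    ext i j; fin_cases i <;> fin_cases j <;> simp
    · ring
    · linear_combination ν * hlk
    · linear_combination μ * hlk
    · ring
    · linear_combination (y4*κ - 1) * hlk + hlk
    · linear_combination (y1*l - 1) * hlk + hlk
  have hdet : y4*κ^2 * (y1*l^2) - ν * μ = 1 := by linear_combination y1*y4*(l*κ+1)*hlk - hK - hν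
  have X := aff2_ord l 0 0 κ l κ (2*m+1) (by omega) l hl (by rw [hκ]) (by simpa using hlk) (s*b) hξ
  have Y := aff2_ord _ _ _ _ _ _ n hn ω hω hy (by linear_combination -hK - hν) y hy'
  have Z := aff2_ord _ _ _ _ _ _ p hp σ hσ hz hdet _ hz'
  have XX := odd_x s b m hss X.1 ![0,0,1] ![-1,-1,1] (by
    rw [hξ, aff2_vec]; ext i; fin_cases i <;> simp) (X.2 0 0 (by simp [hl0]))
  refine rf_of_matrix_seed true false m n p hm (by omega) (by omega) (ι := Fin 3)
    (s*b*s) b (bi*y) ![0,0,1] ![l,κ,1] ![-1,-1,1]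
    { hb := ?_, hc := ?_, ha := ?_, z1 := Z.1, zu := Z.2 0 0 ?_, zw := Z.2 (-1) (-1) ?_, 
      zuw := fun k hk h => ?_
      xo := fun _ => XX
      xe := fun h => by simp at h
      yo := fun h => by simp at h
      ye := fun _ => by
        rw [hbc]
        refine ⟨Y.1, Y.2 0 0 ?_, Y.2 l κ ?_, fun k hk h => ?_⟩
        · simp
        · rintro ⟨h1, h2⟩
          apply m4; linear_combination κ * h2 - μ * hlk
        · obtain ⟨e1, e2⟩ := hdy k _ _ _ _ _ _ hy (by linear_combination -hK - hν) y hy' 0 0 l κ h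
          refine m1 k hk (hμy k μ ν hν ?_ ?_).symm
          · linear_combination e1
          · linear_combination e2 }
  · rw [hb, aff2_vec]; ext i; fin_cases i <;> simp
  · rw [hbi, hy', aff2_mul, aff2_vec]; ext i; fin_cases i <;> simp
    · linear_combination (y1 + ν) * hlk
    · linear_combination (μ + y4) * hlk
  · rw [hξ, hs, aff2_mul, aff2_vec]; ext i; fin_cases i <;> simp
  · rintro ⟨h1, h2⟩
    apply hl0
    linear_combination -l * hdet - (y1*l^2) * h1 + μ * h2
  · rintro ⟨h1, h2⟩
    have : 1 + κ ≠ 0 := by intro h; apply f3; linear_combination h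
    apply m5; rw [eq_div_iff this]; linear_combination -h1 - y4*κ*hlk
  · obtain ⟨e1, e2⟩ := hdz k _ _ _ _ _ _ hz hdet _ hz' 0 0 (-1) (-1) h
    refine m2 k hk (hμz k μ ν hν ?_ ?_).symm
    · linear_combination e1 - (cz k + dz k * (σ + σ⁻¹) - 1) * κ * y4 * hlk - dz k * (l*y4*κ^2+κ*μ) * hz + dz k * l * hdet
    · linear_combination e2 - (cz k + dz k * (σ + σ⁻¹) - 1) * y1 * l * hlk - dz k * (l*ν+κ*y1*l^2) * hz + dz k * κ * hdet

end SeedOEE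


open Equiv
set_option linter.all false

section SeedOE4

theorem choose_l (m n : ℕ) (hm : 2 ≤ m) (hn : 3 ≤ n) (ω : ℂ) (hω : IsPrimitiveRoot ω n) :
    ∃ l κ : ℂ, IsPrimitiveRoot l (2*m+1) ∧ l * κ = 1 ∧ ω + ω⁻¹ + l^2 + κ^2 ≠ 0 := by
  obtain ⟨l, hl⟩ := exists_prim (2*m+1) (by omega)
  have hl0 := hl.ne_zero (by omega)
  obtain ⟨κ, hlk⟩ : ∃ κ, l * κ = 1 := ⟨l⁻¹, mul_inv_cancel₀ hl0⟩
  by_cases h1 : ω + ω⁻¹ + l^2 + κ^2 = 0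
  · refine ⟨l^2, κ^2, hl.pow_of_coprime 2 (by simp), by rw [← mul_pow, hlk, one_pow], fun h2 => ?_⟩
    have h3 : (l^2 - 1) * (l^6 - 1) = 0 := by
      linear_combination l^4 * h2 - l^4 * h1 - (l^3*κ^3+l^2*κ^2+l*κ+1) * hlk + l^2*(l*κ+1)*hlk
    rcases mul_eq_zero.mp h3 with h | h
    · exact hl.pow_ne_one_of_pos_of_lt (l := 2) (by omega) (by omega) (by linear_combination h)
    · have h6 : l ^ 6 = 1 := by linear_combination h
      have := hl.dvd_of_pow_eq_one 6 h6
      have h7 := Nat.le_of_dvd (by norm_num) this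
      have : m = 2 := by omega
      subst this
      omega
  · exact ⟨l, κ, hl, hlk, h1⟩

theorem rf_OE4 (m n : ℕ) (hm : 2 ≤ m) (hn : 3 ≤ n) :
    ResiduallyFinite (Artin3 (len true m) (len false n) (len false 2)) := by
  obtain ⟨ω, hω⟩ := exists_prim n (by omega)
  obtain ⟨l, κ, hl, hlk, hne⟩ := choose_l m n hm hn ω hω
  have hl0 := hl.ne_zero (by omega)
  have hκ : l⁻¹ = κ := inv_eq_of_mul_eq_one_right hlk
  obtain ⟨f1, f2, f3, f4⟩ := prim_odd_facts (by omega) ⟨m, rfl⟩ hl hlk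
  have hlk' : (l - κ)^2 ≠ 0 := pow_ne_zero _ (sub_ne_zero.mpr f1.symm)
  obtain ⟨G, hG⟩ : ∃ G : ℂ, -2 - G * (l-κ)^2 = ω + ω⁻¹ := 
    ⟨-(ω+ω⁻¹+2)/(l-κ)^2, by rw [div_mul_cancel₀ _ hlk']; ring⟩
  obtain ⟨α, hα⟩ := IsAlgClosed.exists_pow_nat_eq (1 - G) (n := 2) (by norm_num)
  have hα0 : α ≠ 0 := by
    rintro rfl
    apply hne
    linear_combination -hG - (l-κ)^2 * hα + 2 * hlk
  have ty := zeta_ne_two (by omega) hω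
  obtain ⟨y1, hy1⟩ : ∃ y1, y1 = -(α^2 + G*κ^2) := ⟨_, rfl⟩
  obtain ⟨y4, hy4⟩ : ∃ y4, y4 = -(α^2 + G*l^2) := ⟨_, rfl⟩
  have hy : y1 + y4 = ω + ω⁻¹ := by rw [hy1, hy4, ← hG]; linear_combination -2*hα - 2*G*hlk
  obtain ⟨K, hK⟩ : ∃ K, K = y1 * y4 - 1 := ⟨_, rfl⟩
  choose cy dy _ hdy using fun k => aff2_disj (ω + ω⁻¹) k
  choose μy hμy using fun k => bad_y f1 hK (hy ▸ ty) (cy k) (dy k)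
  obtain ⟨μ, hμ⟩ := Infinite.exists_notMem_finset ((Finset.range n).image μy ∪ {0, κ*(1+κ-κ*y4)})
  simp only [Finset.mem_union, not_or, Finset.mem_insert, Finset.mem_singleton, Finset.mem_image, Finset.mem_range,
    not_exists, not_and] at hμ
  obtain ⟨m1, m3, m4⟩ := hμ
  have hq : α * (1 - l^2) ≠ 0 := mul_ne_zero hα0 (sub_ne_zero.mpr f2.symm)
  obtain ⟨β, hβ⟩ : ∃ β, α * β * (1 - l^2) = μ := ⟨μ / (α * (1 - l^2)), by field_simp⟩
  have hβ0 : β ≠ 0 := by rintro rfl; apply m3; rw [← hβ]; ring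
  obtain ⟨γ, hγ⟩ : ∃ γ, β * γ = G := ⟨G / β, mul_div_cancel₀ _ hβ0⟩
  obtain ⟨ν, hν⟩ : ∃ ν, ν = α * γ * (κ^2-1) := ⟨_, rfl⟩
  have hμν : μ * ν = K := by
    rw [hK, hy1, hy4, ← hβ, hν]
    linear_combination (-α^2*(1 + l^2*κ^2-l^2-κ^2)) * hγ - (α^2*G*(l*κ+1)+ G^2*(l*κ+1)+2*α^2*G*0)*hlk - (α^2 + G+1+0*G)*hα 
  obtain ⟨s, hs⟩ : ∃ s : Matrix (Fin 3) (Fin 3) ℂ, s = !![α,β,0;γ,-α,0;0,0,1] := ⟨_, rfl⟩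
  obtain ⟨b, hb⟩ : ∃ b : Matrix (Fin 3) (Fin 3) ℂ, b = !![α*l,β*κ,0;γ*l,-α*κ,0;l,κ,1] := ⟨_, rfl⟩
  obtain ⟨c, hc⟩ : ∃ b : Matrix (Fin 3) (Fin 3) ℂ, b = !![-α*κ,-β*l,0;-γ*κ,α*l,0;l*(α*κ)+κ*(γ*κ)-1,l*(β*l)-κ*(α*l)-1,1] := ⟨_, rfl⟩
  have hs2 : α^2 + β * γ = 1 := by rw [hγ]; linear_combination hα
  have hss : s * s = 1 := by
    rw [hs, aff2_mul]
    ext i j; fin_cases i <;> fin_cases j <;> simp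
    · linear_combination hs2
    · ring
    · ring
    · linear_combination hs2
  have hξ : s * b = !![l,0,0;0,κ,0;l,κ,1] := by
    rw [hb, hs, aff2_mul]
    ext i j; fin_cases i <;> fin_cases j <;> simp
    · linear_combination l * hs2
    · ring
    · ring
    · linear_combination κ * hs2
  have hy' : b * c = !![y1,μ,0;ν,y4,0;-1,-1,1] := by
    rw [hb, hc, aff2_mul, hy1, hy4, hν, ← hβ]
    ext i j; fin_cases i <;> fin_cases j <;> simp
    · linear_combination -α^2 * hlk - κ^2*hγ
    · linear_combination α*β*hlk
    · linear_combination -α*γ*hlk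
    · linear_combination -α^2 * hlk - l^2*hγ
    · ring
    · ring
  have hz' : c * (s*b*s) = !![-1, 0, 0; 0, -1, 0; l, κ,1] := by
    rw [hξ, hs, hc, aff2_mul, aff2_mul]
    ext i j; fin_cases i <;> fin_cases j <;> simp
    · linear_combination -hs2 - (α^2+β*γ)*hlk
    · ring
    · ring
    · linear_combination -hs2 - (α^2+β*γ)*hlk
    · linear_combination l*hs2 + (l*α^2+κ*γ*α+γ*β*l-κ*α*γ)*hlk
    · linear_combination κ*hs2 + (l*β*α+κ*γ*β+α^2*κ-l*α*β)*hlk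
  have X := aff2_ord l 0 0 κ l κ (2*m+1) (by omega) l hl (by rw [hκ]) (by simpa using hlk) (s*b) hξ
  have Y := aff2_ord _ _ _ _ _ _ n hn ω hω hy (by linear_combination -hK - hμν) _ hy'
  have XX := odd_x s b m hss X.1 ![0,0,1] ![-1,-1,1] (by
    rw [hξ, aff2_vec]; ext i; fin_cases i <;> simp) (X.2 0 0 (by simp [hl0]))
  have hk1 : ∀ k, 0 < k → k < 2 → k = 1 := by intro k h1 h2; omega
  refine rf_of_matrix_seed true false m n 2 hm (by omega) (by omega) (ι := Fin 3)
    (s*b*s) b c ![0,0,1] ![l,κ,1] ![-1,-1,1]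
    { hb := ?_, hc := ?_, ha := ?_, z1 := ?_, zu := fun k k1 k2 h => ?_, zw := fun k k1 k2 h => ?_, 
      zuw := fun k hk h => ?_
      xo := fun _ => XX
      xe := fun h => by simp at h
      yo := fun h => by simp at h
      ye := fun _ => by
        refine ⟨Y.1, Y.2 0 0 ?_, Y.2 l κ ?_, fun k hk h => ?_⟩
        · simp
        · rintro ⟨h1, h2⟩
          apply m4; linear_combination κ * h2 - μ * hlk
        · obtain ⟨e1, e2⟩ := hdy k _ _ _ _ _ _ hy (by linear_combination -hK - hμν) _ hy' 0 0 l κ h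
          refine m1 k hk (hμy k μ ν hμν ?_ ?_).symm
          · linear_combination e1
          · linear_combination e2 }
  · rw [hb, aff2_vec]; ext i; fin_cases i <;> simp
  · rw [hc, aff2_vec]; ext i; fin_cases i <;> simp <;> ring
  · rw [hξ, hs, aff2_mul, aff2_vec]; ext i; fin_cases i <;> simp <;> ring
  · rw [pow_two, hz', aff2_mul]
    ext i j; fin_cases i <;> fin_cases j <;> simp
  · rw [hk1 k k1 k2, pow_one, hz', aff2_vec] at h
    have := congrFun h 0
    simp at this; exact hl0 this
  · rw [hk1 k k1 k2, pow_one, hz', aff2_vec] at h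
    have e1 := congrFun h 0
    have e2 := congrFun h 1
    simp at e1 e2
    have e3 : l = -2 := by linear_combination e1
    have e4 : κ = -2 := by linear_combination e2
    rw [e3, e4] at hlk; norm_num at hlk
  · interval_cases k
    · have := congrFun h 0
      simp at this
    · rw [pow_one, hz', aff2_vec] at h
      have e1 := congrFun h 0
      simp at e1
      apply f2; rw [e1]; norm_num

end SeedOE4


open Equiv
set_option linter.all false

section SeedOOE

theorem exp_prim (N : ℕ) (hN : 1 ≤ N) : ∃ ω : ℂ, IsPrimitiveRoot ω N ∧ ∀ j : ℕ,
    ω ^ j + (ω ^ j)⁻¹ = ((2 * Real.cos (2 * Real.pi * j / N) : ℝ) : ℂ) := by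
  refine ⟨_, Complex.isPrimitiveRoot_exp N (by omega), fun j => ?_⟩
  rw [← Complex.exp_nat_mul, ← Complex.exp_neg]
  push_cast
  rw [Complex.cos]
  have : (j : ℂ) * (2 * Real.pi * Complex.I / N) = 2 * Real.pi * j / N * Complex.I := by ring
  rw [this]
  rw [neg_mul]
  ring

theorem cos_two_pi_five : 2 * Real.cos (2 * Real.pi / 5) > 0.61 := by
  have h : Real.cos (2 * Real.pi / 5) = 2 * Real.cos (Real.pi / 5) ^ 2 - 1 := by
    rw [← Real.cos_two_mul]; congr 1; ring
  rw [h, Real.cos_pi_div_five]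
  have h5 : Real.sqrt 5 ^ 2 = 5 := Real.sq_sqrt (by norm_num)
  have h6 : Real.sqrt 5 > 2.23 := by
    apply Real.lt_sqrt_of_sq_lt; norm_num
  nlinarith

theorem cos_bounds (N : ℕ) (hN : 5 ≤ N) : 0.61 < 2 * Real.cos (2 * Real.pi / N) ∧ 2 * Real.cos (2 * Real.pi / N) < 2 := by
  have hN' : (5 : ℝ) ≤ N := by exact_mod_cast hN
  have hpi := Real.pi_pos
  have h1 : 2 * Real.pi / N ≤ 2 * Real.pi / 5 := by
    apply div_le_div_of_nonneg_left <;> linarith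
  have h0 : 0 < 2 * Real.pi / N := by positivity
  have h5 : 2 * Real.pi / 5 ≤ Real.pi := by linarith
  constructor
  · have := Real.cos_le_cos_of_nonneg_of_le_pi h0.le h5 h1
    have := cos_two_pi_five
    linarith
  · have := Real.cos_lt_cos_of_nonneg_of_le_pi (le_refl 0) (h1.trans h5) h0
    rw [Real.cos_zero] at this
    linarith

theorem real_prim (N : ℕ) (hN : 5 ≤ N) : ∃ (ω : ℂ) (A : ℝ), IsPrimitiveRoot ω N ∧ 1.6 < A ∧ A < 3 ∧
    ω + ω⁻¹ = (A : ℂ) - 1 := by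
  obtain ⟨ω, h1, h2⟩ := exp_prim N (by omega)
  have := cos_bounds N hN
  refine ⟨ω, 1 + 2 * Real.cos (2 * Real.pi / N), h1, by linarith, by linarith, ?_⟩
  have h3 := h2 1
  rw [pow_one] at h3
  rw [h3]; push_cast; ring_nf

theorem real_prim3 (p : ℕ) (hp : 2 ≤ p) : ∃ (σ : ℂ) (ζ : ℝ), IsPrimitiveRoot σ p ∧ ζ < 2 ∧ σ + σ⁻¹ = (ζ : ℂ) := by
  obtain ⟨ω, h1, h2⟩ := exp_prim p (by omega)
  have h3 := h2 1
  rw [pow_one] at h3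
  refine ⟨ω, _, h1, ?_, h3⟩
  refine lt_of_le_of_ne ?_ ?_
  · have := Real.cos_le_one (2 * Real.pi * (1:ℕ) / p)
    linarith
  · intro h
    rw [h] at h3
    exact zeta_ne_two hp h1 (by rw [h3]; norm_num)

theorem real_ineq (A B : ℝ) (hA : 1.6 < A) (hA3 : A < 3) (hB : 1.6 < B) (hB3 : B < 3) :
    0 < (A*B)^2+A*B*(A+B)+A*B-(A+B)^2 ∧
    ((A+B)^3-A*B*(A+B)-(A*B)^2)^2 < A*B*((A+B)^3-(A+B)^2+A*B)*((A*B)^2+A*B*(A+B)+A*B-(A+B)^2) := by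
  have hx : 0 < A - 1.6 := by linarith
  have hy : 0 < B - 1.6 := by linarith
  have hx3 : 0 < 3 - A := by linarith
  have hy3 : 0 < 3 - B := by linarith
  have hAB : 2.56 < A * B := by nlinarith
  have p1 : 0 < (A*B)^2+A*B*(A+B)+A*B-(A+B)^2 := by
    nlinarith [mul_pos hx hy, mul_pos hx hx3, mul_pos hy hy3, mul_pos hx hy3, mul_pos hy hx3]
  have p2 : (A+B)^3+3*(A+B)^2 < 4*(A*B)^2+4*(A*B)*(A+B)+3*(A*B) := by
    nlinarith [mul_pos hx hy, mul_pos hx hx3, mul_pos hy hy3, mul_pos hx hy3, mul_pos hy hx3, mul_pos (mul_pos hx hy) hx3, mul_pos (mul_pos hx hy) hy3, mul_pos (mul_pos hx hx3) hy3, mul_pos (mul_pos hy hy3) hx3]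
  have p3 : 0 ≤ (A+B)^3-A*B*(A+B)-(A*B)^2 := by
    nlinarith [mul_pos hx hy, mul_pos hx hx3, mul_pos hy hy3, mul_pos hx hy3, mul_pos hy hx3, sq_nonneg (A-B), mul_pos (mul_pos hx hy) hx3]
  refine ⟨p1, ?_⟩
  obtain ⟨e, he⟩ : ∃ e, e = (A*B)^2+A*B*(A+B)+A*B-(A+B)^2 := ⟨_, rfl⟩
  obtain ⟨δ, hδ⟩ : ∃ δ, δ = (A+B)^3-A*B*(A+B)-(A*B)^2 := ⟨_, rfl⟩
  have h1 : (A+B)^3-(A+B)^2+A*B = e + δ := by rw [he, hδ]; ring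
  rw [h1, ← he, ← hδ]
  rw [← he] at p1
  rw [← hδ] at p3
  have p4 : δ < 3 * e := by rw [he, hδ]; linarith
  have : δ^2 ≤ 3 * e * δ := by nlinarith
  nlinarith [mul_pos p1 p1, mul_nonneg p1.le p3, mul_pos p1 (sub_pos.mpr p4)]

end SeedOOE


open Equiv
set_option linter.all false

section SeedOOE2

theorem exists_quad_root (a b c : ℂ) (h : a ≠ 0 ∨ b ≠ 0) : ∃ q : ℂ, c + b * q + a * q^2 = 0 := by
  by_cases ha : a = 0
  · have hb : b ≠ 0 := by simpa [ha] using h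
    exact ⟨-c/b, by rw [ha]; field_simp; ring⟩
  · obtain ⟨s, hs⟩ := IsAlgClosed.exists_pow_nat_eq (b^2 - 4*a*c) (n := 2) (by norm_num)
    refine ⟨(-b+s)/(2*a), ?_⟩
    field_simp
    linear_combination hs

theorem ooe_params (A B ζ : ℝ) (hA : 1.6 < A) (hA3 : A < 3) (hB : 1.6 < B) (hB3 : B < 3) :
    ∃ α q : ℂ, α ≠ 0 ∧ α^2 + A*B*α*q - A*B*q^2 = 1 ∧
      2*(A+B) - 1 - ζ + q * (((A+B)^2-(A+B)^3-A*B)*(α-q) + ((A+B)^2-A*B-A*B*(A+B)-(A*B)^2)*q) = 0 := by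
  obtain ⟨i1, i2⟩ := real_ineq A B hA hA3 hB hB3
  obtain ⟨P, hP⟩ : ∃ P : ℂ, P = A*B := ⟨_, rfl⟩
  obtain ⟨E1, hE1⟩ : ∃ E : ℂ, E = (A+B)^2-(A+B)^3-A*B := ⟨_, rfl⟩
  obtain ⟨E2, hE2⟩ : ∃ E : ℂ, E = (A+B)^2-A*B-A*B*(A+B)-(A*B)^2 := ⟨_, rfl⟩
  have j1 : E2 ≠ 0 := by
    intro h
    have : (((A*B)^2+A*B*(A+B)+A*B-(A+B)^2 : ℝ) : ℂ) = 0 := by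
      push_cast; rw [hE2] at h; linear_combination -h
    rw [Complex.ofReal_eq_zero] at this
    linarith
  have j2 : (E1 - E2)^2 - P * E1 * E2 ≠ 0 := by
    intro h
    have : ((((A+B)^3-A*B*(A+B)-(A*B)^2)^2 - A*B*((A+B)^3-(A+B)^2+A*B)*((A*B)^2+A*B*(A+B)+A*B-(A+B)^2) : ℝ) : ℂ) = 0 := by
      push_cast; rw [hE2, hE1, hP] at h; linear_combination h
    rw [Complex.ofReal_eq_zero] at this
    linarith
  rw [← hE1, ← hE2, ← hP]
  obtain ⟨c0, hc0⟩ : ∃ c : ℂ, c = 2*(A+B) - 1 - ζ := ⟨_, rfl⟩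
  rw [← hc0]
  obtain ⟨q, hq⟩ := exists_quad_root (E2-E1-P*c0) (P*c0+E1) c0 (by
    by_contra hcon
    simp only [not_or, not_not] at hcon
    apply j1; linear_combination hcon.1 + hcon.2)
  have hq0 : 1 + P * q - P * q^2 ≠ 0 := by
    intro h
    have h1 : q * (E1 + (E2 - E1) * q) = 0 := by linear_combination hq - c0 * h
    rcases mul_eq_zero.mp h1 with h2 | h2
    · rw [h2] at h; norm_num at h
    · apply j2
      linear_combination (E1-E2)^2 * h + (-P*E1 + P * (E1 - E2) * (1 - q)) * h2
  obtain ⟨ρ, hρ⟩ := IsAlgClosed.exists_pow_nat_eq (1 + P * q - P * q^2) (n := 2) (by norm_num)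
  have hρ0 : ρ ≠ 0 := by rintro rfl; apply hq0; rw [← hρ]; norm_num
  refine ⟨1/ρ, q/ρ, by simpa using hρ0, ?_, ?_⟩
  · field_simp; linear_combination -hρ
  · field_simp; linear_combination hq + c0 * hρ

theorem ooe_private (A B ζ : ℝ) (hA : 1.6 < A) (hB : 1.6 < B) (hζ : ζ < 2) (α q I J : ℂ) (hα : α ≠ 0)
    (hq : α^2 + A*B*α*q - A*B*q^2 = 1)
    (hF : 2*(A+B) - 1 - ζ + q * (((A+B)^2-(A+B)^3-A*B)*(α-q) + ((A+B)^2-A*B-A*B*(A+B)-(A*B)^2)*q) = 0)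
    (hI : I = 1 - (((A+B)^2-A*B)*(α*q) - (A*B)^2*q^2)) 
    (hJ : J = (A+B) - B*((A+B)^2*(α*q) - ((A+B)^2-A*B)*q^2)) :
    ¬ (J = 1 ∧ I = 2 - ζ) ∧ ∀ g d : ℂ, g*g-ζ*g*d+d*d = 1 → d * I = 1 - J → g * I = ζ - J + I - 1 → False := by
  obtain ⟨P, hP⟩ : ∃ P : ℂ, P = A*B := ⟨_, rfl⟩
  obtain ⟨S, hS⟩ : ∃ S : ℂ, S = A+B := ⟨_, rfl⟩
  obtain ⟨X, hX⟩ : ∃ X : ℂ, X = α * q := ⟨_, rfl⟩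
  obtain ⟨Y, hY⟩ : ∃ Y : ℂ, Y = q^2 := ⟨_, rfl⟩
  obtain ⟨k, hk⟩ : ∃ k : ℂ, k = S^2-P := ⟨_, rfl⟩
  obtain ⟨Ω, hΩ⟩ : ∃ x : ℂ, x = S^2*X-k*Y := ⟨_, rfl⟩
  obtain ⟨Ψ, hΨ⟩ : ∃ x : ℂ, x = k*X-P^2*Y := ⟨_, rfl⟩
  have hI' : I = 1 - Ψ := by rw [hI, hΨ, hX, hY, hk, hS, hP]
  have hJ' : J = S - B*Ω := by rw [hJ, hΩ, hX, hY, hk, hS, hP]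
  have hXY : X^2+P*X*Y-P*Y^2-Y=0 := by rw [hX, hY, hP]; linear_combination q^2 * hq
  have hcurve : Ψ^2+P*Ψ*Ω-P*Ω^2-S^2*Ψ+k*Ω = 0 := by
    rw [hΨ, hΩ, hk]; linear_combination ((S^2-P)^2-P^2*S^2)*hXY
  have hz : (ζ:ℂ) + 2 = (S+1)^2-(S^2+S*Ω-Ψ) := by
    rw [hΨ, hΩ, hX, hY, hk, hS, hP]; linear_combination -hF
  have hzz : (ζ:ℂ) ≠ 2 := by
    intro h; have : ζ = 2 := by exact_mod_cast h
    linarith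
  have hJI : J - ζ - I = -(S - A*Ω) := by
    rw [hJ', hI']; rw [hS] at hz ⊢; linear_combination -hz
  have hS1 : S - 1 ≠ 0 := by
    intro h
    have : ((A + B - 1 : ℝ) : ℂ) = 0 := by push_cast; rw [← hS]; exact h
    rw [Complex.ofReal_eq_zero] at this; linarith
  have hP0 : P ≠ 0 := by
    intro h
    have : ((A * B : ℝ) : ℂ) = 0 := by push_cast; rw [← hP]; exact h
    rw [Complex.ofReal_eq_zero] at this; nlinarith
  constructor
  · rintro ⟨h1, h2⟩
    have a1 : B * Ω = S - 1 := by linear_combination -h1 + hJ'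
    have a2 : A * Ω = S - 1 := by linear_combination h1 - h2 - hJI
    have hΩ0 : Ω ≠ 0 := by intro h; rw [h] at a1; apply hS1; rw [← a1]; ring
    have hAB : (A:ℂ) = B := mul_right_cancel₀ hΩ0 (a2.trans a1.symm)
    have hAB' : A = B := by exact_mod_cast hAB
    subst hAB'
    have hΨ' : Ψ = ζ - 1 := by linear_combination -h2 + hI'
    have hfac : ((ζ:ℂ) - 2) * (ζ - (2*A^2+A)) = 0 := by
      have s2 : S = 2*A := by rw [hS]; ring
      have p2 : P = A^2 := by rw [hP]; ring
      rw [hk, s2, p2, hΨ'] at hcurve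
      rw [s2] at a1
      linear_combination hcurve - (A*(ζ-1) - A*Ω -(2*A-1) + 3*A) * a1
    rcases mul_eq_zero.mp hfac with h | h
    · exact hzz (sub_eq_zero.mp h)
    · have : ((ζ - (2*A^2+A) : ℝ) : ℂ) = 0 := by push_cast; exact h
      rw [Complex.ofReal_eq_zero] at this; nlinarith
  · intro g d hn hd hg
    have hstar : J*(J-ζ-I)+1-I = 0 := by
      have : ((ζ:ℂ)-2) * (J*(J-ζ-I)+1-I) = 0 := by
        have e : (g*I)*(g*I)-ζ*(g*I)*(d*I)+(d*I)*(d*I) = I*I := by linear_combination I*I*hn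
        rw [hd, hg] at e
        linear_combination -e
      rcases mul_eq_zero.mp this with h | h
      · exact absurd (sub_eq_zero.mp h) hzz
      · exact h
    have hΨ2 : Ψ = S^2-S^2*Ω+P*Ω^2 := by
      rw [hJI, hJ', hI'] at hstar
      rw [hP]; linear_combination hstar + S * Ω * hS
    have h3 : Ω * ((Ψ - 1) * (P*Ω-k)) = 0 := by
      linear_combination hcurve + (-1)*Ψ*(hΨ2) - Ψ*Ω*hk
    rcases mul_eq_zero.mp h3 with h | h
    · rw [h] at hz hΨ2
      rw [hΨ2, hS] at hz
      have : ((ζ + 2 - (A + B + 1)^2 : ℝ) : ℂ) = 0 := by push_cast; linear_combination hz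
      rw [Complex.ofReal_eq_zero] at this; nlinarith
    rcases mul_eq_zero.mp h with h | h
    · have hI0 : I = 0 := by rw [hI']; linear_combination -h
      rw [hI0] at hd hg
      apply hzz; linear_combination -hg + hd
    · have hΨP : Ψ = P := by linear_combination hΨ2 + Ω * h - h + Ω*hk - hk
      have hX0 : X = 0 := by
        have e1 : (k^2 - P^2*S^2) * X = 0 := by
          linear_combination k * hΨP - k*hΨ  - P * h + P^2 * hΩ
        rcases mul_eq_zero.mp e1 with e | e
        · have : k = P * S := by
            have : (k - P*S)*(k+P*S) = 0 := by linear_combination e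
            rcases mul_eq_zero.mp this with e | e
            · exact sub_eq_zero.mp e
            · exfalso
              have : (((A+B)^2 - A*B + A*B*(A+B) : ℝ) : ℂ) = 0 := by
                push_cast; rw [← hP, ← hS]; rw [hk] at e; exact e
              rw [Complex.ofReal_eq_zero] at this; nlinarith [mul_pos (show 0 < A by linarith) (show 0 < B by linarith), mul_pos (mul_pos (show 0 < A by linarith) (show 0 < B by linarith)) (show 0 < A + B by linarith)]
          have e2 : S * X - P * Y = 1 := by
            apply mul_left_cancel₀ hP0
            rw [this] at hΨ; linear_combination hΨP - hΨ
          have e3 : 1 + P * Y = 0 := by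
            have hrel : P + P * S - S^2 = 0 := by linear_combination hk - this
            linear_combination S^2*hXY - (S*X+1+P*Y+P*S*Y)*e2 - (1+P*Y)*Y*hrel
          have hS0 : S ≠ 0 := by
            intro h
            have : ((A + B : ℝ) : ℂ) = 0 := by push_cast; rw [← hS]; exact h
            rw [Complex.ofReal_eq_zero] at this; linarith
          apply mul_left_cancel₀ hS0
          linear_combination e2 + e3
        · exact e
      rw [hX] at hX0
      rcases mul_eq_zero.mp hX0 with h5 | h5
      · exact hα h5
      · apply hP0
        rw [← hΨP, hΨ, hX, hY, h5]; ring

end SeedOOE2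


open Equiv
set_option linter.all false

section SeedOOE3

theorem rf_OOE3 (m n p : ℕ) (hm : 2 ≤ m) (hn : 2 ≤ n) (hp : 3 ≤ p) :
    ResiduallyFinite (Artin3 (len true m) (len true n) (len false p)) := by
  obtain ⟨ω, A, hω, hA, hA3, hωA⟩ := real_prim (2*m+1) (by omega)
  obtain ⟨τ, B, hτ, hB, hB3, hτB⟩ := real_prim (2*n+1) (by omega)
  obtain ⟨σ, ζ, hσ, hζ, hσζ⟩ := real_prim3 p (by omega)
  obtain ⟨α, q, hα, hq, hF⟩ := ooe_params A B ζ hA hA3 hB hB3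
  obtain ⟨I, hI⟩ : ∃ I : ℂ, I = 1 - (((A+B)^2-A*B)*(α*q) - (A*B)^2*q^2) := ⟨_, rfl⟩
  obtain ⟨J, hJ⟩ : ∃ J : ℂ, J = (A+B) - B*((A+B)^2*(α*q) - ((A+B)^2-A*B)*q^2) := ⟨_, rfl⟩
  obtain ⟨pr1, pr2⟩ := ooe_private A B ζ hA hB hζ α q I J hα hq hF hI hJ
  generalize (A : ℂ) = A at *
  generalize (B : ℂ) = B at *
  obtain ⟨s, hs⟩ : ∃ s : Matrix (Fin 3) (Fin 3) ℂ, s = !![α,B*(α-q),0;A*q,-α,0;0,0,1] := ⟨_, rfl⟩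
  obtain ⟨b, hb⟩ : ∃ s : Matrix (Fin 3) (Fin 3) ℂ, s = !![-(B*(α-q)),α+(A-1)*(B*(α-q)),0;α,A*q-(A-1)*α,0;0,1,1] := ⟨_, rfl⟩
  obtain ⟨r, hr⟩ : ∃ s : Matrix (Fin 3) (Fin 3) ℂ, s = !![-(α+B*q),(A-2)*α-(A+B)*q,0;B*q,α+B*q,0;-(B*q),1-(α+B*q),1] := ⟨_, rfl⟩
  have hss : s * s = 1 := by
    rw [hs, aff2_mul]
    ext i j; fin_cases i <;> fin_cases j <;> simp
    · linear_combination hq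
    · ring
    · ring
    · linear_combination hq
  have hrr : r * r = 1 := by
    rw [hr, aff2_mul]
    ext i j; fin_cases i <;> fin_cases j <;> simp
    · linear_combination hq
    · ring
    · ring
    · linear_combination hq
    · ring
    · linear_combination -hq
  have hξ : s * b = !![0,1,0;-1,A-1,0;0,1,1] := by
    rw [hb, hs, aff2_mul]
    ext i j; fin_cases i <;> fin_cases j <;> simp
    · ring
    · linear_combination hq
    · linear_combination -hq
    · linear_combination (A-1)*hq
  have hη : b * r = !![B,B+1,0;-1,-1,0;0,1,1] := by
    rw [hb, hr, aff2_mul]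
    ext i j; fin_cases i <;> fin_cases j <;> simp
    · linear_combination B*hq
    · linear_combination (B+1)*hq
    · linear_combination -hq
    · linear_combination -hq
  have hz1 : (r*b*r)*(s*b*s) = (r * (b * r)) * ((s * b) * s) := by simp only [mul_assoc]
  obtain ⟨z12, hz12⟩ : ∃ z12, z12 = (-(α + B * q) * B + ((A - 2) * α - (A + B) * q) * -1) * (0 * (B * (α - q)) + 1 * -α) + (-(α + B * q) * (B + 1) + ((A - 2) * α - (A + B) * q) * -1) * (-1 * (B * (α - q)) + (A - 1) * -α) := ⟨_, rfl⟩
  have hz' : (r*b*r)*(s*b*s) = !![ζ-J, z12, 0; I, J, 0; -I, -J, 1] := by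
    rw [hz1, hξ, hη, hr, hs, aff2_mul, aff2_mul, aff2_mul, hz12]
    ext i j; fin_cases i <;> fin_cases j <;> simp
    · rw [hJ]; linear_combination (A+B-1)*hq + hF
    · rw [hI]; linear_combination hq
    · rw [hJ]; linear_combination (A+B)*hq
    · rw [hI]; linear_combination -hq
    · rw [hJ]; linear_combination -(A+B)*hq
  have hdet : (ζ - J) * J - z12 * I = 1 := by
    have h1 := congrArg Matrix.det hz'
    have d1 := congrArg Matrix.det hrr
    have d3 := congrArg Matrix.det hξ
    have e3 : (!![0,1,0;-1,A-1,0;0,1,1] : Matrix (Fin 3) (Fin 3) ℂ).det = 1 := by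
      rw [Matrix.det_fin_three]; simp
    have e1 : (!![ζ-J, z12, 0; I, J, 0; -I, -J, 1] : Matrix (Fin 3) (Fin 3) ℂ).det = (ζ - J) * J - z12 * I := by
      rw [Matrix.det_fin_three]; simp
    rw [e3] at d3
    rw [e1] at h1
    simp only [Matrix.det_mul, Matrix.det_one] at h1 d1 d3
    rw [← h1]
    linear_combination (s.det * b.det)^2 * d1 + (s.det * b.det + 1) * d3
  have X := aff2_ord _ _ _ _ _ _ (2*m+1) (by omega) ω hω (by rw [hωA]; ring) (by ring) (s*b) hξ
  have Y := aff2_ord _ _ _ _ _ _ (2*n+1) (by omega) τ hτ (by rw [hτB]; ring) (by ring) (b*r) hη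
  have Z := aff2_ord _ _ _ _ _ _ p hp σ hσ (by rw [hσζ]; ring) hdet _ hz'
  have XX := odd_x s b m hss X.1 ![0,0,1] ![-1,0,1] (by
    rw [hξ, aff2_vec]; ext i; fin_cases i <;> simp) (X.2 0 0 (by simp))
  have YY := odd_y b r n hrr Y.1 ![0,0,1] ![0,1,1] (by
    rw [hη, aff2_vec]; ext i; fin_cases i <;> simp) (Y.2 0 0 (by simp))
  refine rf_of_matrix_seed true true m n p hm hn (by omega) (ι := Fin 3)
    (s*b*s) b (r*b*r) ![0,0,1] ![0,1,1] ![-1,0,1]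
    { hb := ?_, hc := ?_, ha := ?_, z1 := Z.1, zu := Z.2 0 0 ?_, zw := Z.2 (-1) 0 ?_, 
      zuw := fun k hk h => ?_
      xo := fun _ => XX
      xe := fun h => by simp at h
      yo := fun _ => YY
      ye := fun h => by simp at h }
  · rw [hb, aff2_vec]; ext i; fin_cases i <;> simp
  · rw [mul_assoc, hη, hr, aff2_mul, aff2_vec]; ext i; fin_cases i <;> simp <;> ring
  · rw [hξ, hs, aff2_mul, aff2_vec]; ext i; fin_cases i <;> simp
  · rintro ⟨h1, h2⟩
    have e1 : I = 0 := by linear_combination -h1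
    have e2 : J = 0 := by linear_combination -h2
    rw [e1, e2] at hdet; norm_num at hdet
  · rintro ⟨h1, h2⟩
    have e : J = 1 := by linear_combination hdet + J * h1 - I * h2
    exact pr1 ⟨e, by linear_combination -h1 + e⟩
  · obtain ⟨c, d, hcd, h3⟩ := aff2_disj ζ k
    obtain ⟨e1, e2⟩ := h3 _ _ _ _ _ _ (by ring) hdet _ hz' 0 0 (-1) 0 h
    have g1 : (c + d*ζ) * I = ζ - J + I - 1 := by linear_combination e1
    refine pr2 (c + d*ζ) d (by linear_combination hcd) ?_ g1
    linear_combination -e2 * I + J * g1 + (1-d*I)*hdet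

end SeedOOE3


open Equiv
set_option linter.all false

section SeedOO4
open Polynomial

def aff {κ : Type} [DecidableEq κ] (L : Matrix κ κ ℂ) (c : κ → ℂ) :
    Matrix (κ ⊕ Unit) (κ ⊕ Unit) ℂ :=
  Matrix.fromBlocks L 0 (Matrix.of fun _ k => c k) 1

def affPt {κ : Type} (x : κ → ℂ) : κ ⊕ Unit → ℂ := Sum.elim x (fun _ => 1)

variable {κ : Type} [Fintype κ] [DecidableEq κ]

theorem affPt_inj (x y : κ → ℂ) (h : affPt x = affPt y) : x = y := by
  funext k
  exact congrFun h (Sum.inl k)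

theorem aff_mul (L L' : Matrix κ κ ℂ) (c c' : κ → ℂ) :
    aff L c * aff L' c' = aff (L * L') (Matrix.vecMul c L' + c') := by
  unfold aff
  rw [Matrix.fromBlocks_multiply]
  simp only [Matrix.mul_zero, Matrix.zero_mul, add_zero, Matrix.mul_one, Matrix.one_mul, zero_add]
  congr 1

theorem aff_one : aff (1 : Matrix κ κ ℂ) 0 = 1 := by
  unfold aff
  have : (Matrix.of fun (_ : Unit) (k : κ) => (0 : κ → ℂ) k) = 0 := by ext; rfl
  rw [this]
  exact Matrix.fromBlocks_one

theorem aff_vec (L : Matrix κ κ ℂ) (c x : κ → ℂ) :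
    Matrix.vecMul (affPt x) (aff L c) = affPt (Matrix.vecMul x L + c) := by
  unfold aff affPt
  rw [Matrix.vecMul_fromBlocks]
  ext k
  rcases k with k | k
  · simp [Matrix.vecMul, dotProduct, Sum.elim_comp_inl, Sum.elim_comp_inr]
  · simp [Matrix.vecMul, dotProduct]

theorem aff_ann (L : Matrix κ κ ℂ) (c : κ → ℂ) (F : ℂ[X]) (h : aeval L F = 0) :
    (aff L c - 1) * aeval (aff L c) F = 0 := by
  have key : ∀ G : ℂ[X], ∃ (y : Matrix Unit κ ℂ) (e : Matrix Unit Unit ℂ),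
      aeval (aff L c) G = Matrix.fromBlocks (aeval L G) 0 y e := by
    intro G
    induction G using Polynomial.induction_on' with
    | add p q hp hq =>
      obtain ⟨y, e, h1⟩ := hp
      obtain ⟨y', e', h2⟩ := hq
      exact ⟨y + y', e + e', by rw [map_add, map_add, h1, h2, Matrix.fromBlocks_add, add_zero]⟩
    | monomial n x =>
      have hk : ∀ n : ℕ, ∃ y : Matrix Unit κ ℂ, ∃ e : Matrix Unit Unit ℂ, (aff L c)^n = Matrix.fromBlocks (L^n) 0 y e := by
        intro n
        induction n with
        | zero => exact ⟨0, 1, by simp⟩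
        | succ n ih =>
          obtain ⟨y, e, h⟩ := ih
          rw [pow_succ, h]
          unfold aff
          rw [Matrix.fromBlocks_multiply]
          exact ⟨_, _, by rw [pow_succ]; simp only [Matrix.mul_zero, Matrix.zero_mul, add_zero, zero_add]; rfl⟩
      obtain ⟨y, e, h⟩ := hk n
      refine ⟨x • y, x • e, ?_⟩
      rw [aeval_monomial, aeval_monomial, h, ← Algebra.smul_def, ← Algebra.smul_def,
        Matrix.fromBlocks_smul, smul_zero]
  obtain ⟨y, e, hy⟩ := key F
  rw [hy, h]
  have h1 : aff L c - 1 = Matrix.fromBlocks (L - 1) 0 (Matrix.of fun _ k => c k) 0 := by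
    unfold aff
    ext i j; rcases i with i | i <;> rcases j with j | j <;> simp [Matrix.one_apply]
  rw [h1, Matrix.fromBlocks_multiply]
  simp

theorem four_prim {ω : ℂ} {m : ℕ} (hm : 2 ≤ m) (hω : IsPrimitiveRoot ω (2*m+1)) :
    ω ∉ ({ω⁻¹, ω^2, (ω^2)⁻¹} : Finset ℂ) ∧ ω⁻¹ ∉ ({ω^2, (ω^2)⁻¹} : Finset ℂ) ∧ ω^2 ≠ (ω^2)⁻¹ := by
  have h0 := hω.ne_zero (by omega)
  have n1 : ω ^ 1 ≠ 1 := hω.pow_ne_one_of_pos_of_lt (by omega) (by omega)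
  have n2 : ω ^ 2 ≠ 1 := hω.pow_ne_one_of_pos_of_lt (by omega) (by omega)
  have n3 : ω ^ 3 ≠ 1 := hω.pow_ne_one_of_pos_of_lt (by omega) (by omega)
  have n4 : ω ^ 4 ≠ 1 := hω.pow_ne_one_of_pos_of_lt (by omega) (by omega)
  refine ⟨?_, ?_, ?_⟩
  · simp only [Finset.mem_insert, Finset.mem_singleton, not_or]
    refine ⟨fun h => n2 ?_, fun h => n1 ?_, fun h => n3 ?_⟩
    · field_simp at h; exact h
    · apply mul_left_cancel₀ h0; linear_combination -h
    · field_simp at h; linear_combination h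
  · simp only [Finset.mem_insert, Finset.mem_singleton, not_or]
    refine ⟨fun h => n3 ?_, fun h => n1 ?_⟩
    · field_simp at h; linear_combination -h
    · field_simp at h; linear_combination h
  · intro h; apply n4; field_simp at h; linear_combination h

theorem dihedral_ann (t r : Matrix κ κ ℂ) (ht : t * t = 1) (hr : r * r = 1) (x y : ℂ)
    (h : (t*r+r*t)*(t*r+r*t) - (x+y) • (t*r+r*t) + (x*y) • (1 : Matrix κ κ ℂ) = 0) :
    ((t*r)*(t*r) - x • (t*r) + 1) * ((t*r)*(t*r) - y • (t*r) + 1) = 0 := by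
  obtain ⟨Θ, hΘ⟩ : ∃ Θ, Θ = t*r+r*t := ⟨_, rfl⟩
  obtain ⟨L, hL⟩ : ∃ L, L = t*r := ⟨_, rfl⟩
  have e1 : L * L + 1 = Θ * L := by
    rw [hL, hΘ, add_mul]
    congr 1
    rw [mul_assoc r t, ← mul_assoc t t, ht, one_mul, hr]
  have e2 : L * L + 1 = L * Θ := by
    rw [hL, hΘ, mul_add]
    congr 1
    rw [mul_assoc t r, ← mul_assoc r r, hr, one_mul, ht]
  rw [← hΘ] at h
  rw [← hL]
  have f : ∀ x : ℂ, L * L - x • L + 1 = (Θ - x • 1) * L := by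
    intro x
    rw [sub_mul, ← e1, smul_mul_assoc, one_mul]; abel
  have f2 : ∀ x : ℂ, L * (Θ - x • 1) = (Θ - x • 1) * L := by
    intro x
    rw [sub_mul, mul_sub, ← e1, ← e2, smul_mul_assoc, one_mul, mul_smul_comm, mul_one]
  have f3 : (Θ - x • 1) * (Θ - y • 1) = 0 := by
    rw [← h]
    simp only [sub_mul, mul_sub, smul_mul_assoc, mul_smul_comm, one_mul, mul_one, smul_sub, smul_smul, add_smul]
    rw [mul_comm y x]
    abel
  rw [f, f, mul_assoc, ← mul_assoc L, f2, ← mul_assoc, ← mul_assoc, f3, zero_mul, zero_mul]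

theorem aff_ord (t r : Matrix κ κ ℂ) (ht : t * t = 1) (hr : r * r = 1) (c : κ → ℂ) (m : ℕ) (hm : 2 ≤ m)
    (ω : ℂ) (hω : IsPrimitiveRoot ω (2*m+1))
    (h : (t*r+r*t)*(t*r+r*t) - ((ω+ω⁻¹)+(ω^2+(ω^2)⁻¹)) • (t*r+r*t) + ((ω+ω⁻¹)*(ω^2+(ω^2)⁻¹)) • (1 : Matrix κ κ ℂ) = 0) :
    (aff (t*r) c)^(2*m+1) = 1 ∧ ∀ P, Matrix.vecMul P (aff (t*r) c) ≠ P → ∀ k, 0 < k → k < 2*m+1 → 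
      Matrix.vecMul P ((aff (t*r) c)^k) ≠ P := by
  have h0 := hω.ne_zero (by omega)
  have hω2 : IsPrimitiveRoot (ω^2) (2*m+1) := hω.pow_of_coprime 2 (by simp)
  obtain ⟨g1, g2, g3⟩ := four_prim hm hω
  apply ord_of_ann _ (2*m+1) (by omega) {ω, ω⁻¹, ω^2, (ω^2)⁻¹}
  · intro r hr
    simp only [Finset.mem_insert, Finset.mem_singleton] at hr
    rcases hr with rfl | rfl | rfl | rfl
    · exact hω
    · exact hω.inv
    · exact hω2
    · exact hω2.inv
  · apply aff_ann
    rw [← dihedral_ann t r ht hr _ _ h]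
    rw [Finset.prod_insert g1, Finset.prod_insert g2, Finset.prod_pair g3]
    have e : ∀ z : ℂ, z ≠ 0 → (t*r)*(t*r) - (z+z⁻¹) • (t*r) + 1 = aeval (t*r) ((X - C z) * (X - C z⁻¹)) := by
      intro z hz
      simp only [map_mul, map_sub, aeval_X, aeval_C, Algebra.algebraMap_eq_smul_one, sub_mul, mul_sub,
        smul_mul_assoc, mul_smul_comm, one_mul, mul_one, smul_smul, add_smul, mul_inv_cancel₀ hz, one_smul]
      rw [inv_mul_cancel₀ hz, one_smul]
      abel
    rw [e ω h0, e (ω^2) (pow_ne_zero _ h0), ← map_mul]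
    congr 1
    ring

theorem cubic_root (S e k : ℂ) (hS : S ≠ 0) : ∃ D : ℂ, D ≠ 0 ∧ 4*D^3-4*S*D^2+e*D+k = 0 := by
  by_cases hk : k = 0
  · by_cases he : e = 0
    · exact ⟨S, hS, by rw [hk, he]; ring⟩
    · obtain ⟨q, hq⟩ := exists_quad_root 4 (-4*S) e (by norm_num)
      refine ⟨q, ?_, by rw [hk]; linear_combination q * hq⟩
      rintro rfl
      apply he; linear_combination hq
  · have hd : (C (4:ℂ) * X^3 + C (-4*S) * X^2 + C e * X + C k).degree = 3 :=
      Polynomial.degree_cubic (by norm_num)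
    obtain ⟨D, hD⟩ := IsAlgClosed.exists_root (C (4:ℂ) * X^3 + C (-4*S) * X^2 + C e * X + C k) (by rw [hd]; decide)
    simp [IsRoot] at hD
    refine ⟨D, ?_, by linear_combination hD⟩
    rintro rfl
    apply hk; linear_combination hD

theorem oo4_params (Ea Eb w τ : ℂ) (h1 : Ea ≠ 0) (h2 : Eb ≠ 0) (h3 : τ + Ea + Eb ≠ 0) :
    ∃ a b P Q D : ℂ, D ≠ 0 ∧ a * P = Ea ∧ b * Q = Eb ∧ D * P = a - 1 - w ∧ D * Q = b + 1 - w ∧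
      2 * D = τ + (Q - P) * (b - a) := by
  obtain ⟨S, hS⟩ : ∃ S, S = τ + Ea + Eb := ⟨_, rfl⟩
  rw [← hS] at h3
  obtain ⟨D, hD, hc⟩ := cubic_root S (S^2 - 2*(w^2-1) - 4*Ea*Eb) ((w^2-1)*S - Ea*(1-w)^2 - Eb*(1+w)^2) h3
  obtain ⟨α, β, hα, hβ, hαβ⟩ : ∃ α β : ℂ, α^2 = (1+w)^2+4*Ea*D ∧ β^2=(1-w)^2+4*Eb*D ∧
      α*β = w^2-1+2*S*D-4*D^2 := by
    obtain ⟨α, hα⟩ := IsAlgClosed.exists_pow_nat_eq ((1+w)^2+4*Ea*D) (n := 2) (by norm_num)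
    have key : ((1+w)^2+4*Ea*D) * ((1-w)^2+4*Eb*D) = (w^2-1+2*S*D-4*D^2)^2 := by
      linear_combination -4*D*hc
    by_cases hα0 : α = 0
    · obtain ⟨β, hβ⟩ := IsAlgClosed.exists_pow_nat_eq ((1-w)^2+4*Eb*D) (n := 2) (by norm_num)
      refine ⟨α, β, hα, hβ, ?_⟩
      rw [← hα, hα0] at key
      have : (w^2-1+2*S*D-4*D^2)^2 = 0 := by rw [← key]; ring
      rw [pow_eq_zero_iff (by norm_num)] at this
      rw [this, hα0]; ring
    · refine ⟨α, (w^2-1+2*S*D-4*D^2)/α, hα, ?_, by field_simp⟩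
      rw [div_pow, ← key, ← hα]
      field_simp
  have hi : D * D⁻¹ = 1 := mul_inv_cancel₀ hD
  obtain ⟨a, ha⟩ : ∃ a, a = (α+1+w)/2 := ⟨_, rfl⟩
  obtain ⟨b, hb⟩ : ∃ b, b = (β-1+w)/2 := ⟨_, rfl⟩
  have ea : a*(a-1-w) = Ea*D := by rw [ha]; linear_combination hα/4
  have eb : b*(b+1-w) = Eb*D := by rw [hb]; linear_combination hβ/4
  have eab : 2*D^2 - S*D + 2*a*b+a-b-w*(a+b) = 0 := by rw [ha, hb]; linear_combination hαβ/2
  obtain ⟨P, hP⟩ : ∃ P, D * P = a-1-w := ⟨(a-1-w)/D, by field_simp⟩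
  obtain ⟨Q, hQ⟩ : ∃ Q, D * Q = b+1-w := ⟨(b+1-w)/D, by field_simp⟩
  refine ⟨a, b, P, Q, D, hD, ?_, ?_, hP, hQ, ?_⟩
  · apply mul_left_cancel₀ hD; linear_combination a * hP + ea
  · apply mul_left_cancel₀ hD; linear_combination b * hQ + eb
  · apply mul_left_cancel₀ hD
    linear_combination eab - (b-a)*(hQ - hP) - ea - eb + D * hS

end SeedOO4


open Equiv
set_option linter.all false

section SeedOO4b

theorem oo4_real (m : ℕ) (hm : 2 ≤ m) : ∃ (ω : ℂ) (x : ℝ), IsPrimitiveRoot ω (2*m+1) ∧ 0.61 < x ∧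
    ω + ω⁻¹ = x ∧ ω^2 + (ω^2)⁻¹ = x^2 - 2 := by
  obtain ⟨ω, h1, h2⟩ := exp_prim (2*m+1) (by omega)
  have := cos_bounds (2*m+1) (by omega)
  have h0 := h1.ne_zero (by omega)
  have h3 := h2 1
  rw [pow_one] at h3
  refine ⟨ω, 2 * Real.cos (2 * Real.pi * (1:ℕ) / (2*m+1 : ℕ)), h1, ?_, h3, ?_⟩
  · rw [Nat.cast_one, mul_one]; exact this.1
  · rw [← h3]; field_simp; ring

/-- The matrix `t`. -/
noncomputable def oo4T (a b P Q D C k : ℂ) : Matrix (Fin 4) (Fin 4) ℂ :=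
  !![(a-2)/2, (C-D-1)/2, (C+D-1)/2, -D*P/2;
     (-a-a*(Q-P))/2, (-C+D-(k-(b-a+1)))/2, (-C-D-(k+(b-a+1)))/2, (D*P-P*(a-b))/2;
     (-a+a*(Q-P))/2, (-C+D+(k-(b-a+1)))/2, (-C-D+(k+(b-a+1)))/2, (D*P+P*(a-b))/2;
     -a/2, (-C+D-1)/2, (-C-D-1)/2, (2+D*P)/2]

def oo4R : Matrix (Fin 4) (Fin 4) ℂ := !![1,0,0,0;0,1,0,0;0,0,-1,0;0,0,0,-1]
def oo4S : Matrix (Fin 4) (Fin 4) ℂ := !![0,0,1,0;0,0,0,1;1,0,0,0;0,1,0,0]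

theorem oo4_RR : oo4R * oo4R = 1 := by
  unfold oo4R
  ext i j; fin_cases i <;> fin_cases j <;> simp [Matrix.mul_apply, Fin.sum_univ_four]

theorem oo4_SS : oo4S * oo4S = 1 := by
  unfold oo4S
  ext i j; fin_cases i <;> fin_cases j <;> simp [Matrix.mul_apply, Fin.sum_univ_four]

theorem oo4_RS : oo4R * oo4S * oo4R * oo4S = -1 := by
  unfold oo4S oo4R
  ext i j; fin_cases i <;> fin_cases j <;> simp [Matrix.mul_apply, Fin.sum_univ_four]

variable (a b P Q D C k : ℂ)

theorem oo4_TT (hb : b = D*Q-D*P+a-2) (hC : C = (b+D*Q)/2) (hk : k = (Q*(b-a)+b*(Q-P))/2) :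
    oo4T a b P Q D C k * oo4T a b P Q D C k = 1 := by
  subst hk hC hb
  unfold oo4T
  ext i j; fin_cases i <;> fin_cases j <;> simp [Matrix.mul_apply, Fin.sum_univ_four] <;> ring

theorem oo4_TR (hb : b = D*Q-D*P+a-2) (hC : C = (b+D*Q)/2) (hk : k = (Q*(b-a)+b*(Q-P))/2) (T δ : ℂ)
    (hT : T = (2*D-3-(Q-P)*(b-a)+(a-1-D*P)-b*Q+a*P)/2) (hδ : δ = a*P-2*T-4) :
    (oo4T a b P Q D C k * oo4R + oo4R * oo4T a b P Q D C k) * (oo4T a b P Q D C k * oo4R + oo4R * oo4T a b P Q D C k)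
      - T • (oo4T a b P Q D C k * oo4R + oo4R * oo4T a b P Q D C k) + δ • (1 : Matrix (Fin 4) (Fin 4) ℂ) = 0 := by
  have e : oo4T a b P Q D C k * oo4R + oo4R * oo4T a b P Q D C k =
    !![a-2, C-D-1, 0, 0; -a-a*(Q-P), -C+D-(k-(b-a+1)), 0, 0;
      0, 0, -(-C-D+(k+(b-a+1))), -(D*P+P*(a-b)); 0, 0, C+D+1, -(2+D*P)] := by
    unfold oo4T oo4R
    ext i j; fin_cases i <;> fin_cases j <;> simp [Matrix.mul_apply, Fin.sum_univ_four] <;> ring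
  rw [e]
  subst hδ hT hk hC hb
  ext i j; fin_cases i <;> fin_cases j <;> simp [Matrix.mul_apply, Fin.sum_univ_four] <;> ring

set_option maxHeartbeats 2000000 in
theorem oo4_ST (hb : b = D*Q-D*P+a-2) (hC : C = (b+D*Q)/2) (hk : k = (Q*(b-a)+b*(Q-P))/2) (T δ : ℂ)
    (hT : T = (2*D-3-(Q-P)*(b-a)-(a-1-D*P)+b*Q-a*P)/2) (hδ : δ = b*Q-2*T-4) :
    (oo4S * oo4T a b P Q D C k + oo4T a b P Q D C k * oo4S) * (oo4S * oo4T a b P Q D C k + oo4T a b P Q D C k * oo4S)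
      - T • (oo4S * oo4T a b P Q D C k + oo4T a b P Q D C k * oo4S) + δ • (1 : Matrix (Fin 4) (Fin 4) ℂ) = 0 := by
  obtain ⟨x1, hx1⟩ : ∃ x, x = ((C+D-1)+(-a+a*(Q-P)))/2 := ⟨_, rfl⟩
  obtain ⟨x2, hx2⟩ : ∃ x, x = (-D*P+(-C+D+(k-(b-a+1))))/2 := ⟨_, rfl⟩
  obtain ⟨x3, hx3⟩ : ∃ x, x = ((-C-D-(k+(b-a+1))) + -a)/2 := ⟨_, rfl⟩
  obtain ⟨x4, hx4⟩ : ∃ x, x = ((D*P-P*(a-b)) + (-C+D-1))/2 := ⟨_, rfl⟩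
  obtain ⟨y1, hy1⟩ : ∃ x, x = ((a-2)+(-C-D+(k+(b-a+1))))/2 := ⟨_, rfl⟩
  obtain ⟨y2, hy2⟩ : ∃ x, x = ((C-D-1)+(D*P+P*(a-b)))/2 := ⟨_, rfl⟩
  obtain ⟨y3, hy3⟩ : ∃ x, x = ((-a-a*(Q-P))+(-C-D-1))/2 := ⟨_, rfl⟩
  obtain ⟨y4, hy4⟩ : ∃ x, x = ((-C+D-(k-(b-a+1)))+(2+D*P))/2 := ⟨_, rfl⟩
  have e : oo4S * oo4T a b P Q D C k + oo4T a b P Q D C k * oo4S =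
    !![x1,x2,y1,y2;x3,x4,y3,y4;y1,y2,x1,x2;y3,y4,x3,x4] := by
    unfold oo4T oo4S
    rw [hx1, hx2, hx3, hx4, hy1, hy2, hy3, hy4]
    ext i j; fin_cases i <;> fin_cases j <;> simp [Matrix.mul_apply, Fin.sum_univ_four] <;> ring
  rw [e]
  have f1 : x1*x1+x2*x3+y1*y1+y2*y3-T*x1+δ=0 := by
    rw [hx1, hx2, hx3, hy1, hy2, hy3]; subst hδ hT hk hC hb; ring
  have f2 : x1*x2+x2*x4+y1*y2+y2*y4-T*x2=0 := by
    rw [hx1, hx2, hx4, hy1, hy2, hy4]; subst hδ hT hk hC hb; ring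
  have f3 : x3*x1+x4*x3+y3*y1+y4*y3-T*x3=0 := by
    rw [hx1, hx3, hx4, hy1, hy3, hy4]; subst hδ hT hk hC hb; ring
  have f4 : x3*x2+x4*x4+y3*y2+y4*y4-T*x4+δ=0 := by
    rw [hx2, hx3, hx4, hy2, hy3, hy4]; subst hδ hT hk hC hb; ring
  have g1 : x1*y1+x2*y3+y1*x1+y2*x3-T*y1=0 := by
    rw [hx1, hx2, hx3, hy1, hy2, hy3]; subst hδ hT hk hC hb; ring
  have g2 : x1*y2+x2*y4+y1*x2+y2*x4-T*y2=0 := by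
    rw [hx1, hx2, hx4, hy1, hy2, hy4]; subst hδ hT hk hC hb; ring
  have g3 : x3*y1+x4*y3+y3*x1+y4*x3-T*y3=0 := by
    rw [hx1, hx3, hx4, hy1, hy3, hy4]; subst hδ hT hk hC hb; ring
  have g4 : x3*y2+x4*y4+y3*x2+y4*x4-T*y4=0 := by
    rw [hx2, hx3, hx4, hy2, hy3, hy4]; subst hδ hT hk hC hb; ring
  ext i j; fin_cases i <;> fin_cases j <;> simp [Matrix.mul_apply, Fin.sum_univ_four]
  · linear_combination f1
  · linear_combination f2
  · linear_combination g1
  · linear_combination g2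
  · linear_combination f3
  · linear_combination f4
  · linear_combination g3
  · linear_combination g4
  · linear_combination g1
  · linear_combination g2
  · linear_combination f1
  · linear_combination f2
  · linear_combination g3
  · linear_combination g4
  · linear_combination f3
  · linear_combination f4

end SeedOO4b


open Equiv
set_option linter.all false

section SeedOO4c

theorem rf_OO4 (m n : ℕ) (hm : 2 ≤ m) (hn : 2 ≤ n) :
    ResiduallyFinite (Artin3 (len true m) (len true n) (len false 2)) := by
  obtain ⟨ω, x, hω, hx, hωx, hωx2⟩ := oo4_real m hm
  obtain ⟨τ, y, hτ, hy, hτy, hτy2⟩ := oo4_real n hn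
  have nE : ∀ x : ℝ, 0.61 < x → (((x:ℂ)+2)*x^2) ≠ 0 := by
    intro x hx h
    have : (((x+2)*x^2 : ℝ) : ℂ) = 0 := by push_cast; exact h
    rw [Complex.ofReal_eq_zero] at this
    have : 0 < (x+2)*x^2 := by positivity
    linarith
  obtain ⟨a, b, P, Q, D, hD, hE, hE', hP, hQ, h2⟩ := oo4_params (((x:ℂ)+2)*x^2) (((y:ℂ)+2)*y^2)
    (((y:ℂ)+2)*y^2 - ((x:ℂ)+2)*x^2 + (x + (x^2-2)) - (y + (y^2-2))) ((x + (x^2-2)) + (y + (y^2-2)) + 3)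
    (nE x hx) (nE y hy) (by
      intro h
      have : ((((x + (x^2-2)) + (y + (y^2-2)) + 3) + (x+2)*x^2 + (y+2)*y^2 : ℝ) : ℂ) = 0 := by
        push_cast; exact h
      rw [Complex.ofReal_eq_zero] at this
      have e1 : 0 < (x+2)*x^2 := by positivity
      have e2 : 0 < (y+2)*y^2 := by positivity
      nlinarith)
  have hb : b = D*Q-D*P+a-2 := by linear_combination hP - hQ
  obtain ⟨C, hC⟩ : ∃ C, C = (b+D*Q)/2 := ⟨_, rfl⟩
  obtain ⟨k, hk⟩ : ∃ k, k = (Q*(b-a)+b*(Q-P))/2 := ⟨_, rfl⟩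
  have tt := oo4_TT a b P Q D C k hb hC hk
  have tr := oo4_TR a b P Q D C k hb hC hk (ω+ω⁻¹+(ω^2+(ω^2)⁻¹)) ((ω+ω⁻¹)*(ω^2+(ω^2)⁻¹))
    (by rw [hωx, hωx2]; linear_combination (-1/2)*(h2 - hP + hE - hE')) 
    (by rw [hωx, hωx2]; linear_combination -hE)
  have st := oo4_ST a b P Q D C k hb hC hk (τ+τ⁻¹+(τ^2+(τ^2)⁻¹)) ((τ+τ⁻¹)*(τ^2+(τ^2)⁻¹))
    (by rw [hτy, hτy2]; linear_combination (-1/2)*(h2 + hP - hE + hE')) 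
    (by rw [hτy, hτy2]; linear_combination -hE')
  obtain ⟨j, hj⟩ : ∃ j : Fin 4 → ℂ, j = ![1,0,0,1] := ⟨_, rfl⟩
  obtain ⟨i, hi⟩ : ∃ j : Fin 4 → ℂ, j = ![a-1,C-D,C+D,-1-D*P] := ⟨_, rfl⟩
  have jr : Matrix.vecMul j oo4R = ![1,0,0,-1] := by
    rw [hj]; unfold oo4R
    ext i; fin_cases i <;> simp [Matrix.vecMul, dotProduct, Fin.sum_univ_four]
  have it : Matrix.vecMul i (oo4T a b P Q D C k) = ![1,0,0,-1] := by
    rw [hi]; subst hk hC hb; unfold oo4T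
    ext i; fin_cases i <;> simp [Matrix.vecMul, dotProduct, Fin.sum_univ_four] <;> ring
  have jst : Matrix.vecMul (Matrix.vecMul j oo4S) (oo4T a b P Q D C k) = -i - j := by
    rw [hi, hj]; subst hk hC hb; unfold oo4T oo4S
    ext i; fin_cases i <;> simp [Matrix.vecMul, dotProduct, Fin.sum_univ_four] <;> ring
  have jtrs : Matrix.vecMul (Matrix.vecMul (Matrix.vecMul j (oo4T a b P Q D C k)) oo4R + j) oo4S = Matrix.vecMul j oo4R := by
    rw [jr, hj]; subst hk hC hb; unfold oo4T oo4S oo4R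
    ext i; fin_cases i <;> simp [Matrix.vecMul, dotProduct, Fin.sum_univ_four] <;> ring
  have i12 : i 1 = 0 → i 2 = 0 → False := by
    intro h1 h2
    rw [hi] at h1 h2
    simp at h1 h2
    apply hD; linear_combination (h2 - h1)/2
  have j1 : j 1 = 0 := by rw [hj]; rfl
  have j2 : j 2 = 0 := by rw [hj]; rfl
  have j0 : j ≠ 0 := by
    intro h; have := congrFun h 0; rw [hj] at this; simp at this
  generalize oo4T a b P Q D C k = t at *
  have rr := oo4_RR
  have ss := oo4_SS
  have rs := oo4_RS
  generalize oo4R = r at *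
  generalize oo4S = s at *
  obtain ⟨s', hs'⟩ : ∃ x, x = aff s 0 := ⟨_, rfl⟩
  obtain ⟨r', hr'⟩ : ∃ x, x = aff r (j - Matrix.vecMul j r) := ⟨_, rfl⟩
  obtain ⟨b', hb'⟩ : ∃ x, x = aff (s*(t*r)) j := ⟨_, rfl⟩
  have ss' : s' * s' = 1 := by rw [hs', aff_mul, ss]; simp [aff_one]
  have rr' : r' * r' = 1 := by 
    rw [hr', aff_mul, rr, Matrix.sub_vecMul, Matrix.vecMul_vecMul, rr]; simp [aff_one]
  have hξ : s' * b' = aff (t*r) j := by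
    rw [hs', hb', aff_mul, ← mul_assoc, ss]; simp
  have hη : b' * r' = aff (s*t) j := by
    rw [hr', hb', aff_mul, mul_assoc, mul_assoc, rr]; simp
  have hz : (r'*b'*r')*(s'*b'*s') = aff (-1) j := by
    have : (r'*b'*r')*(s'*b'*s') = (r' * (b' * r')) * ((s' * b') * s') := by simp only [mul_assoc]
    rw [this, hξ, hη, hr', hs', aff_mul, aff_mul, aff_mul]
    have e1 : r * (s * t) * (t * r * s) = -1 := by
      rw [← rs]; simp only [mul_assoc]; rw [← mul_assoc t t, tt, one_mul]
    have e2 : s * t * (t * r * s) = - r := by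
      have : r * (r * (s * t) * (t * r * s)) = - r := by rw [e1]; simp
      rw [← this]; simp only [mul_assoc]; rw [← mul_assoc r r, rr, one_mul]
    rw [e1]
    congr 1
    rw [Matrix.add_vecMul, Matrix.vecMul_vecMul, e2, Matrix.vecMul_neg, Matrix.sub_vecMul, Matrix.vecMul_vecMul, rr,
      Matrix.vecMul_one]
    rw [Matrix.add_vecMul, ← Matrix.vecMul_vecMul, ← Matrix.vecMul_vecMul] at *
    rw [add_zero, add_assoc, jtrs]
    abel
  have vm : ∀ x : Fin 4 → ℂ, Matrix.vecMul x (-1) = -x := fun x => by rw [Matrix.vecMul_neg, Matrix.vecMul_one]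
  have hzz : aff (-1) j * aff (-1) j = 1 := by rw [aff_mul, vm]; simp [aff_one]
  have u1 : Matrix.vecMul (affPt (0 : Fin 4 → ℂ)) (aff (t*r) j) = affPt j := by rw [aff_vec]; simp
  have u2 : Matrix.vecMul (affPt (0 : Fin 4 → ℂ)) (aff (s*t) j) = affPt j := by rw [aff_vec]; simp
  have w1 : Matrix.vecMul (affPt (-i)) (aff (t*r) j) = affPt 0 := by
    rw [aff_vec, Matrix.neg_vecMul, ← Matrix.vecMul_vecMul, it, ← jr, Matrix.vecMul_vecMul, rr]; simp
  have v1 : Matrix.vecMul (affPt j) (aff (s*t) j) = affPt (-i) := by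
    rw [aff_vec, ← Matrix.vecMul_vecMul, jst]; simp
  have X := aff_ord t r tt rr j m hm ω hω tr
  have Y := aff_ord s t ss tt j n hn τ hτ st
  have hj0 : affPt j ≠ affPt 0 := fun h => j0 (affPt_inj _ _ h)
  rw [← hξ] at X w1 u1
  rw [← hη] at Y v1 u2
  have XX := odd_x s' b' m ss' X.1 (affPt 0) (affPt (-i)) w1 (X.2 _ (by rw [u1]; exact hj0))
  have YY := odd_y b' r' n rr' Y.1 (affPt 0) (affPt j) u2 (Y.2 _ (by rw [u2]; exact hj0))
  refine rf_of_matrix_seed true true m n 2 hm hn (by omega) (ι := Fin 4 ⊕ Unit)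
    (s'*b'*s') b' (r'*b'*r') (affPt 0) (affPt j) (affPt (-i))
    { hb := ?_, hc := ?_, ha := ?_, z1 := ?_, zu := fun k h1 h2 => ?_, zw := fun k h1 h2 => ?_, 
      zuw := fun k hk => ?_
      xo := fun _ => XX
      xe := fun h => by simp at h
      yo := fun _ => YY
      ye := fun h => by simp at h }
  · rw [hb', aff_vec]; simp
  · rw [mul_assoc, ← Matrix.vecMul_vecMul]
    have : Matrix.vecMul (affPt j) r' = affPt j := by rw [hr', aff_vec]; simp
    rw [this, v1]
  · rw [← Matrix.vecMul_vecMul, w1, hs', aff_vec]; simp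
  · rw [hz, pow_two, hzz]
  · have : k = 1 := by omega
    subst this
    rw [hz, pow_one, aff_vec, vm]
    simpa using hj0
  · have : k = 1 := by omega
    subst this
    rw [hz, pow_one, aff_vec, vm]
    intro h
    have h := affPt_inj _ _ h
    have a1 := congrFun h 1
    have a2 := congrFun h 2
    simp [j1, j2] at a1 a2
    exact i12 (by linear_combination a1/2) (by linear_combination a2/2)
  · have : k = 0 ∨ k = 1 := by omega
    rcases this with rfl | rfl
    · rw [pow_zero, Matrix.vecMul_one]
      intro h
      have h := affPt_inj _ _ h
      have a1 := congrFun h 1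
      have a2 := congrFun h 2
      simp at a1 a2
      exact i12 a1 a2
    · rw [hz, pow_one, aff_vec, vm]
      intro h
      have h := affPt_inj _ _ h
      have a1 := congrFun h 1
      have a2 := congrFun h 2
      simp [j1, j2] at a1 a2
      exact i12 a1 a2

end SeedOO4c


open Equiv
set_option linter.all false

section Symmetry

theorem rf_of_retract {G H : Type} [Group G] [Group H] (φ : G →* H) (ψ : H →* G)
    (h : ψ.comp φ = MonoidHom.id G) (hH : ResiduallyFinite H) : ResiduallyFinite G := by
  intro g hg
  have : φ g ≠ 1 := by
    intro h1
    apply hg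
    have := DFunLike.congr_fun h g
    simp [h1] at this
    exact this.symm
  obtain ⟨Q, i1, i2, θ, hθ⟩ := hH _ this
  exact ⟨Q, i1, i2, θ.comp φ, hθ⟩

theorem map_altWord {V W : Type} (σ : V → W) (i j : V) (K : ℕ) :
    FreeGroup.map σ (altWord i j K) = altWord (σ i) (σ j) K := by
  unfold altWord
  rw [map_list_prod, List.map_map]
  congr 1
  apply List.map_congr_left
  intro k _
  simp only [Function.comp]
  split_ifs <;> simp

theorem alt_rel01 (M N P : ℕ) : PresentedGroup.mk (artinRels3 M N P) (altWord 0 1 M) =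
    PresentedGroup.mk (artinRels3 M N P) (altWord 1 0 M) := by
  have := PresentedGroup.one_of_mem (rels := artinRels3 M N P) (x := altWord 0 1 M * (altWord 1 0 M)⁻¹) (by simp [artinRels3])
  rw [map_mul, map_inv] at this
  exact mul_inv_eq_one.mp this

theorem alt_rel12 (M N P : ℕ) : PresentedGroup.mk (artinRels3 M N P) (altWord 1 2 N) =
    PresentedGroup.mk (artinRels3 M N P) (altWord 2 1 N) := by
  have := PresentedGroup.one_of_mem (rels := artinRels3 M N P) (x := altWord 1 2 N * (altWord 2 1 N)⁻¹) (by simp [artinRels3])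
  rw [map_mul, map_inv] at this
  exact mul_inv_eq_one.mp this

theorem alt_rel20 (M N P : ℕ) : PresentedGroup.mk (artinRels3 M N P) (altWord 2 0 P) =
    PresentedGroup.mk (artinRels3 M N P) (altWord 0 2 P) := by
  have := PresentedGroup.one_of_mem (rels := artinRels3 M N P) (x := altWord 2 0 P * (altWord 0 2 P)⁻¹) (by simp [artinRels3])
  rw [map_mul, map_inv] at this
  exact mul_inv_eq_one.mp this

theorem exists_permuteHom (M N P M' N' P' : ℕ) (σ : Fin 3 → Fin 3)
    (h01 : PresentedGroup.mk (artinRels3 M' N' P') (altWord (σ 0) (σ 1) M) =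
      PresentedGroup.mk (artinRels3 M' N' P') (altWord (σ 1) (σ 0) M))
    (h12 : PresentedGroup.mk (artinRels3 M' N' P') (altWord (σ 1) (σ 2) N) =
      PresentedGroup.mk (artinRels3 M' N' P') (altWord (σ 2) (σ 1) N))
    (h20 : PresentedGroup.mk (artinRels3 M' N' P') (altWord (σ 2) (σ 0) P) =
      PresentedGroup.mk (artinRels3 M' N' P') (altWord (σ 0) (σ 2) P)) :
    ∃ φ : Artin3 M N P →* Artin3 M' N' P', ∀ i, φ (PresentedGroup.of i) = PresentedGroup.of (σ i) := by
  have hl : ∀ w : FreeGroup (Fin 3), FreeGroup.lift (fun i => (PresentedGroup.of (σ i) : Artin3 M' N' P')) w =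
      PresentedGroup.mk (artinRels3 M' N' P') (FreeGroup.map σ w) := by
    intro w
    have : FreeGroup.lift (fun i => (PresentedGroup.of (σ i) : Artin3 M' N' P')) =
      (PresentedGroup.mk (artinRels3 M' N' P')).comp (FreeGroup.map σ) := by
      ext i; simp [PresentedGroup.of]
    rw [this]; rfl
  have hr : ∀ w ∈ artinRels3 M N P, FreeGroup.lift (fun i => (PresentedGroup.of (σ i) : Artin3 M' N' P')) w = 1 := by
    intro w hw
    rw [hl]
    simp only [artinRels3, Set.mem_insert_iff, Set.mem_singleton_iff] at hw
    rcases hw with rfl | rfl | rfl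
    · rw [map_mul, map_mul, map_inv, map_inv, map_altWord, map_altWord, h01, mul_inv_cancel]
    · rw [map_mul, map_mul, map_inv, map_inv, map_altWord, map_altWord, h12, mul_inv_cancel]
    · rw [map_mul, map_mul, map_inv, map_inv, map_altWord, map_altWord, h20, mul_inv_cancel]
  exact ⟨PresentedGroup.toGroup hr, fun i => PresentedGroup.toGroup.of hr⟩

theorem rf_swap (M N P : ℕ) (h : ResiduallyFinite (Artin3 N M P)) : ResiduallyFinite (Artin3 M N P) := by
  obtain ⟨φ, hφ⟩ := exists_permuteHom M N P N M P ![2,1,0] (alt_rel12 N M P).symm (alt_rel01 N M P).symm (alt_rel20 N M P).symm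
  obtain ⟨ψ, hψ⟩ := exists_permuteHom N M P M N P ![2,1,0] (alt_rel12 M N P).symm (alt_rel01 M N P).symm (alt_rel20 M N P).symm
  refine rf_of_retract φ ψ ?_ h
  ext i
  fin_cases i <;> simp [hφ, hψ]

theorem rf_rot (M N P : ℕ) (h : ResiduallyFinite (Artin3 N P M)) : ResiduallyFinite (Artin3 M N P) := by
  obtain ⟨φ, hφ⟩ := exists_permuteHom M N P N P M ![2,0,1] (alt_rel20 N P M) (alt_rel01 N P M) (alt_rel12 N P M)
  obtain ⟨ψ, hψ⟩ := exists_permuteHom N P M M N P ![1,2,0] (alt_rel12 M N P) (alt_rel20 M N P) (alt_rel01 M N P)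
  refine rf_of_retract φ ψ ?_ h
  ext i
  fin_cases i <;> simp [hφ, hψ]

theorem rf_OE (M N P : ℕ) (hM : 4 ≤ M) (hN : 4 ≤ N) (hP : 4 ≤ P) (oM : Odd M) (eN : Even N) (eP : Even P)
    (h : ¬ (N = 4 ∧ P = 4)) : ResiduallyFinite (Artin3 M N P) := by
  obtain ⟨m, rfl⟩ := oM
  obtain ⟨n, rfl⟩ := eN
  obtain ⟨p, rfl⟩ := eP
  rw [← two_mul, ← two_mul] at *
  by_cases hp : p = 2
  · subst hp
    exact rf_OE4 m n (by omega) (by omega)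
  · by_cases hn : n = 2
    · subst hn
      apply rf_rot
      apply rf_swap
      apply rf_rot
      apply rf_rot
      exact rf_OE4 m p (by omega) (by omega)
    · exact rf_OEE3 m n p (by omega) (by omega) (by omega)

theorem rf_evenP (M N P : ℕ) (hM : 4 ≤ M) (hN : 4 ≤ N) (hP : 4 ≤ P) (eP : Even P)
    (h1 : ¬ (Odd M ∧ N = 4 ∧ P = 4)) (h2 : ¬ (Odd N ∧ M = 4 ∧ P = 4)) : ResiduallyFinite (Artin3 M N P) := by
  rcases Nat.even_or_odd M with eM | oM <;> rcases Nat.even_or_odd N with eN | oN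
  · obtain ⟨m, rfl⟩ := eM
    obtain ⟨n, rfl⟩ := eN
    obtain ⟨p, rfl⟩ := eP
    rw [← two_mul, ← two_mul, ← two_mul]
    exact rf_EEE m n p (by omega) (by omega) (by omega)
  · apply rf_swap
    exact rf_OE N M P hN hM hP oN eM eP (fun h => h2 ⟨oN, h⟩)
  · exact rf_OE M N P hM hN hP oM eN eP (fun h => h1 ⟨oM, h⟩)
  · obtain ⟨m, rfl⟩ := oM
    obtain ⟨n, rfl⟩ := oN
    obtain ⟨p, rfl⟩ := eP
    rw [← two_mul]
    by_cases hp : p = 2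
    · subst hp
      exact rf_OO4 m n (by omega) (by omega)
    · exact rf_OOE3 m n p (by omega) (by omega) (by omega)

end Symmetry

theorem artin3_oneEven_residuallyFinite (M N P : ℕ) (hM : 4 ≤ M) (hN : 4 ≤ N) (hP : 4 ≤ P)
    (he : Even M ∨ Even N ∨ Even P)
    (h : ¬ ((Odd M ∧ N = 4 ∧ P = 4) ∨ (Odd N ∧ M = 4 ∧ P = 4) ∨ (Odd P ∧ M = 4 ∧ N = 4))) :
    ResiduallyFinite (Artin3 M N P) := by
  simp only [not_or] at h
  obtain ⟨h1, h2, h3⟩ := h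
  rcases he with e | e | e
  · apply rf_rot
    exact rf_evenP N P M hN hP hM e (fun h => h2 ⟨h.1, h.2.2, h.2.1⟩) (fun h => h3 ⟨h.1, h.2.2, h.2.1⟩)
  · apply rf_rot
    apply rf_rot
    exact rf_evenP P M N hP hM hN e h3 (fun h => h1 ⟨h.1, h.2.2, h.2.1⟩)
  · exact rf_evenP M N P hM hN hP e h1 h2
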